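/- arXiv:2103.12113 — 3 statements merged into one kernel-verified Lean document; each statement's English description precedes it below -/
import Mathlib

section
/- Suppose 1, θ₁, …, θₙ are linearly independent over ℚ and ω < ∞. Then λ̂ ≤ ω^{n−1}/ω̂ⁿ. -/
open scoped ENNReal

/-- Solvability of the simultaneous approximation system
`max_{1≤i≤n} |x₀θᵢ - xᵢ| ≤ t^{-γ}`, `0 < |x₀| ≤ t` in integers. -/
def SimSolvable (n : ℕ) (θ : Fin n → ℝ) (γ t : ℝ) : Prop :=
  ∃ x : Fin (n+1) → ℤ, x 0 ≠ 0 ∧ (|x 0| : ℝ) ≤ t ∧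
    ∀ i : Fin n, |(x 0 : ℝ) * θ i - (x i.succ : ℝ)| ≤ t ^ (-γ)

/-- Solvability of the linear form system
`|x₀ + θ₁x₁ + … + θₙxₙ| ≤ t^{-γ}`, `0 < max_{1≤i≤n} |xᵢ| ≤ t` in integers. -/
def LinSolvable (n : ℕ) (θ : Fin n → ℝ) (γ t : ℝ) : Prop :=
  ∃ x : Fin (n+1) → ℤ, (∃ i : Fin n, x i.succ ≠ 0) ∧ (∀ i : Fin n, (|x i.succ| : ℝ) ≤ t) ∧
    |(x 0 : ℝ) + ∑ i : Fin n, θ i * (x i.succ : ℝ)| ≤ t ^ (-γ)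

/-- The regular simultaneous Diophantine exponent `λ(θ) ∈ [0,∞]`. -/
noncomputable def lambdaExp (n : ℕ) (θ : Fin n → ℝ) : ℝ≥0∞ :=
  sSup {e : ℝ≥0∞ | ∃ γ : ℝ, 0 < γ ∧ e = ENNReal.ofReal γ ∧
    ∀ T : ℝ, ∃ t : ℝ, T < t ∧ SimSolvable n θ γ t}

/-- The uniform simultaneous Diophantine exponent `λ̂(θ) ∈ [0,∞]`. -/
noncomputable def lambdaHatExp (n : ℕ) (θ : Fin n → ℝ) : ℝ≥0∞ :=
  sSup {e : ℝ≥0∞ | ∃ γ : ℝ, 0 < γ ∧ e = ENNReal.ofReal γ ∧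
    ∃ T : ℝ, ∀ t : ℝ, T < t → SimSolvable n θ γ t}

/-- The regular linear form Diophantine exponent `ω(θ) ∈ [0,∞]`. -/
noncomputable def omegaExp (n : ℕ) (θ : Fin n → ℝ) : ℝ≥0∞ :=
  sSup {e : ℝ≥0∞ | ∃ γ : ℝ, 0 < γ ∧ e = ENNReal.ofReal γ ∧
    ∀ T : ℝ, ∃ t : ℝ, T < t ∧ LinSolvable n θ γ t}

/-- The uniform linear form Diophantine exponent `ω̂(θ) ∈ [0,∞]`. -/
noncomputable def omegaHatExp (n : ℕ) (θ : Fin n → ℝ) : ℝ≥0∞ :=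
  sSup {e : ℝ≥0∞ | ∃ γ : ℝ, 0 < γ ∧ e = ENNReal.ofReal γ ∧
    ∃ T : ℝ, ∀ t : ℝ, T < t → LinSolvable n θ γ t}

namespace TransferenceProof

section Gram

open scoped InnerProductSpace

variable {E : Type*} [NormedAddCommGroup E] [InnerProductSpace ℝ E]

/-- The Gram determinant of a finite family of vectors. -/
noncomputable def gramDet {ι : Type*} [Fintype ι] [DecidableEq ι] (v : ι → E) : ℝ :=
  (Matrix.gram ℝ v).det

lemma gramDet_nonneg {ι : Type*} [Fintype ι] [DecidableEq ι] (v : ι → E) : 0 ≤ gramDet v :=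
  (Matrix.posSemidef_gram ℝ v).det_nonneg

lemma gramDet_comp_equiv {ι κ : Type*} [Fintype ι] [DecidableEq ι] [Fintype κ] [DecidableEq κ]
    (e : κ ≃ ι) (v : ι → E) : gramDet (v ∘ e) = gramDet v :=
  Matrix.det_submatrix_equiv_self e (Matrix.gram ℝ v)

lemma gramDet_sum_smul {ι : Type*} [Fintype ι] [DecidableEq ι] (T : Matrix ι ι ℝ) (v : ι → E) :
    gramDet (fun i ↦ ∑ j, T i j • v j) = T.det ^ 2 * gramDet v := by
  have : Matrix.gram ℝ (fun i ↦ ∑ j, T i j • v j) = T * Matrix.gram ℝ v * T.transpose := by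
    ext i j
    simp only [Matrix.gram_apply, Matrix.mul_apply, Matrix.transpose_apply, sum_inner, inner_sum,
      inner_smul_left, inner_smul_right, Finset.sum_mul]
    refine Finset.sum_congr rfl fun a _ ↦ ?_
    rw [Finset.mul_sum]
    refine Finset.sum_congr rfl fun b _ ↦ ?_
    simp
    ring
  rw [gramDet, gramDet, this, Matrix.det_mul, Matrix.det_mul, Matrix.det_transpose]
  ring

lemma gramDet_unit (y : E) : gramDet (fun _ : Unit ↦ y) = ‖y‖ ^ 2 := by
  simp [gramDet]

lemma gramDet_of_isEmpty {ι : Type*} [Fintype ι] [DecidableEq ι] [IsEmpty ι] (v : ι → E) :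
    gramDet v = 1 := by
  simp [gramDet]

lemma exists_orthogonal_component {ι : Type*} [Fintype ι] (v : ι → E) (y : E) :
    ∃ z : E, y - z ∈ Submodule.span ℝ (Set.range v) ∧
      ∀ w ∈ Submodule.span ℝ (Set.range v), ⟪w, z⟫_ℝ = 0 := by
  have : FiniteDimensional ℝ (Submodule.span ℝ (Set.range v)) :=
    FiniteDimensional.span_of_finite ℝ (Set.finite_range v)
  set S := Submodule.span ℝ (Set.range v)
  refine ⟨y - S.starProjection y, by simp, fun w hw ↦ ?_⟩
  exact (S.sub_starProjection_mem_orthogonal y) w hw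

lemma gramDet_sumElim_unit {ι : Type*} [Fintype ι] [DecidableEq ι] (v : ι → E) {y z : E}
    (h : y - z ∈ Submodule.span ℝ (Set.range v)) (hz : ∀ i, ⟪v i, z⟫_ℝ = 0) :
    gramDet (Sum.elim v (fun _ : Unit ↦ y)) = gramDet v * ‖z‖ ^ 2 := by
  obtain ⟨c, hc⟩ := (Submodule.mem_span_range_iff_exists_fun ℝ).1 h
  let T : Matrix (ι ⊕ Unit) (ι ⊕ Unit) ℝ :=
    Matrix.fromBlocks 1 0 (Matrix.of fun _ i ↦ c i) 1
  have h1 : Sum.elim v (fun _ : Unit ↦ y) =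
      fun i ↦ ∑ j, T i j • (Sum.elim v (fun _ : Unit ↦ z)) j := by
    funext i
    rcases i with i | i
    · simp [T, Matrix.one_apply]
    · simp [T, hc]
  have h2 : T.det = 1 := by simp [T]
  have h3 : Matrix.gram ℝ (Sum.elim v (fun _ : Unit ↦ z)) =
      Matrix.fromBlocks (Matrix.gram ℝ v) 0 0 (Matrix.of fun _ _ ↦ ‖z‖ ^ 2) := by
    ext i j
    have hz' : ∀ i, ⟪z, v i⟫_ℝ = 0 := fun i ↦ by rw [real_inner_comm, hz]
    rcases i with i | i <;> rcases j with j | j <;> simp [hz, hz']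
  rw [h1, gramDet_sum_smul, h2, gramDet, h3, Matrix.det_fromBlocks_zero₁₂]
  simp [gramDet]

lemma gramDet_sumElim_option {γ τ : Type*} [Fintype γ] [DecidableEq γ] [Fintype τ]
    [DecidableEq τ] [DecidableEq (Option τ)] (a : γ → E) (v : Option τ → E) :
    gramDet (Sum.elim a v) =
      gramDet (Sum.elim (Sum.elim a (v ∘ some)) (fun _ : Unit ↦ v none)) := by
  let e : (γ ⊕ τ) ⊕ Unit ≃ γ ⊕ Option τ :=
    (Equiv.sumAssoc γ τ Unit).trans
      (Equiv.sumCongr (Equiv.refl γ) (Equiv.optionEquivSumPUnit τ).symm)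
  rw [← gramDet_comp_equiv e]
  congr 1
  funext i
  rcases i with (i | i) | i <;> rfl

lemma gramDet_sumElim_comp {γ σ τ : Type*} [Fintype γ] [DecidableEq γ] [Fintype τ]
    [DecidableEq τ] [Fintype σ] [DecidableEq σ] (e : τ ≃ σ) (a : γ → E) (v : σ → E) :
    gramDet (Sum.elim a (v ∘ e)) = gramDet (Sum.elim a v) := by
  rw [← gramDet_comp_equiv (Equiv.sumCongr (Equiv.refl γ) e)]
  congr 1
  funext i
  rcases i with i | i <;> rfl

lemma gramDet_sumElim_mul_le {α β τ : Type*} [Fintype α] [DecidableEq α] [Fintype β]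
    [DecidableEq β] [Fintype τ] [DecidableEq τ] (a : α → E) (b : β → E) (v : τ → E)
    (hab : ∀ i, b i ∈ Submodule.span ℝ (Set.range a)) :
    gramDet (Sum.elim a v) * gramDet b ≤ gramDet (Sum.elim b v) * gramDet a := by
  classical
  refine Fintype.induction_empty_option (P := fun τ [Fintype τ] ↦ ∀ [DecidableEq τ] (v : τ → E),
      gramDet (Sum.elim a v) * gramDet b ≤ gramDet (Sum.elim b v) * gramDet a) ?_ ?_ ?_ τ v
  · intro τ σ _ e hτ _ v
    let _ := Fintype.ofEquiv σ e.symm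
    have := hτ (v ∘ e)
    rwa [gramDet_sumElim_comp, gramDet_sumElim_comp] at this
  · intro _ v
    have ha' : Sum.elim a v = a ∘ (Equiv.sumEmpty α PEmpty) := by
      funext i; rcases i with i | i
      · rfl
      · exact i.elim
    have hb' : Sum.elim b v = b ∘ (Equiv.sumEmpty β PEmpty) := by
      funext i; rcases i with i | i
      · rfl
      · exact i.elim
    rw [ha', hb', gramDet_comp_equiv, gramDet_comp_equiv, mul_comm]
  · intro τ _ ih _ v
    rw [gramDet_sumElim_option, gramDet_sumElim_option]
    obtain ⟨za, ha1, ha2⟩ := exists_orthogonal_component (Sum.elim a (v ∘ some)) (v none)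
    obtain ⟨zb, hb1, hb2⟩ := exists_orthogonal_component (Sum.elim b (v ∘ some)) (v none)
    rw [gramDet_sumElim_unit _ ha1 (fun i ↦ ha2 _ (Submodule.subset_span ⟨i, rfl⟩)),
      gramDet_sumElim_unit _ hb1 (fun i ↦ hb2 _ (Submodule.subset_span ⟨i, rfl⟩))]
    have hsub : Submodule.span ℝ (Set.range (Sum.elim b (v ∘ some))) ≤
        Submodule.span ℝ (Set.range (Sum.elim a (v ∘ some))) := by
      rw [Submodule.span_le]
      rintro _ ⟨i, rfl⟩
      rcases i with i | i
      · refine Submodule.span_mono ?_ (hab i)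
        rintro _ ⟨j, rfl⟩
        exact ⟨Sum.inl j, rfl⟩
      · exact Submodule.subset_span ⟨Sum.inr i, rfl⟩
    have hz : ‖za‖ ^ 2 ≤ ‖zb‖ ^ 2 := by
      have hd : zb - za ∈ Submodule.span ℝ (Set.range (Sum.elim a (v ∘ some))) := by
        have := Submodule.sub_mem _ ha1 (hsub hb1)
        simpa using! this
      have h0 := ha2 _ hd
      have : ‖zb‖ ^ 2 = ‖zb - za‖ ^ 2 + ‖za‖ ^ 2 := by
        conv_lhs => rw [show zb = (zb - za) + za by abel]
        rw [norm_add_sq_real, h0]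
        ring
      nlinarith [sq_nonneg ‖zb - za‖]
    have := ih (v ∘ some)
    have g1 := gramDet_nonneg (Sum.elim a (v ∘ some))
    have g2 := gramDet_nonneg b
    nlinarith [mul_le_mul this hz (sq_nonneg _)
      (mul_nonneg (gramDet_nonneg (Sum.elim b (v ∘ some))) (gramDet_nonneg a))]

end Gram

section Lattice

variable {σ : Type*}

/-- The coordinatewise embedding `ℤ^σ → K^σ`. -/
def castVec (K : Type*) [Ring K] : (σ → ℤ) →ₗ[ℤ] (σ → K) where
  toFun y i := (y i : K)
  map_add' x y := by ext; simp
  map_smul' c x := by ext; simp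

@[simp] lemma castVec_apply (K : Type*) [Ring K] (y : σ → ℤ) (i : σ) :
    castVec K y i = (y i : K) := rfl

lemma castVec_injective (K : Type*) [Ring K] [CharZero K] :
    Function.Injective (castVec K : (σ → ℤ) →ₗ[ℤ] (σ → K)) := fun x y h ↦ by
  funext i
  have : (x i : K) = y i := congrFun h i
  exact_mod_cast this

/-- The integer points of a rational subspace. -/
def lat (W : Submodule ℚ (σ → ℚ)) : Submodule ℤ (σ → ℤ) :=
  (W.restrictScalars ℤ).comap (castVec ℚ)

lemma mem_lat {W : Submodule ℚ (σ → ℚ)} {y : σ → ℤ} : y ∈ lat W ↔ castVec ℚ y ∈ W := Iff.rfl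

lemma lat_mono {W W' : Submodule ℚ (σ → ℚ)} (h : W' ≤ W) : lat W' ≤ lat W := fun _ hy ↦ h hy

lemma linearIndependent_castVec {ι : Type*} {v : ι → σ → ℤ} (h : LinearIndependent ℤ v) :
    LinearIndependent ℚ (fun i ↦ castVec ℚ (v i)) := by
  rw [← LinearIndependent.iff_fractionRing ℤ ℚ]
  exact h.map' (castVec ℚ) (LinearMap.ker_eq_bot.2 (castVec_injective ℚ))

lemma linearIndependent_castVec_basis {ι : Type*} {W : Submodule ℚ (σ → ℚ)}
    (b : Module.Basis ι ℤ (lat W)) :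
    LinearIndependent ℤ (fun i ↦ (b i : σ → ℤ)) :=
  b.linearIndependent.map' (lat W).subtype (Submodule.ker_subtype _)

variable [Fintype σ]

lemma exists_smul_eq_castVec (w : σ → ℚ) :
    ∃ (d : ℤ) (y : σ → ℤ), d ≠ 0 ∧ (d : ℚ) • w = castVec ℚ y := by
  obtain ⟨b, hb⟩ := IsLocalization.exist_integer_multiples_of_finite (nonZeroDivisors ℤ) w
  choose y hy using hb
  refine ⟨b, y, nonZeroDivisors.coe_ne_zero b, ?_⟩
  funext i
  have := hy i
  simp only [castVec_apply, Pi.smul_apply, smul_eq_mul]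
  simpa [Submonoid.smul_def] using this.symm

lemma span_castVec_basis {ι : Type*} {W : Submodule ℚ (σ → ℚ)} (b : Module.Basis ι ℤ (lat W)) :
    Submodule.span ℚ (Set.range fun i ↦ castVec ℚ (b i : σ → ℤ)) = W := by
  refine le_antisymm ?_ fun w hw ↦ ?_
  · rw [Submodule.span_le]
    rintro _ ⟨i, rfl⟩
    exact (b i).2
  · obtain ⟨d, y, hd, hy⟩ := exists_smul_eq_castVec w
    have hyW : y ∈ lat W := by
      rw [mem_lat, ← hy]
      exact W.smul_mem _ hw
    have h1 : y ∈ Submodule.span ℤ (Set.range fun i ↦ (b i : σ → ℤ)) := by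
      have h2 : (⟨y, hyW⟩ : lat W) ∈ Submodule.span ℤ (Set.range b) := by
        rw [b.span_eq]; trivial
      have h3 := Submodule.mem_map_of_mem (f := (lat W).subtype) h2
      rw [Submodule.map_span, ← Set.range_comp] at h3
      exact h3
    have h4 : castVec ℚ y ∈ Submodule.span ℚ (Set.range fun i ↦ castVec ℚ (b i : σ → ℤ)) := by
      have h5 := Submodule.mem_map_of_mem (f := castVec ℚ) h1
      rw [Submodule.map_span, ← Set.range_comp] at h5
      exact Submodule.span_le_restrictScalars ℤ ℚ _ h5
    have h6 : w = (d : ℚ)⁻¹ • castVec ℚ y := by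
      rw [← hy, smul_smul, inv_mul_cancel₀ (by exact_mod_cast hd), one_smul]
    rw [h6]
    exact Submodule.smul_mem _ _ h4

lemma card_basis_lat {ι : Type*} [Fintype ι] {W : Submodule ℚ (σ → ℚ)}
    (b : Module.Basis ι ℤ (lat W)) : Fintype.card ι = Module.finrank ℚ W := by
  rw [← finrank_span_eq_card (linearIndependent_castVec (linearIndependent_castVec_basis b)),
    span_castVec_basis]

/-- A chosen basis of the integer points of a rational subspace. -/
noncomputable def latBasis (W : Submodule ℚ (σ → ℚ)) :
    Module.Basis (Fin (Module.finrank ℚ W)) ℤ (lat W) :=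
  (Module.Free.chooseBasis ℤ (lat W)).reindex
    (Fintype.equivFinOfCardEq (card_basis_lat (Module.Free.chooseBasis ℤ (lat W))))

lemma exists_basis_extension {W W' : Submodule ℚ (σ → ℚ)} (h : W' ≤ W) :
    ∃ (k : ℕ) (b : Module.Basis (Fin (Module.finrank ℚ W') ⊕ Fin k) ℤ (lat W)),
      ∀ i, (b (Sum.inl i) : σ → ℤ) = latBasis W' i := by
  let Λ := (lat W').submoduleOf (lat W)
  have : Module.IsTorsionFree ℤ (lat W ⧸ Λ) := by
    refine Module.IsTorsionFree.of_smul_eq_zero fun d q hq ↦ ?_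
    induction q using Submodule.Quotient.induction_on with
    | H y =>
      by_contra! hcon
      refine hcon.2 ?_
      rw [← Submodule.Quotient.mk_smul, Submodule.Quotient.mk_eq_zero] at hq
      rw [Submodule.Quotient.mk_eq_zero]
      have h1 : castVec ℚ (d • (y : σ → ℤ)) ∈ W' := hq
      rw [map_smul] at h1
      change castVec ℚ (y : σ → ℤ) ∈ W'
      have h2 : castVec ℚ (y : σ → ℤ) = (d : ℚ)⁻¹ • (d • castVec ℚ (y : σ → ℤ)) := by
        rw [← Int.cast_smul_eq_zsmul ℚ, smul_smul,
          inv_mul_cancel₀ (by exact_mod_cast hcon.1), one_smul]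
      rw [h2]
      exact W'.smul_mem _ h1
  obtain ⟨k, bQ⟩ : Σ k, Module.Basis (Fin k) ℤ (lat W ⧸ Λ) := Module.basisOfFiniteTypeTorsionFree'
  let bW : Module.Basis _ ℤ Λ := (latBasis W').map (Submodule.submoduleOfEquivOfLe (lat_mono h)).symm
  refine ⟨k, bW.sumQuot bQ, fun i ↦ ?_⟩
  rw [Module.Basis.sumQuot_inl]
  rfl

section Covolume

variable {E : Type*} [NormedAddCommGroup E] [InnerProductSpace ℝ E] (ψ : (σ → ℝ) →ₗ[ℝ] E)

/-- The squared covolume of the image under `ψ` of the lattice of integer points of `W`. -/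
noncomputable def covol (W : Submodule ℚ (σ → ℚ)) : ℝ :=
  gramDet fun i ↦ ψ (castVec ℝ (latBasis W i : σ → ℤ))

lemma covol_nonneg (W : Submodule ℚ (σ → ℚ)) : 0 ≤ covol ψ W := gramDet_nonneg _

lemma covol_le_gramDet {ι : Type*} [Fintype ι] [DecidableEq ι] {W : Submodule ℚ (σ → ℚ)}
    {v : ι → σ → ℤ} (hv : ∀ i, v i ∈ lat W) (hli : LinearIndependent ℤ v)
    (hcard : Fintype.card ι = Module.finrank ℚ W) :
    covol ψ W ≤ gramDet fun i ↦ ψ (castVec ℝ (v i)) := by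
  let e := Fintype.equivFinOfCardEq hcard
  let b := (latBasis W).reindex e.symm
  let T : Matrix ι ι ℤ := Matrix.of fun i j ↦ b.repr ⟨v i, hv i⟩ j
  have h1 : ∀ i, v i = ∑ j, T i j • (b j : σ → ℤ) := fun i ↦ by
    have := congrArg (lat W).subtype (b.sum_repr ⟨v i, hv i⟩).symm
    rw [map_sum] at this
    exact this
  have hdet : T.det ≠ 0 := by
    intro h0
    obtain ⟨c, hc0, hc⟩ := Matrix.exists_vecMul_eq_zero_iff.2 h0
    refine hc0 (funext fun i ↦ ?_)
    refine Fintype.linearIndependent_iff.1 hli c ?_ i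
    simp_rw [h1, Finset.smul_sum, smul_smul]
    rw [Finset.sum_comm]
    refine Finset.sum_eq_zero fun j _ ↦ ?_
    rw [← Finset.sum_smul]
    have : ∑ i, c i * T i j = 0 := congrFun hc j
    rw [this, zero_smul]
  have h2 : (fun i ↦ ψ (castVec ℝ (v i))) =
      fun i ↦ ∑ j, (T.map (Int.cast : ℤ → ℝ)) i j • ψ (castVec ℝ (b j : σ → ℤ)) := by
    funext i
    rw [h1 i, map_sum, map_sum]
    refine Finset.sum_congr rfl fun j _ ↦ ?_
    rw [map_smul, ← Int.cast_smul_eq_zsmul ℝ, map_smul]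
    rfl
  have h3 : covol ψ W = gramDet fun j ↦ ψ (castVec ℝ (b j : σ → ℤ)) := by
    rw [covol, ← gramDet_comp_equiv e]
    congr 1
    funext j
    simp [b]
  have h4 : (T.map (Int.cast : ℤ → ℝ)).det = (T.det : ℝ) := (Int.cast_det T).symm
  have h5 : (1 : ℝ) ≤ (T.det : ℝ) ^ 2 := by
    have : 1 ≤ T.det ^ 2 := Int.one_le_abs hdet |> fun h ↦ by
      rw [← sq_abs]; nlinarith
    exact_mod_cast this
  rw [h2, gramDet_sum_smul, h4, h3]
  nlinarith [gramDet_nonneg fun j ↦ ψ (castVec ℝ (b j : σ → ℤ))]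

lemma covol_eq {ι : Type*} [Fintype ι] [DecidableEq ι] {W : Submodule ℚ (σ → ℚ)}
    (b : Module.Basis ι ℤ (lat W)) :
    gramDet (fun i ↦ ψ (castVec ℝ (b i : σ → ℤ))) = covol ψ W := by
  let e := (latBasis W).indexEquiv b
  refine le_antisymm ?_ (covol_le_gramDet ψ (fun i ↦ (b i).2)
    (linearIndependent_castVec_basis b) (card_basis_lat b))
  let T : Matrix ι ι ℤ := b.toMatrix ((latBasis W).reindex e)
  have hU : IsUnit T.det := Matrix.isUnit_det_of_right_inverse
    (b.toMatrix_mul_toMatrix_flip ((latBasis W).reindex e))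
  have h1 : ∀ i, (((latBasis W).reindex e) i : σ → ℤ) = ∑ j, T j i • (b j : σ → ℤ) := fun i ↦ by
    have := congrArg (lat W).subtype (b.sum_toMatrix_smul_self ((latBasis W).reindex e) i).symm
    rw [map_sum] at this
    exact this
  have h2 : (fun i ↦ ψ (castVec ℝ (((latBasis W).reindex e) i : σ → ℤ))) =
      fun i ↦ ∑ j, (T.transpose.map (Int.cast : ℤ → ℝ)) i j • ψ (castVec ℝ (b j : σ → ℤ)) := by
    funext i
    rw [h1 i, map_sum, map_sum]
    refine Finset.sum_congr rfl fun j _ ↦ ?_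
    rw [map_smul, ← Int.cast_smul_eq_zsmul ℝ, map_smul]
    rfl
  have h3 : covol ψ W = gramDet fun j ↦ ψ (castVec ℝ (((latBasis W).reindex e) j : σ → ℤ)) := by
    rw [covol, ← gramDet_comp_equiv e]
    congr 1
    funext j
    simp
  have h4 : (T.transpose.map (Int.cast : ℤ → ℝ)).det = (T.det : ℝ) := by
    rw [← Int.cast_det, Matrix.det_transpose]
  have h5 : (T.det : ℝ) ^ 2 = 1 := by
    have : T.det ^ 2 = 1 := by rw [← sq_abs, Int.isUnit_iff_abs_eq.1 hU, one_pow]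
    exact_mod_cast this
  rw [h3, h2, gramDet_sum_smul, h4, h5, one_mul]

lemma covol_bot : covol ψ ⊥ = 1 := by
  have : IsEmpty (Fin (Module.finrank ℚ (⊥ : Submodule ℚ (σ → ℚ)))) := by
    rw [finrank_bot]; infer_instance
  exact gramDet_of_isEmpty _

lemma covol_inf_mul_covol_sup_le (N M : Submodule ℚ (σ → ℚ)) :
    covol ψ (N ⊓ M) * covol ψ (N ⊔ M) ≤ covol ψ N * covol ψ M := by
  obtain ⟨k, bN, hbN⟩ := exists_basis_extension (inf_le_left : N ⊓ M ≤ N)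
  obtain ⟨l, bM, hbM⟩ := exists_basis_extension (inf_le_right : N ⊓ M ≤ M)
  let u : Fin l → σ → ℤ := fun i ↦ bM (Sum.inr i)
  let v : Fin k → σ → ℤ := fun i ↦ bN (Sum.inr i)
  have hM : (fun i ↦ (bM i : σ → ℤ)) = Sum.elim (fun i ↦ (latBasis (N ⊓ M) i : σ → ℤ)) u := by
    funext i
    rcases i with i | i
    · exact hbM i
    · rfl
  have hN : (fun i ↦ (bN i : σ → ℤ)) = Sum.elim (fun i ↦ (latBasis (N ⊓ M) i : σ → ℤ)) v := by
    funext i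
    rcases i with i | i
    · exact hbN i
    · rfl
  have hMli := linearIndependent_castVec_basis bM
  have hNli := linearIndependent_castVec_basis bN
  have hspanInf : Submodule.span ℤ (Set.range fun i ↦ (latBasis (N ⊓ M) i : σ → ℤ))
      = lat (N ⊓ M) := by
    have := congrArg (Submodule.map (lat (N ⊓ M)).subtype) (latBasis (N ⊓ M)).span_eq
    rw [Submodule.map_span, ← Set.range_comp, Submodule.map_top, Submodule.range_subtype] at this
    exact this
  have hli : LinearIndependent ℤ (Sum.elim (fun i ↦ (bM i : σ → ℤ)) v) := by
    rw [hN, linearIndependent_sum] at hNli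
    refine hMli.sum_type (by simpa using! hNli.2.1) ?_
    have hd := hNli.2.2
    rw [Submodule.disjoint_def] at hd ⊢
    intro x hx1 hx2
    refine hd x ?_ (by simpa using! hx2)
    have h1 : x ∈ lat M := by
      refine Submodule.span_le.2 ?_ hx1
      rintro _ ⟨i, rfl⟩
      exact (bM i).2
    have h2 : x ∈ lat N := by
      refine Submodule.span_le.2 ?_ hx2
      rintro _ ⟨i, rfl⟩
      exact (bN (Sum.inr i)).2
    have h3 : x ∈ lat (N ⊓ M) := ⟨h2, h1⟩
    rw [← hspanInf] at h3
    simpa using! h3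
  have hcard : Fintype.card ((Fin (Module.finrank ℚ (N ⊓ M : Submodule ℚ (σ → ℚ))) ⊕ Fin l) ⊕ Fin k) =
      Module.finrank ℚ (N ⊔ M : Submodule ℚ (σ → ℚ)) := by
    have h1 := card_basis_lat bN
    have h2 := card_basis_lat bM
    have h3 := Submodule.finrank_sup_add_finrank_inf_eq N M
    simp only [Fintype.card_sum, Fintype.card_fin] at h1 h2 ⊢
    omega
  have hsup : covol ψ (N ⊔ M) ≤
      gramDet fun i ↦ ψ (castVec ℝ ((Sum.elim (fun i ↦ (bM i : σ → ℤ)) v) i)) := by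
    refine covol_le_gramDet ψ ?_ hli hcard
    rintro (i | i)
    · exact lat_mono le_sup_right (bM i).2
    · exact lat_mono le_sup_left (bN (Sum.inr i)).2
  have hG := gramDet_sumElim_mul_le (fun i ↦ ψ (castVec ℝ (bM i : σ → ℤ)))
    (fun i ↦ ψ (castVec ℝ (latBasis (N ⊓ M) i : σ → ℤ)))
    (fun i ↦ ψ (castVec ℝ (v i)))
    (fun i ↦ Submodule.subset_span ⟨Sum.inl i, by simp only [hbM i]⟩)
  have e1 : (Sum.elim (fun i ↦ ψ (castVec ℝ (bM i : σ → ℤ))) fun i ↦ ψ (castVec ℝ (v i))) =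
      fun i ↦ ψ (castVec ℝ ((Sum.elim (fun i ↦ (bM i : σ → ℤ)) v) i)) := by
    funext i; rcases i with i | i <;> rfl
  have e2 : (Sum.elim (fun i ↦ ψ (castVec ℝ (latBasis (N ⊓ M) i : σ → ℤ)))
      fun i ↦ ψ (castVec ℝ (v i))) = fun i ↦ ψ (castVec ℝ (bN i : σ → ℤ)) := by
    funext i; rcases i with i | i
    · simp only [Sum.elim_inl, hbN i]
    · rfl
  rw [e1, e2, covol_eq ψ bN, covol_eq ψ bM] at hG
  calc _ ≤ covol ψ (N ⊓ M) * _ := mul_le_mul_of_nonneg_left hsup (covol_nonneg _ _)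
    _ ≤ _ := by rw [mul_comm]; exact hG

/-- The rational hyperplane orthogonal to an integer vector. -/
def perp (x : σ → ℤ) : Submodule ℚ (σ → ℚ) :=
  LinearMap.ker (∑ j, (x j : ℚ) • (LinearMap.proj j : (σ → ℚ) →ₗ[ℚ] ℚ))

lemma mem_perp {x : σ → ℤ} {w : σ → ℚ} : w ∈ perp x ↔ ∑ j, (x j : ℚ) * w j = 0 := by
  simp [perp, LinearMap.mem_ker]

lemma finrank_inf_perp {W : Submodule ℚ (σ → ℚ)} {x : σ → ℤ} (h : ¬ W ≤ perp x) :
    Module.finrank ℚ (W ⊓ perp x : Submodule ℚ (σ → ℚ)) + 1 = Module.finrank ℚ W := by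
  set f : (σ → ℚ) →ₗ[ℚ] ℚ := ∑ j, (x j : ℚ) • (LinearMap.proj j : (σ → ℚ) →ₗ[ℚ] ℚ) with hf
  have h1 := LinearMap.finrank_range_add_finrank_ker (f.domRestrict W)
  have h2 : LinearMap.range (f.domRestrict W) = ⊤ := by
    rw [LinearMap.range_eq_top]
    refine LinearMap.surjective ?_
    intro h0
    refine h fun w hw ↦ ?_
    exact LinearMap.congr_fun h0 ⟨w, hw⟩
  have h3 : Module.finrank ℚ (LinearMap.ker (f.domRestrict W)) =
      Module.finrank ℚ (W ⊓ perp x : Submodule ℚ (σ → ℚ)) := by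
    have : LinearMap.ker (f.domRestrict W) = (W ⊓ perp x).submoduleOf W := by
      ext w
      simp [Submodule.submoduleOf, perp, hf, LinearMap.mem_ker]
    rw [this]
    exact (Submodule.submoduleOfEquivOfLe inf_le_left).finrank_eq
  rw [h2, finrank_top, Module.finrank_self, h3] at h1
  omega

lemma covol_inf_perp_le {W : Submodule ℚ (σ → ℚ)} {x : σ → ℤ} (h : ¬ W ≤ perp x)
    {P : Submodule ℝ (σ → ℝ)} (hP : ∀ y ∈ lat W, castVec ℝ y ∈ P) {C : ℝ}
    (hC : ∀ y ∈ P, |∑ j, (x j : ℝ) * y j| ≤ C * ‖ψ y‖) :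
    covol ψ (W ⊓ perp x) ≤ C ^ 2 * covol ψ W := by
  obtain ⟨k, b, hb⟩ := exists_basis_extension (inf_le_left : W ⊓ perp x ≤ W)
  have hk : k = 1 := by
    have h1 := card_basis_lat b
    have h2 := finrank_inf_perp h
    simp only [Fintype.card_sum, Fintype.card_fin] at h1
    omega
  subst hk
  let b' := b.reindex (Equiv.sumCongr (Equiv.refl _)
    (Equiv.ofUnique (Fin 1) Unit))
  set u : σ → ℤ := (b (Sum.inr 0)).1 with hu
  have hbu : (fun i ↦ ψ (castVec ℝ (b' i : σ → ℤ))) =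
      Sum.elim (fun i ↦ ψ (castVec ℝ (latBasis (W ⊓ perp x) i : σ → ℤ)))
        (fun _ ↦ ψ (castVec ℝ u)) := by
    funext i
    rcases i with i | i
    · simp [b', hb]
    · simp only [b', hu, Module.Basis.reindex_apply, Sum.elim_inr]
      congr
  have hdot : ∀ w : σ → ℤ, ((∑ j, x j * w j : ℤ) : ℚ) = ∑ j, (x j : ℚ) * castVec ℚ w j := by
    intro w; simp
  have hux : ∑ j, x j * u j ≠ 0 := by
    intro h0
    refine h ?_
    rw [← span_castVec_basis b, Submodule.span_le]
    rintro _ ⟨i | i, rfl⟩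
    · simp only [hb]
      exact (latBasis (W ⊓ perp x) i).2.2
    · have : i = 0 := Subsingleton.elim _ _
      subst this
      rw [SetLike.mem_coe, mem_perp]
      change ∑ j, (x j : ℚ) * castVec ℚ u j = 0
      rw [← hdot, h0, Int.cast_zero]
  obtain ⟨z, hz1, hz2⟩ := exists_orthogonal_component
    (fun i ↦ ψ (castVec ℝ (latBasis (W ⊓ perp x) i : σ → ℤ))) (ψ (castVec ℝ u))
  have hG := gramDet_sumElim_unit _ hz1 (fun i ↦ hz2 _ (Submodule.subset_span ⟨i, rfl⟩))
  rw [← hbu, covol_eq ψ b'] at hG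
  obtain ⟨c, hc⟩ := (Submodule.mem_span_range_iff_exists_fun ℝ).1 hz1
  set y0 : σ → ℝ := ∑ i, c i • castVec ℝ (latBasis (W ⊓ perp x) i : σ → ℤ) with hy0
  have hψ : ψ (castVec ℝ u - y0) = z := by
    rw [map_sub, hy0, map_sum]
    simp only [map_smul, hc]
    abel
  have hmem : castVec ℝ u - y0 ∈ P := by
    refine P.sub_mem (hP _ (b (Sum.inr 0)).2) (P.sum_mem fun i _ ↦ P.smul_mem _ (hP _ ?_))
    exact (latBasis (W ⊓ perp x) i).2.1
  have hval : ∑ j, (x j : ℝ) * (castVec ℝ u - y0) j = ((∑ j, x j * u j : ℤ) : ℝ) := by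
    have h0 : ∑ j, (x j : ℝ) * y0 j = 0 := by
      have : ∀ i, ∑ j, (x j : ℝ) * castVec ℝ (latBasis (W ⊓ perp x) i : σ → ℤ) j = 0 := by
        intro i
        have h1 := mem_perp.1 (latBasis (W ⊓ perp x) i).2.2
        rw [← hdot] at h1
        have h2 : ∑ j, x j * (latBasis (W ⊓ perp x) i : σ → ℤ) j = 0 := by exact_mod_cast h1
        simp only [castVec_apply]
        exact_mod_cast h2
      simp only [hy0, Finset.sum_apply, Pi.smul_apply, smul_eq_mul, Finset.mul_sum]
      rw [Finset.sum_comm]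
      refine Finset.sum_eq_zero fun i _ ↦ ?_
      have h1 := congrArg (c i * ·) (this i)
      simp only [Finset.mul_sum, mul_zero] at h1
      rw [← h1]
      exact Finset.sum_congr rfl fun j _ ↦ by ring
    simp only [Pi.sub_apply, mul_sub, Finset.sum_sub_distrib, h0, sub_zero, castVec_apply]
    push_cast
    rfl
  have h1 : 1 ≤ C * ‖z‖ := by
    rw [← hψ]
    refine le_trans ?_ (hC _ hmem)
    rw [hval]
    exact_mod_cast Int.one_le_abs hux
  rw [hG]
  have h2 : 1 ≤ (C * ‖z‖) ^ 2 := one_le_pow₀ h1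
  have h3 : 0 ≤ covol ψ (W ⊓ perp x) := covol_nonneg _ _
  calc covol ψ (W ⊓ perp x) ≤ covol ψ (W ⊓ perp x) * (C * ‖z‖) ^ 2 := le_mul_of_one_le_right h3 h2
    _ = C ^ 2 * (covol ψ (W ⊓ perp x) * ‖z‖ ^ 2) := by ring

lemma covol_lower_bound [DecidableEq σ] {P : Submodule ℝ (σ → ℝ)} {C : ℝ} (hC1 : 1 ≤ C)
    (hC : ∀ y ∈ P, ∀ j, |y j| ≤ C * ‖ψ y‖) (r : ℕ) (W : Submodule ℚ (σ → ℚ))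
    (hr : Module.finrank ℚ W = r) (hP : ∀ y ∈ lat W, castVec ℝ y ∈ P) :
    1 ≤ (C ^ 2) ^ r * covol ψ W := by
  induction r generalizing W with
  | zero =>
    rw [Submodule.finrank_eq_zero.1 hr, covol_bot]
    simp
  | succ r ih =>
    have : ∃ j, ¬ W ≤ perp (Pi.single j (1 : ℤ)) := by
      by_contra! hcon
      have : W = ⊥ := by
        rw [eq_bot_iff]
        intro w hw
        rw [Submodule.mem_bot]
        funext j
        have := mem_perp.1 (hcon j hw)
        simpa [Pi.single_apply] using this
      rw [this, finrank_bot] at hr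
      omega
    obtain ⟨j, hj⟩ := this
    have h1 := covol_inf_perp_le ψ hj hP (C := C) fun y hy ↦ by
      simpa [Pi.single_apply] using hC y hy j
    have h2 := ih (W ⊓ perp (Pi.single j 1)) (by have := finrank_inf_perp hj; omega)
      fun y hy ↦ hP y hy.1
    calc 1 ≤ _ := h2
      _ ≤ (C ^ 2) ^ r * (C ^ 2 * covol ψ W) := by gcongr
      _ = _ := by ring

lemma covol_span_singleton_le {y : σ → ℤ} (hy : y ≠ 0) :
    covol ψ (Submodule.span ℚ {castVec ℚ y}) ≤ ‖ψ (castVec ℝ y)‖ ^ 2 := by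
  rw [← gramDet_unit]
  have hne : castVec ℚ y ≠ 0 := fun h ↦ hy (castVec_injective ℚ (by simpa using h))
  refine covol_le_gramDet ψ (v := fun _ : Unit ↦ y) (fun _ ↦ Submodule.mem_span_singleton_self _)
    ?_ ?_
  · exact linearIndependent_unique_iff.2 hy
  · rw [finrank_span_singleton hne]
    simp

end Covolume

end Lattice

section Heights

/-- The partial sum `g⁻¹ + g⁻² + … + g⁻ʳ`, in closed form. -/
noncomputable def geomWeight (g : ℝ) (r : ℕ) : ℝ := (1 - g⁻¹ ^ r) / (g - 1)

variable {g : ℝ}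

lemma geomWeight_zero : geomWeight g 0 = 0 := by simp [geomWeight]

lemma geomWeight_one (hg : 1 < g) : geomWeight g 1 = g⁻¹ := by
  have h1 : g - 1 ≠ 0 := by linarith
  have h2 : g ≠ 0 := by linarith
  rw [geomWeight]
  field_simp

lemma geomWeight_add (m t : ℕ) :
    geomWeight g (m + t) = geomWeight g m + g⁻¹ ^ m * geomWeight g t := by
  rw [geomWeight, geomWeight, geomWeight, pow_add]
  ring

lemma mul_geomWeight_succ (hg : 1 < g) (r : ℕ) : g * geomWeight g (r + 1) = 1 + geomWeight g r := by
  have h2 : g ≠ 0 := by linarith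
  rw [add_comm r, geomWeight_add, geomWeight_one hg]
  field_simp

lemma sub_one_mul_geomWeight (hg : 1 < g) (r : ℕ) : (g - 1) * geomWeight g r = 1 - g⁻¹ ^ r := by
  have h1 : g - 1 ≠ 0 := by linarith
  rw [geomWeight]
  field_simp

lemma geomWeight_mono (hg : 1 < g) : Monotone (geomWeight g) := by
  intro m n h
  have h0 : 0 < g - 1 := by linarith
  have h1 : g⁻¹ ^ n ≤ g⁻¹ ^ m :=
    pow_le_pow_of_le_one (by positivity) (inv_le_one_of_one_le₀ hg.le) h
  unfold geomWeight
  gcongr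

lemma geomWeight_nonneg (hg : 1 < g) (r : ℕ) : 0 ≤ geomWeight g r := by
  rw [← geomWeight_zero (g := g)]
  exact geomWeight_mono hg (Nat.zero_le r)

lemma inv_le_geomWeight (hg : 1 < g) {r : ℕ} (hr : 1 ≤ r) : g⁻¹ ≤ geomWeight g r := by
  rw [← geomWeight_one hg]
  exact geomWeight_mono hg hr

lemma geomWeight_le (hg : 1 < g) (r : ℕ) : geomWeight g r ≤ 1 / (g - 1) := by
  have h0 : 0 < g - 1 := by linarith
  have : 0 < g⁻¹ ^ r := by positivity
  unfold geomWeight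
  gcongr
  linarith

variable {V : Type*} [AddCommGroup V] [Module ℚ V] [FiniteDimensional ℚ V]

lemma exists_weighted_sup (hg : 1 < g) {c : Submodule ℚ V → ℝ} (c_bot : c ⊥ = 0)
    {H : Submodule ℚ V} (hbdd : ∃ B, ∀ W ≤ H, c W ≤ B)
    (hne : ∃ W ≤ H, 1 ≤ Module.finrank ℚ W) :
    ∃ K : ℝ, (∀ W ≤ H, c W ≤ K * geomWeight g (Module.finrank ℚ W)) ∧
      ∃ W ≤ H, 1 ≤ Module.finrank ℚ W ∧ K * geomWeight g (Module.finrank ℚ W) - 1 ≤ c W := by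
  have hg0 : 0 < g := by linarith
  obtain ⟨B, hB⟩ := hbdd
  set S : Set ℝ := {t | ∃ W ≤ H, 1 ≤ Module.finrank ℚ W ∧
    t = c W / geomWeight g (Module.finrank ℚ W)} with hS
  have hpos : ∀ {r : ℕ}, 1 ≤ r → 0 < geomWeight g r := fun hr ↦
    lt_of_lt_of_le (inv_pos.2 hg0) (inv_le_geomWeight hg hr)
  have hSb : BddAbove S := by
    refine ⟨|B| * g, ?_⟩
    rintro _ ⟨W, hW, hr, rfl⟩
    rw [div_le_iff₀ (hpos hr)]
    have h1 := inv_le_geomWeight hg hr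
    have h2 : 1 ≤ g * geomWeight g (Module.finrank ℚ W) := by
      rw [← mul_inv_cancel₀ hg0.ne']
      gcongr
    calc c W ≤ |B| := (hB W hW).trans (le_abs_self B)
      _ ≤ |B| * (g * geomWeight g (Module.finrank ℚ W)) := le_mul_of_one_le_right (abs_nonneg _) h2
      _ = _ := by ring
  have hSn : S.Nonempty := by
    obtain ⟨W, hW, hr⟩ := hne
    exact ⟨_, W, hW, hr, rfl⟩
  refine ⟨sSup S, fun W hW ↦ ?_, ?_⟩
  · rcases Nat.eq_zero_or_pos (Module.finrank ℚ W) with h0 | hr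
    · rw [Submodule.finrank_eq_zero.1 h0, c_bot, finrank_bot, geomWeight_zero, mul_zero]
    · rw [← div_le_iff₀ (hpos hr)]
      exact le_csSup hSb ⟨W, hW, hr, rfl⟩
  · obtain ⟨_, ⟨W, hW, hr, rfl⟩, hlt⟩ :=
      exists_lt_of_lt_csSup hSn (show sSup S - (g - 1) < sSup S by linarith)
    refine ⟨W, hW, hr, ?_⟩
    rw [lt_div_iff₀ (hpos hr)] at hlt
    have h1 := geomWeight_le hg (Module.finrank ℚ W)
    rw [le_div_iff₀ (by linarith)] at h1
    linarith

set_option maxHeartbeats 1000000 in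
/-- The height inequalities along a sequence of hyperplanes `H k` are contradictory. -/
theorem false_of_height_inequalities {n : ℕ} {a b γ C : ℝ} {s e : ℕ → ℝ}
    {H : ℕ → Submodule ℚ V} {c : Submodule ℚ V → ℝ}
    (hg : 1 < g) (ha : 0 < a) (hab : a ≤ b) (hbg : b / a < g) (hγ : g ^ n < γ * a * g)
    (hC : 0 ≤ C)
    (c_bot : c ⊥ = 0)
    (rank_le : ∀ k, ∀ W ≤ H k, Module.finrank ℚ W ≤ n)
    (rank_cut : ∀ k W, ¬ W ≤ H k → Module.finrank ℚ (W ⊓ H k : Submodule ℚ V) + 1 =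
      Module.finrank ℚ W)
    (bdd : ∀ k, ∃ B, ∀ W ≤ H k, c W ≤ B)
    (e_le : ∀ k, e k ≤ c (H k) + C)
    (line : ∀ k, ∃ W ≤ H k, Module.finrank ℚ W = 1 ∧ γ * e k - C ≤ c W)
    (up : ∀ k, ∀ M ≤ H (k + 1), ¬ M ≤ H k →
      c M ≤ c (M ⊓ H k) + s (k + 1) + e (k + 1) - e k + C)
    (down : ∀ k, ∀ N ≤ H k, ¬ N ≤ H (k + 1) → c N ≤ c (N ⊓ H (k + 1)) + s (k + 1) + C)
    (submod : ∀ k, ∀ N ≤ H k, ∀ M ≤ H k, c N + c M ≤ c (N ⊓ M) + c (N ⊔ M))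
    (s_le : ∀ k, a * s (k + 1) ≤ e k) (e_le_s : ∀ k, e k ≤ b * s k)
    (e_tendsto : Filter.Tendsto e Filter.atTop Filter.atTop) : False := by
  have hg0 : 0 < g := by linarith
  set q := g⁻¹ with hq
  have hq0 : 0 < q := inv_pos.2 hg0
  have hq1 : q < 1 := inv_lt_one_of_one_lt₀ hg
  have hqg : q * g = 1 := inv_mul_cancel₀ hg0.ne'
  have hγ0 : 0 < γ := by
    by_contra! h
    have h1 : 0 < g ^ n := by positivity
    have h2 : γ * a * g ≤ 0 := by
      have := mul_nonneg ha.le hg0.le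
      nlinarith
    linarith
  set η := geomWeight g with hη
  have η_nonneg : ∀ r, 0 ≤ η r := geomWeight_nonneg hg
  have η_mono : Monotone η := geomWeight_mono hg
  have η_add : ∀ m t, η (m + t) = η m + q ^ m * η t := geomWeight_add
  have η_one : η 1 = q := geomWeight_one hg
  have qpow : ∀ {r}, r ≤ n → q ^ n ≤ q ^ r := fun hr ↦
    pow_le_pow_of_le_one hq0.le hq1.le hr
  have hline : ∀ k, ∃ W ≤ H k, 1 ≤ Module.finrank ℚ W := fun k ↦ by
    obtain ⟨W, h1, h2, -⟩ := line k
    exact ⟨W, h1, h2.ge⟩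
  choose K hK hKW using fun k ↦ exists_weighted_sup hg c_bot (bdd k) (hline k)
  rw [← hη] at hK hKW
  -- lower bound for `K`, and the resulting bound for `s`
  have hKe : ∀ k, g * (γ * e k - C) ≤ K k := fun k ↦ by
    obtain ⟨W, h1, h2, h3⟩ := line k
    have h4 := hK k W h1
    rw [h2, η_one, hq] at h4
    have : g * (γ * e k - C) ≤ g * (K k * g⁻¹) := by gcongr; linarith
    rwa [mul_comm (K k), ← mul_assoc, mul_inv_cancel₀ hg0.ne', one_mul] at this
  have hKtop : Filter.Tendsto K Filter.atTop Filter.atTop := by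
    refine Filter.tendsto_atTop_mono hKe ?_
    refine Filter.Tendsto.const_mul_atTop hg0 ?_
    exact Filter.tendsto_atTop_add_const_right _ _ (e_tendsto.const_mul_atTop hγ0)
  set ρ := (γ * a * g)⁻¹ with hρ
  have hρ0 : 0 < ρ := by positivity
  have hρq : ρ < q ^ n := by
    rw [hq, inv_pow, hρ]
    exact inv_strictAnti₀ (by positivity) hγ
  set C₁ := C / (γ * a) with hC₁
  have hC₁0 : 0 ≤ C₁ := by positivity
  have hs : ∀ k, s (k + 1) ≤ ρ * K k + C₁ := fun k ↦ by
    have h1 : γ * a * g * s (k + 1) ≤ K k + g * C := by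
      have := hKe k
      have h2 : g * γ * (a * s (k + 1)) ≤ g * γ * e k := by gcongr; exact s_le k
      linarith
    have h3 : ρ * K k + C₁ = (K k + g * C) / (γ * a * g) := by
      rw [hρ, hC₁]; field_simp
    rw [h3, le_div_iff₀ (by positivity)]
    linarith
  -- growth of `K`
  set κ := (b / a - 1) * η n + ρ with hκ
  have hba : 0 ≤ b / a - 1 := by
    rw [sub_nonneg, one_le_div ha]; exact hab
  have hκ1 : κ < 1 := by
    have h1 := sub_one_mul_geomWeight hg n
    have h2 : (b / a - 1) * η n ≤ (g - 1) * η n := by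
      gcongr
      exact η_nonneg n
    linarith
  set τ := (η n + κ) / (η n + 1) with hτ
  have hτ1 : τ < 1 := by
    rw [hτ, div_lt_one (by have := η_nonneg n; linarith)]
    linarith
  have hτκ : ∀ r ≤ n, η r + κ ≤ τ * (η r + 1) := fun r hr ↦ by
    have h1 : τ * (η n + 1) = η n + κ := div_mul_cancel₀ _ (by have := η_nonneg n; linarith)
    have h2 := η_mono hr
    nlinarith
  set C₃ := g * ((b / a - 1) * C + C₁ + C) with hC₃
  have hC₃0 : 0 ≤ C₃ := by positivity
  set G := max 1 (τ * g) with hG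
  have hGg : G < g := max_lt hg (by nlinarith)
  have hG1 : 1 ≤ G := le_max_left _ _
  have hstep : ∀ k, 0 ≤ K k → K (k + 1) ≤ G * K k + C₃ + g := fun k hk ↦ by
    obtain ⟨M, hM, hr, hMc⟩ := hKW (k + 1)
    have hηM := inv_le_geomWeight hg hr
    set r := Module.finrank ℚ M with hrdef
    have hηpos : 0 < η r := lt_of_lt_of_le hq0 hηM
    have hgη : 1 ≤ g * η r := by
      calc 1 = g * q := by rw [mul_comm, hqg]
        _ ≤ _ := by gcongr
    suffices hsuff : c M ≤ (G * K k + C₃) * η r by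
      by_contra! hcon
      have h1 : (G * K k + C₃ + g) * η r < K (k + 1) * η r := by gcongr
      nlinarith
    by_cases hMk : M ≤ H k
    · have h1 := hK k M hMk
      refine h1.trans ?_
      gcongr
      nlinarith
    · have h1 := up k M hM hMk
      have h2 := hK k (M ⊓ H k) inf_le_right
      have h3 := rank_cut k M hMk
      set r' := Module.finrank ℚ (M ⊓ H k : Submodule ℚ V) with hr'
      have h4 : g * η r = 1 + η r' := by
        rw [hrdef, ← h3]; exact mul_geomWeight_succ hg r'
      have h5 : e (k + 1) ≤ b / a * e k := by
        calc e (k + 1) ≤ b * s (k + 1) := e_le_s _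
          _ = b / a * (a * s (k + 1)) := by field_simp
          _ ≤ _ := mul_le_mul_of_nonneg_left (s_le k) (by linarith)
      have h6 : e k ≤ K k * η n + C := by
        refine (e_le k).trans ?_
        gcongr
        refine (hK k (H k) le_rfl).trans ?_
        gcongr
        exact η_mono (rank_le k _ le_rfl)
      have h7 := hs k
      have h8 : (b / a - 1) * e k ≤ (b / a - 1) * (K k * η n + C) := by gcongr
      have h9 : c M ≤ K k * (η r' + κ) + ((b / a - 1) * C + C₁ + C) := by
        rw [hκ]
        linarith
      have h10 : η r' + κ ≤ τ * (g * η r) := by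
        rw [h4, add_comm 1]
        exact hτκ r' (rank_le k _ inf_le_right)
      have h11 : τ * g * η r ≤ G * η r := by
        gcongr
        exact le_max_right _ _
      have h12 : (b / a - 1) * C + C₁ + C ≤ ((b / a - 1) * C + C₁ + C) * (g * η r) :=
        le_mul_of_one_le_right (by positivity) hgη
      calc c M ≤ _ := h9
        _ ≤ K k * (G * η r) + ((b / a - 1) * C + C₁ + C) * (g * η r) := by
          gcongr
          linarith
        _ = _ := by rw [hC₃]; ring
  -- near-maximisers persist
  have hpersist : ∀ E, 0 ≤ E → ∀ k, E + C₁ + C < K k * (q ^ n - ρ) → ∀ N ≤ H k,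
      1 ≤ Module.finrank ℚ N → K k * η (Module.finrank ℚ N) - E ≤ c N → N ≤ H (k + 1) := by
    intro E hE k hlarge N hN hr hcN
    by_contra hcon
    have hk : 0 ≤ K k := by
      by_contra! hneg
      have : 0 < q ^ n - ρ := by linarith
      nlinarith
    have h1 := down k N hN hcon
    have h2 := hK k (N ⊓ H (k + 1)) (inf_le_left.trans hN)
    have h3 := rank_cut (k + 1) N hcon
    have h4 : η (Module.finrank ℚ N) = η (Module.finrank ℚ (N ⊓ H (k + 1) : Submodule ℚ V)) +
        q ^ (Module.finrank ℚ (N ⊓ H (k + 1) : Submodule ℚ V)) * q := by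
      rw [← h3, η_add, η_one]
    rw [← pow_succ, h3] at h4
    have h5 := hs k
    have h6 : K k * q ^ n ≤ K k * q ^ (Module.finrank ℚ N) :=
      mul_le_mul_of_nonneg_left (qpow (rank_le k N hN)) hk
    rw [h4] at hcN
    linarith
  set E := g * (1 / (g - 1)) + 1 with hE
  have hE0 : 0 ≤ E := by
    have : 0 < g - 1 := by linarith
    positivity
  have hGq : 0 < 1 - G * q := by
    have : G * q < g * q := by gcongr
    linarith
  obtain ⟨k₀, hk₀⟩ : ∃ k₀, ∀ k ≥ k₀, 0 ≤ K k ∧ E + C₁ + C < K k * (q ^ n - ρ) ∧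
      q * (G * g + C₃ + g) + 2 * g < K k * (q ^ n * (1 - G * q)) := by
    have h1 := hKtop.eventually_ge_atTop 0
    have h2 := (hKtop.atTop_mul_const (show 0 < q ^ n - ρ by linarith)).eventually_gt_atTop
      (E + C₁ + C)
    have h3 := (hKtop.atTop_mul_const (show 0 < q ^ n * (1 - G * q) by positivity)
      ).eventually_gt_atTop (q * (G * g + C₃ + g) + 2 * g)
    obtain ⟨k₀, hk₀⟩ := Filter.eventually_atTop.1 (h1.and (h2.and h3))
    exact ⟨k₀, hk₀⟩
  have hmain : ∀ d : ℕ, ∃ k ≥ k₀, ∃ N ≤ H k, d + 1 ≤ Module.finrank ℚ N ∧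
      K k * η (Module.finrank ℚ N) - 1 ≤ c N := by
    intro d
    induction d with
    | zero =>
      obtain ⟨N, h1, h2, h3⟩ := hKW k₀
      exact ⟨k₀, le_rfl, N, h1, by simpa using h2, h3⟩
    | succ d ih =>
      obtain ⟨k, hk, N, hN, hrN, hcN⟩ := ih
      have hex : ∃ l, k < l ∧ K k + g < K l := by
        obtain ⟨l, hl1, hl2⟩ := ((hKtop.eventually_gt_atTop (K k + g)).and
          (Filter.eventually_gt_atTop k)).exists
        exact ⟨l, hl2, hl1⟩
      classical
      set l := Nat.find hex with hl
      obtain ⟨hkl, hKl⟩ := Nat.find_spec hex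
      rw [← hl] at hkl hKl
      have hmin : ∀ j, k ≤ j → j < l → K j ≤ K k + g := fun j h1 h2 ↦ by
        rcases h1.eq_or_lt with rfl | h1
        · linarith
        · by_contra! hcon
          exact Nat.find_min hex h2 ⟨h1, hcon⟩
      have hNj : ∀ j, k ≤ j → j ≤ l → N ≤ H j := by
        intro j hj
        induction j, hj using Nat.le_induction with
        | base => exact fun _ ↦ hN
        | succ j hj ihj =>
          intro hjl
          refine hpersist E hE0 j (hk₀ j (hk.trans hj)).2.1 N (ihj (by omega)) (by omega) ?_
          have h1 := hmin j hj (by omega)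
          have h2 := geomWeight_le hg (Module.finrank ℚ N)
          have h3 := η_nonneg (Module.finrank ℚ N)
          have h4 : K j * η (Module.finrank ℚ N) ≤ (K k + g) * η (Module.finrank ℚ N) := by gcongr
          have h5 : g * η (Module.finrank ℚ N) ≤ g * (1 / (g - 1)) := by gcongr
          rw [hE]
          linarith
      have hNl := hNj l hkl.le le_rfl
      obtain ⟨M, hM, hrM, hcM⟩ := hKW l
      have hMk : ¬ M ≤ H k := fun hcon ↦ by
        have h1 := hK k M hcon
        have h2 := inv_le_geomWeight hg hrM
        have h3 : (K k + g) * η (Module.finrank ℚ M) < K l * η (Module.finrank ℚ M) := by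
          have : 0 < η (Module.finrank ℚ M) := lt_of_lt_of_le hq0 h2
          gcongr
        have h4 : g * q ≤ g * η (Module.finrank ℚ M) := by gcongr
        linarith
      have hsub := submod l N hNl M hM
      have hi := hK k (N ⊓ M) (inf_le_left.trans hN)
      have hu := hK l (N ⊔ M) (sup_le hNl hM)
      have hdim := Submodule.finrank_sup_add_finrank_inf_eq N M
      have hiN := Submodule.finrank_mono (R := ℚ) (inf_le_left : N ⊓ M ≤ N)
      have hiM := Submodule.finrank_mono (R := ℚ) (inf_le_right : N ⊓ M ≤ M)
      obtain ⟨t, ht⟩ := Nat.exists_eq_add_of_le hiN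
      have ht' : Module.finrank ℚ (N ⊔ M : Submodule ℚ V) = Module.finrank ℚ M + t := by omega
      rcases Nat.eq_zero_or_pos t with rfl | htpos
      · have hNM : N ≤ M := by
          have := Submodule.eq_of_le_of_finrank_eq (inf_le_left : N ⊓ M ≤ N) (by omega)
          rw [← this]; exact inf_le_right
        refine ⟨l, hk.trans hkl.le, M, hM, ?_, hcM⟩
        have h1 := Submodule.finrank_mono (R := ℚ) hNM
        rcases h1.eq_or_lt with h2 | h2
        · have := Submodule.eq_of_le_of_finrank_eq hNM h2
          exact absurd (this ▸ hN) hMk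
        · omega
      · exfalso
        rcases hiM.eq_or_lt with h1 | h1
        · have := Submodule.eq_of_le_of_finrank_eq (inf_le_right : N ⊓ M ≤ M) h1
          exact hMk (this ▸ (inf_le_left.trans hN))
        · set i := Module.finrank ℚ (N ⊓ M : Submodule ℚ V) with hidef
          have hin : i ≤ n := rank_le k _ (inf_le_left.trans hN)
          rw [ht, η_add] at hcN
          rw [ht', η_add] at hu
          have hηt : q ≤ η t := inv_le_geomWeight hg htpos
          have h2 : (K k * q ^ i - K l * q ^ Module.finrank ℚ M) * η t ≤ 2 := by
            linarith
          have h3 : K k * q ^ i - K l * q ^ Module.finrank ℚ M ≤ 2 * g := by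
            by_contra! hcon
            have h5 : 2 * g * q < (K k * q ^ i - K l * q ^ Module.finrank ℚ M) * η t := by
              have : 2 * g * q < (K k * q ^ i - K l * q ^ Module.finrank ℚ M) * q := by gcongr
              refine this.trans_le ?_
              gcongr
              linarith
            nlinarith
          obtain ⟨hk1, -, hk3⟩ := hk₀ k hk
          have hKl0 : 0 ≤ K l := by linarith
          have h4 : K l * q ^ Module.finrank ℚ M ≤ K l * (q ^ i * q) := by
            rw [← pow_succ]
            gcongr ?_ * ?_
            exact pow_le_pow_of_le_one hq0.le hq1.le h1
          have h5 : K l ≤ G * (K k + g) + C₃ + g := by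
            obtain ⟨j, hj⟩ : ∃ j, l = j + 1 := ⟨l - 1, by omega⟩
            have h6 := hstep j (hk₀ j (by omega)).1
            rw [hj]
            refine h6.trans ?_
            gcongr
            exact hmin j (by omega) (by omega)
          have hqi1 : q ^ i ≤ 1 := pow_le_one₀ hq0.le hq1.le
          have hqi0 : 0 < q ^ i := by positivity
          have h6 : K l * (q ^ i * q) ≤ (G * (K k + g) + C₃ + g) * (q ^ i * q) := by gcongr
          have h7 : q ^ i * (q * (G * g + C₃ + g)) ≤ q * (G * g + C₃ + g) :=
            mul_le_of_le_one_left (by positivity) hqi1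
          have h8 : K k * (q ^ n * (1 - G * q)) ≤ K k * (q ^ i * (1 - G * q)) := by
            have := qpow hin
            gcongr
          linarith
  obtain ⟨k, -, N, hN, hr, -⟩ := hmain n
  have := rank_le k N hN
  omega

end Heights

section Projection

variable {n : ℕ} (θ : Fin n → ℝ)

/-- The linear form `x₀ + θ₁x₁ + … + θₙxₙ`. -/
noncomputable def linForm (x : Fin (n + 1) → ℤ) : ℝ :=
  (x 0 : ℝ) + ∑ i : Fin n, θ i * (x i.succ : ℝ)

/-- The linear map `y ↦ (δy₀, y₀θ₁ - y₁, …, y₀θₙ - yₙ)`. -/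
noncomputable def projMap (δ : ℝ) : (Fin (n + 1) → ℝ) →ₗ[ℝ] EuclideanSpace ℝ (Fin (n + 1)) where
  toFun y := WithLp.toLp 2 (Fin.cons (δ * y 0) fun i ↦ y 0 * θ i - y i.succ)
  map_add' x y := by
    ext i
    refine Fin.cases ?_ (fun i ↦ ?_) i <;> simp <;> ring
  map_smul' c x := by
    ext i
    refine Fin.cases ?_ (fun i ↦ ?_) i <;> simp <;> ring

@[simp] lemma projMap_zero (δ : ℝ) (y : Fin (n + 1) → ℝ) : projMap θ δ y 0 = δ * y 0 := rfl

@[simp] lemma projMap_succ (δ : ℝ) (y : Fin (n + 1) → ℝ) (i : Fin n) :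
    projMap θ δ y i.succ = y 0 * θ i - y i.succ := rfl

lemma abs_le_norm_projMap (δ : ℝ) (y : Fin (n + 1) → ℝ) (i : Fin n) :
    |y 0 * θ i - y i.succ| ≤ ‖projMap θ δ y‖ := by
  rw [← projMap_succ θ δ y i, ← Real.norm_eq_abs]
  exact PiLp.norm_apply_le _ _

lemma abs_mul_le_norm_projMap (δ : ℝ) (y : Fin (n + 1) → ℝ) :
    |δ * y 0| ≤ ‖projMap θ δ y‖ := by
  rw [← projMap_zero θ δ y, ← Real.norm_eq_abs]
  exact PiLp.norm_apply_le _ _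

lemma dot_eq (x : Fin (n + 1) → ℤ) (y : Fin (n + 1) → ℝ) :
    ∑ j, (x j : ℝ) * y j =
      y 0 * linForm θ x - ∑ i : Fin n, (x i.succ : ℝ) * (y 0 * θ i - y i.succ) := by
  rw [Fin.sum_univ_succ, linForm, mul_add, Finset.mul_sum, add_sub_assoc,
    ← Finset.sum_sub_distrib]
  congr 1
  · ring
  · exact Finset.sum_congr rfl fun i _ ↦ by ring

lemma abs_sum_mul_le {x : Fin (n + 1) → ℤ} {X B : ℝ} (hX : ∀ i : Fin n, |(x i.succ : ℝ)| ≤ X)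
    {z : Fin n → ℝ} (hz : ∀ i, |z i| ≤ B) :
    |∑ i : Fin n, (x i.succ : ℝ) * z i| ≤ n * (X * B) := by
  calc _ ≤ ∑ i : Fin n, |(x i.succ : ℝ) * z i| := Finset.abs_sum_le_sum_abs _ _
    _ ≤ ∑ _i : Fin n, X * B := Finset.sum_le_sum fun i _ ↦ by
      rw [abs_mul]
      exact mul_le_mul (hX i) (hz i) (abs_nonneg _) ((abs_nonneg _).trans (hX i))
    _ = _ := by simp

lemma abs_dot_le {x : Fin (n + 1) → ℤ} {X : ℝ} (hX : ∀ i : Fin n, |(x i.succ : ℝ)| ≤ X)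
    (δ : ℝ) (y : Fin (n + 1) → ℝ) :
    |∑ j, (x j : ℝ) * y j| ≤ |y 0| * |linForm θ x| + n * (X * ‖projMap θ δ y‖) := by
  rw [dot_eq θ]
  refine (abs_sub _ _).trans ?_
  rw [abs_mul]
  gcongr
  exact abs_sum_mul_le hX fun i ↦ abs_le_norm_projMap θ δ y i

/-- The real hyperplane orthogonal to an integer vector. -/
def realPerp (x : Fin (n + 1) → ℤ) : Submodule ℝ (Fin (n + 1) → ℝ) :=
  LinearMap.ker (∑ j, (x j : ℝ) • (LinearMap.proj j : (Fin (n + 1) → ℝ) →ₗ[ℝ] ℝ))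

lemma mem_realPerp {x : Fin (n + 1) → ℤ} {y : Fin (n + 1) → ℝ} :
    y ∈ realPerp x ↔ ∑ j, (x j : ℝ) * y j = 0 := by
  simp [realPerp, LinearMap.mem_ker]

lemma castVec_mem_perp {x y : Fin (n + 1) → ℤ} :
    castVec ℚ y ∈ perp x ↔ ∑ j, x j * y j = 0 := by
  rw [mem_perp]
  simp only [castVec_apply]
  norm_cast

lemma castVec_mem_realPerp {x : Fin (n + 1) → ℤ} {W : Submodule ℚ (Fin (n + 1) → ℚ)}
    (hW : W ≤ perp x) : ∀ y ∈ lat W, castVec ℝ y ∈ realPerp x := by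
  intro y hy
  have h := castVec_mem_perp.1 (hW hy)
  rw [mem_realPerp]
  simp only [castVec_apply]
  exact_mod_cast h

lemma abs_zero_le {x : Fin (n + 1) → ℤ} {X : ℝ} (hX : ∀ i : Fin n, |(x i.succ : ℝ)| ≤ X)
    (hx : linForm θ x ≠ 0) {y : Fin (n + 1) → ℝ} (hy : y ∈ realPerp x) :
    |y 0| ≤ n * X / |linForm θ x| * ‖projMap θ 0 y‖ := by
  rw [mem_realPerp, dot_eq θ, sub_eq_zero] at hy
  rw [div_mul_eq_mul_div, le_div_iff₀ (abs_pos.2 hx), ← abs_mul, hy, mul_assoc]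
  exact abs_sum_mul_le hX fun i ↦ abs_le_norm_projMap θ 0 y i

lemma abs_dot_le_of_mem_realPerp {x x' : Fin (n + 1) → ℤ} {X X' : ℝ}
    (hX : ∀ i : Fin n, |(x i.succ : ℝ)| ≤ X) (hX' : ∀ i : Fin n, |(x' i.succ : ℝ)| ≤ X')
    (hx : linForm θ x ≠ 0) {y : Fin (n + 1) → ℝ} (hy : y ∈ realPerp x) :
    |∑ j, (x' j : ℝ) * y j| ≤
      (n * (X * |linForm θ x'| / |linForm θ x| + X')) * ‖projMap θ 0 y‖ := by
  refine (abs_dot_le θ hX' 0 y).trans ?_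
  have h := mul_le_mul_of_nonneg_right (abs_zero_le θ hX hx hy) (abs_nonneg (linForm θ x'))
  refine (add_le_add_left h _).trans (le_of_eq ?_)
  ring

lemma exists_coordinate_bound {x : Fin (n + 1) → ℤ} (hx : linForm θ x ≠ 0) :
    ∃ C : ℝ, 1 ≤ C ∧ ∀ y ∈ realPerp x, ∀ j, |y j| ≤ C * ‖projMap θ 0 y‖ := by
  set X : ℝ := ∑ i : Fin n, |(x i.succ : ℝ)|
  have hX : ∀ i : Fin n, |(x i.succ : ℝ)| ≤ X := fun i ↦
    Finset.single_le_sum (f := fun i : Fin n ↦ |(x i.succ : ℝ)|) (fun _ _ ↦ abs_nonneg _)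
      (Finset.mem_univ i)
  set A := n * X / |linForm θ x| with hA
  have hA0 : 0 ≤ A := by
    have : 0 ≤ X := Finset.sum_nonneg fun _ _ ↦ abs_nonneg _
    positivity
  set Θ : ℝ := ∑ i : Fin n, |θ i|
  have hΘ0 : 0 ≤ Θ := Finset.sum_nonneg fun _ _ ↦ abs_nonneg _
  have hΘ : ∀ i, |θ i| ≤ Θ := fun i ↦
    Finset.single_le_sum (f := fun i : Fin n ↦ |θ i|) (fun _ _ ↦ abs_nonneg _) (Finset.mem_univ i)
  refine ⟨1 + A * (1 + Θ), by nlinarith [mul_nonneg hA0 hΘ0], fun y hy j ↦ ?_⟩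
  have h0 := abs_zero_le θ hX hx hy
  rw [← hA] at h0
  have hnn := norm_nonneg (projMap θ 0 y)
  refine Fin.cases ?_ (fun i ↦ ?_) j
  · refine h0.trans ?_
    gcongr
    nlinarith [mul_nonneg hA0 hΘ0]
  · have h1 := abs_le_norm_projMap θ 0 y i
    have h2 : |y i.succ| ≤ |y 0| * |θ i| + |y 0 * θ i - y i.succ| := by
      rw [← abs_mul]
      have := abs_sub (y 0 * θ i) (y 0 * θ i - y i.succ)
      simpa using this
    have h3 : |y 0| * |θ i| ≤ A * ‖projMap θ 0 y‖ * Θ := by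
      gcongr
      exact hΘ i
    nlinarith [mul_nonneg hA0 hnn]

/-- The logarithmic height of a rational subspace. -/
noncomputable def height (W : Submodule ℚ (Fin (n + 1) → ℚ)) : ℝ :=
  -(Real.log (covol (projMap θ 0) W)) / 2

lemma height_bot : height θ ⊥ = 0 := by simp [height, covol_bot]

lemma covol_pos {x : Fin (n + 1) → ℤ} (hx : linForm θ x ≠ 0) {W : Submodule ℚ (Fin (n + 1) → ℚ)}
    (hW : W ≤ perp x) : 0 < covol (projMap θ 0) W := by
  obtain ⟨C, hC1, hC⟩ := exists_coordinate_bound θ hx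
  have h := covol_lower_bound (projMap θ 0) hC1 hC _ W rfl (castVec_mem_realPerp hW)
  by_contra! hcon
  have : (C ^ 2) ^ (Module.finrank ℚ W) * covol (projMap θ 0) W ≤ 0 :=
    mul_nonpos_of_nonneg_of_nonpos (by positivity) hcon
  linarith

lemma exists_height_le {x : Fin (n + 1) → ℤ} (hx : linForm θ x ≠ 0) :
    ∃ B, ∀ W ≤ perp x, height θ W ≤ B := by
  obtain ⟨C, hC1, hC⟩ := exists_coordinate_bound θ hx
  refine ⟨(n + 1) * Real.log C, fun W hW ↦ ?_⟩
  have h := covol_lower_bound (projMap θ 0) hC1 hC _ W rfl (castVec_mem_realPerp hW)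
  have hpos := covol_pos θ hx hW
  have h1 := Real.log_le_log one_pos h
  have hC0 : C ≠ 0 := by linarith
  rw [Real.log_one, Real.log_mul (by positivity) hpos.ne', Real.log_pow, Real.log_pow] at h1
  have h2 : (Module.finrank ℚ W : ℝ) ≤ n + 1 := by
    have := Submodule.finrank_le W
    rw [Module.finrank_fin_fun] at this
    exact_mod_cast this
  have h3 := mul_le_mul_of_nonneg_right h2 (Real.log_nonneg hC1)
  unfold height
  push_cast at h1
  linarith

lemma height_inf_perp {x x' : Fin (n + 1) → ℤ} (hx : linForm θ x ≠ 0)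
    {W : Submodule ℚ (Fin (n + 1) → ℚ)} (hW : W ≤ perp x) (hW' : ¬ W ≤ perp x') {A : ℝ}
    (hA : 0 < A)
    (hbound : ∀ y ∈ realPerp x, |∑ j, (x' j : ℝ) * y j| ≤ A * ‖projMap θ 0 y‖) :
    height θ W ≤ height θ (W ⊓ perp x') + Real.log A := by
  have h := covol_inf_perp_le (projMap θ 0) hW' (castVec_mem_realPerp hW) hbound
  have h1 := Real.log_le_log (covol_pos θ hx (inf_le_left.trans hW)) h
  rw [Real.log_mul (by positivity) (covol_pos θ hx hW).ne', Real.log_pow] at h1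
  unfold height
  push_cast at h1
  linarith

lemma height_submodular {x : Fin (n + 1) → ℤ} (hx : linForm θ x ≠ 0)
    {N M : Submodule ℚ (Fin (n + 1) → ℚ)} (hN : N ≤ perp x) (hM : M ≤ perp x) :
    height θ N + height θ M ≤ height θ (N ⊓ M) + height θ (N ⊔ M) := by
  have p1 := covol_pos θ hx hN
  have p2 := covol_pos θ hx hM
  have p3 := covol_pos θ hx (inf_le_left.trans hN : N ⊓ M ≤ perp x)
  have p4 := covol_pos θ hx (sup_le hN hM)
  have h := Real.log_le_log (mul_pos p3 p4) (covol_inf_mul_covol_sup_le (projMap θ 0) N M)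
  rw [Real.log_mul p1.ne' p2.ne', Real.log_mul p3.ne' p4.ne'] at h
  unfold height
  linarith

lemma covol_top_le (δ : ℝ) : covol (projMap θ δ) ⊤ ≤ δ ^ 2 := by
  have h1 : covol (projMap θ δ) ⊤ ≤
      gramDet fun i : Fin (n + 1) ↦ projMap θ δ (castVec ℝ (Pi.single i (1 : ℤ))) := by
    refine covol_le_gramDet _ (fun _ ↦ Submodule.mem_top) ?_ ?_
    · convert! (Pi.basisFun ℤ (Fin (n + 1))).linearIndependent using 1
      ext i j
      simp
    · simp
  refine h1.trans (le_of_eq ?_)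
  let T : Matrix (Fin (n + 1)) (Fin (n + 1)) ℝ :=
    Matrix.of fun i j ↦ projMap θ δ (castVec ℝ (Pi.single i (1 : ℤ))) j
  let o := EuclideanSpace.basisFun (Fin (n + 1)) ℝ
  have h2 : (fun i : Fin (n + 1) ↦ projMap θ δ (castVec ℝ (Pi.single i (1 : ℤ)))) =
      fun i ↦ ∑ j, T i j • o j := by
    funext i
    conv_lhs => rw [← o.sum_repr (projMap θ δ (castVec ℝ (Pi.single i (1 : ℤ))))]
    rfl
  have h3 : gramDet o = 1 := by
    rw [gramDet, Matrix.gram_eq_one_iff_orthonormal.2 o.orthonormal, Matrix.det_one]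
  have h4 : T.IsUpperTriangular := by
    intro i j hij
    change j < i at hij
    have hi : i ≠ 0 := fun h ↦ by simp [h] at hij
    revert hij
    refine Fin.cases ?_ (fun j ↦ ?_) j
    · intro _
      simp [T, hi.symm]
    · intro hij
      have : j.succ ≠ i := hij.ne
      simp [T, hi.symm, this]
  rw [h2, gramDet_sum_smul, h3, Matrix.det_of_isUpperTriangular h4, Fin.prod_univ_succ]
  simp [T, Fin.succ_ne_zero, mul_pow]
  rw [← pow_mul, mul_comm n 2, pow_mul]
  simp

lemma continuous_covol_projMap (W : Submodule ℚ (Fin (n + 1) → ℚ)) :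
    Continuous fun δ ↦ covol (projMap θ δ) W := by
  unfold covol gramDet
  refine Continuous.matrix_det (continuous_matrix fun i j ↦ ?_)
  simp only [Matrix.gram_apply, PiLp.inner_apply, Fin.sum_univ_succ, projMap_zero, projMap_succ]
  fun_prop

lemma covol_perp_le {x : Fin (n + 1) → ℤ} (hx : x ≠ 0) :
    covol (projMap θ 0) (perp x) ≤ linForm θ x ^ 2 := by
  set X : ℝ := ∑ i : Fin n, |(x i.succ : ℝ)|
  have hX : ∀ i : Fin n, |(x i.succ : ℝ)| ≤ X := fun i ↦
    Finset.single_le_sum (f := fun i : Fin n ↦ |(x i.succ : ℝ)|) (fun _ _ ↦ abs_nonneg _)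
      (Finset.mem_univ i)
  have hX0 : 0 ≤ X := Finset.sum_nonneg fun _ _ ↦ abs_nonneg _
  have hnot : ¬ (⊤ : Submodule ℚ (Fin (n + 1) → ℚ)) ≤ perp x := by
    intro h
    refine hx (funext fun j ↦ ?_)
    have := mem_perp.1 (h (Submodule.mem_top (x := Pi.single j (1 : ℚ))))
    simpa [Pi.single_apply] using this
  have key : ∀ δ > 0, covol (projMap θ δ) (perp x) ≤ (|linForm θ x| + n * X * δ) ^ 2 := by
    intro δ hδ
    have h := covol_inf_perp_le (projMap θ δ) hnot (P := ⊤) (fun _ _ ↦ Submodule.mem_top)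
      (C := |linForm θ x| / δ + n * X) fun y _ ↦ by
        refine (abs_dot_le θ hX δ y).trans ?_
        have h1 := abs_mul_le_norm_projMap θ δ y
        rw [abs_mul, abs_of_pos hδ, mul_comm, ← le_div_iff₀ hδ] at h1
        have h2 := mul_le_mul_of_nonneg_right h1 (abs_nonneg (linForm θ x))
        refine (add_le_add_left h2 _).trans (le_of_eq ?_)
        ring
    rw [top_inf_eq] at h
    refine h.trans ?_
    calc _ ≤ (|linForm θ x| / δ + n * X) ^ 2 * δ ^ 2 := by
          gcongr
          exact covol_top_le θ δ
      _ = _ := by field_simp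
  have hlim1 := ((continuous_covol_projMap θ (perp x)).tendsto 0).mono_left
    (nhdsWithin_le_nhds (s := Set.Ioi 0))
  have hlim2 : Filter.Tendsto (fun δ : ℝ ↦ (|linForm θ x| + n * X * δ) ^ 2)
      (nhdsWithin 0 (Set.Ioi 0)) (nhds ((|linForm θ x| + n * X * 0) ^ 2)) :=
    (Continuous.tendsto (by fun_prop) 0).mono_left nhdsWithin_le_nhds
  have := le_of_tendsto_of_tendsto hlim1 hlim2
    (Filter.eventually_of_mem self_mem_nhdsWithin fun δ hδ ↦ key δ hδ)
  simpa using this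

lemma neg_log_le_height_perp {x : Fin (n + 1) → ℤ} (hx : linForm θ x ≠ 0) :
    -Real.log |linForm θ x| ≤ height θ (perp x) := by
  have hx0 : x ≠ 0 := fun h ↦ hx (by simp [h, linForm])
  have h := Real.log_le_log (covol_pos θ hx le_rfl) (covol_perp_le θ hx0)
  rw [← sq_abs, Real.log_pow] at h
  unfold height
  push_cast at h
  linarith

lemma height_span_singleton {x y : Fin (n + 1) → ℤ} (hx : linForm θ x ≠ 0) (hn : 1 ≤ n)
    (hy0 : y ≠ 0) (hxy : ∑ j, x j * y j = 0) {B : ℝ} (hB : 0 < B)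
    (hy : ∀ i : Fin n, |(y 0 : ℝ) * θ i - y i.succ| ≤ B) :
    -Real.log B - Real.log n / 2 ≤ height θ (Submodule.span ℚ {castVec ℚ y}) := by
  have h1 := covol_span_singleton_le (projMap θ 0) hy0
  have h2 : ‖projMap θ 0 (castVec ℝ y)‖ ^ 2 ≤ n * B ^ 2 := by
    rw [EuclideanSpace.norm_sq_eq, Fin.sum_univ_succ]
    simp only [projMap_zero, projMap_succ, castVec_apply, zero_mul, norm_zero, Real.norm_eq_abs]
    calc _ = ∑ i : Fin n, |(y 0 : ℝ) * θ i - y i.succ| ^ 2 := by simp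
      _ ≤ ∑ _i : Fin n, B ^ 2 := by
        gcongr with i
        exact hy i
      _ = _ := by simp
  have hle : Submodule.span ℚ {castVec ℚ y} ≤ perp x := by
    rw [Submodule.span_singleton_le_iff_mem]
    exact castVec_mem_perp.2 hxy
  have h3 := Real.log_le_log (covol_pos θ hx hle) (h1.trans h2)
  have hn' : (n : ℝ) ≠ 0 := by positivity
  rw [Real.log_mul hn' (by positivity), Real.log_pow] at h3
  unfold height
  push_cast at h3
  linarith

theorem false_of_minimal_sequence {T a b g γ : ℝ} (hn : 1 ≤ n)
    {x : ℕ → Fin (n + 1) → ℤ} {X : ℕ → ℝ}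
    (hg : 1 < g) (ha : 0 < a) (hab : a ≤ b) (hbg : b / a < g) (hγ : g ^ n < γ * a * g)
    (hX : ∀ k, ∀ i : Fin n, |(x k i.succ : ℝ)| ≤ X k) (hX1 : ∀ k, 1 ≤ X k)
    (hXmono : ∀ k, X k ≤ X (k + 1))
    (hne : ∀ k, linForm θ (x k) ≠ 0)
    (hanti : ∀ k, |linForm θ (x (k + 1))| < |linForm θ (x k)|)
    (s_le : ∀ k, a * Real.log (X (k + 1)) ≤ -Real.log |linForm θ (x k)|)
    (e_le : ∀ k, -Real.log |linForm θ (x k)| ≤ b * Real.log (X k))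
    (htend : Filter.Tendsto (fun k ↦ -Real.log |linForm θ (x k)|) Filter.atTop Filter.atTop)
    (hsim : ∀ t, T < t → SimSolvable n θ γ t) : False := by
  set e : ℕ → ℝ := fun k ↦ -Real.log |linForm θ (x k)| with he
  have hLpos : ∀ k, 0 < |linForm θ (x k)| := fun k ↦ abs_pos.2 (hne k)
  have hLexp : ∀ k, |linForm θ (x k)| = Real.exp (-e k) := fun k ↦ by
    rw [he, neg_neg, Real.exp_log (hLpos k)]
  have hnR : (1 : ℝ) ≤ n := by exact_mod_cast hn
  have hγa : 1 < γ * a := by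
    have h1 : g ≤ g ^ n := le_self_pow₀ hg.le (by omega)
    by_contra! hcon
    nlinarith
  have hγ0 : 0 < γ := by
    by_contra! h
    nlinarith
  have hγa' : 0 < γ - 1 / a := by
    rw [sub_pos, div_lt_iff₀ ha]; exact hγa
  -- a line of small height in each hyperplane
  have hline : ∃ k₀, ∀ k ≥ k₀, ∃ W ≤ perp (x k), Module.finrank ℚ W = 1 ∧
      γ * e k - (γ * Real.log 2 + Real.log n / 2) ≤ height θ W := by
    have h1 : Filter.Tendsto (fun k ↦ Real.exp (e k) / 2) Filter.atTop Filter.atTop :=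
      (Real.tendsto_exp_atTop.comp htend).atTop_div_const two_pos
    have h2 : Filter.Tendsto (fun k ↦ (γ - 1 / a) * e k) Filter.atTop Filter.atTop :=
      htend.const_mul_atTop hγa'
    obtain ⟨k₀, hk₀⟩ := Filter.eventually_atTop.1 ((h1.eventually_gt_atTop T).and
      (h2.eventually_gt_atTop (Real.log (2 * n) + γ * Real.log 2)))
    refine ⟨k₀, fun k hk ↦ ?_⟩
    obtain ⟨hkT, hkbig⟩ := hk₀ k hk
    obtain ⟨y, hy0, hyt, hyerr⟩ := hsim _ hkT
    have hB : (Real.exp (e k) / 2) ^ (-γ) = Real.exp (γ * Real.log 2 - γ * e k) := by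
      rw [Real.rpow_def_of_pos (by positivity), Real.log_div (Real.exp_ne_zero _) two_ne_zero,
        Real.log_exp]
      congr 1
      ring
    rw [hB] at hyerr
    have hXk : X k ≤ Real.exp (e k / a) := by
      refine (hXmono k).trans ?_
      rw [← Real.log_le_iff_le_exp (by linarith [hX1 (k + 1)]), le_div_iff₀ ha, mul_comm]
      exact s_le k
    have hdot : |∑ j, (x k j : ℝ) * castVec ℝ y j| < 1 := by
      rw [dot_eq θ]
      refine (abs_sub _ _).trans_lt ?_
      have h3 := abs_sum_mul_le (hX k) hyerr
      have h4 : |(y 0 : ℝ) * linForm θ (x k)| ≤ 1 / 2 := by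
        rw [abs_mul]
        calc _ ≤ Real.exp (e k) / 2 * |linForm θ (x k)| := by gcongr
          _ = 1 / 2 := by
            rw [hLexp k, div_mul_eq_mul_div, ← Real.exp_add, add_neg_cancel, Real.exp_zero]
      have h5 : n * (X k * Real.exp (γ * Real.log 2 - γ * e k)) < 1 / 2 := by
        have h6 : (2 * n : ℝ) * (Real.exp (e k / a) * Real.exp (γ * Real.log 2 - γ * e k)) < 1 := by
          rw [← Real.exp_log (show (0 : ℝ) < 2 * n by positivity), ← Real.exp_add,
            ← Real.exp_add, Real.exp_lt_one_iff]
          have : (γ - 1 / a) * e k = γ * e k - e k / a := by ring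
          linarith
        have h7 : (n : ℝ) * (X k * Real.exp (γ * Real.log 2 - γ * e k)) ≤
            n * (Real.exp (e k / a) * Real.exp (γ * Real.log 2 - γ * e k)) := by gcongr
        linarith
      simp only [castVec_apply]
      linarith
    have hxy : ∑ j, x k j * y j = 0 := by
      have : |∑ j, x k j * y j| < 1 := by
        simp only [castVec_apply] at hdot
        exact_mod_cast hdot
      exact Int.abs_lt_one_iff.1 this
    have hyne : y ≠ 0 := fun h ↦ hy0 (by simp [h])
    refine ⟨Submodule.span ℚ {castVec ℚ y}, ?_, ?_, ?_⟩
    · rw [Submodule.span_singleton_le_iff_mem]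
      exact castVec_mem_perp.2 hxy
    · exact finrank_span_singleton fun h ↦ hyne (castVec_injective ℚ (by simpa using h))
    · have := height_span_singleton θ (hne k) hn hyne hxy (Real.exp_pos _) hyerr
      rw [Real.log_exp] at this
      linarith
  obtain ⟨k₀, hk₀⟩ := hline
  set C := max (γ * Real.log 2 + Real.log n / 2) (Real.log (2 * n)) with hC
  have hC1 : γ * Real.log 2 + Real.log n / 2 ≤ C := le_max_left _ _
  have hC2 : Real.log (2 * n) ≤ C := le_max_right _ _
  have hC0 : 0 ≤ C := (Real.log_nonneg (by linarith)).trans hC2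
  have hXpos : ∀ k, 0 < X k := fun k ↦ by linarith [hX1 k]
  refine false_of_height_inequalities (n := n) (C := C) (s := fun k ↦ Real.log (X (k + k₀)))
    (e := fun k ↦ e (k + k₀)) (H := fun k ↦ perp (x (k + k₀))) (c := height θ)
    hg ha hab hbg hγ hC0 (height_bot θ) ?_ ?_ ?_ ?_ ?_ ?_ ?_ ?_ ?_ ?_ ?_
  · intro k W hW
    have h1 := Submodule.finrank_mono (R := ℚ) hW
    have h2 : ¬ (⊤ : Submodule ℚ (Fin (n + 1) → ℚ)) ≤ perp (x (k + k₀)) := by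
      intro h
      refine hne (k + k₀) ?_
      have : ∀ j, x (k + k₀) j = 0 := fun j ↦ by
        have := mem_perp.1 (h (Submodule.mem_top (x := Pi.single j (1 : ℚ))))
        simpa [Pi.single_apply] using this
      simp [linForm, this]
    have h3 := finrank_inf_perp h2
    rw [top_inf_eq, finrank_top, Module.finrank_fin_fun] at h3
    omega
  · exact fun k W hW ↦ finrank_inf_perp hW
  · exact fun k ↦ exists_height_le θ (hne _)
  · exact fun k ↦ (neg_log_le_height_perp θ (hne _)).trans (by linarith)
  · intro k
    obtain ⟨W, h1, h2, h3⟩ := hk₀ (k + k₀) (by omega)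
    exact ⟨W, h1, h2, by linarith⟩
  · intro k M hM hM'
    rw [show k + 1 + k₀ = k + k₀ + 1 by ring] at hM ⊢
    set j := k + k₀
    have h1 := height_inf_perp θ (hne (j + 1)) hM hM'
      (A := 2 * n * (X (j + 1) * |linForm θ (x j)| / |linForm θ (x (j + 1))|))
      (by have := hXpos (j + 1); have := hLpos j; have := hLpos (j + 1); positivity) ?_
    · rw [Real.log_mul (by positivity) (by
          have := hXpos (j + 1); have := hLpos j; have := hLpos (j + 1); positivity),
        Real.log_div (by have := hXpos (j + 1); have := hLpos j; positivity) (hLpos _).ne',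
        Real.log_mul (hXpos _).ne' (hLpos _).ne'] at h1
      simp only [he]
      linarith
    · intro y hy
      refine (abs_dot_le_of_mem_realPerp θ (hX (j + 1)) (hX j) (hne _) hy).trans ?_
      have h2 : X j ≤ X (j + 1) * |linForm θ (x j)| / |linForm θ (x (j + 1))| := by
        rw [le_div_iff₀ (hLpos _)]
        exact mul_le_mul (hXmono j) (hanti j).le (abs_nonneg _) (hXpos _).le
      refine mul_le_mul_of_nonneg_right ?_ (norm_nonneg _)
      rw [mul_comm 2 (n : ℝ), mul_assoc]
      exact mul_le_mul_of_nonneg_left (by linarith) n.cast_nonneg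
  · intro k N hN hN'
    simp only [show k + 1 + k₀ = k + k₀ + 1 by ring] at hN' ⊢
    set j := k + k₀
    have h1 := height_inf_perp θ (hne j) hN hN' (A := 2 * n * X (j + 1))
      (by have := hXpos (j + 1); positivity) ?_
    · rw [Real.log_mul (by positivity) (hXpos _).ne'] at h1
      linarith
    · intro y hy
      refine (abs_dot_le_of_mem_realPerp θ (hX j) (hX (j + 1)) (hne _) hy).trans ?_
      have h2 : X j * |linForm θ (x (j + 1))| / |linForm θ (x j)| ≤ X (j + 1) := by
        rw [div_le_iff₀ (hLpos _)]
        exact mul_le_mul (hXmono j) (hanti j).le (abs_nonneg _) (hXpos _).le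
      refine mul_le_mul_of_nonneg_right ?_ (norm_nonneg _)
      rw [mul_comm 2 (n : ℝ), mul_assoc]
      exact mul_le_mul_of_nonneg_left (by linarith) n.cast_nonneg
  · exact fun k N hN M hM ↦ height_submodular θ (hne _) hN hM
  · intro k
    rw [show k + 1 + k₀ = k + k₀ + 1 by ring]
    exact s_le _
  · exact fun k ↦ e_le _
  · exact htend.comp (Filter.tendsto_add_atTop_nat k₀)

end Projection

section MinimalPoints

variable {n : ℕ} {θ : Fin n → ℝ}

/-- The largest absolute value of the coordinates other than the first. -/
def tailHeight (x : Fin (n + 1) → ℤ) : ℕ := Finset.univ.sup fun i : Fin n ↦ (x i.succ).natAbs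

lemma abs_le_tailHeight (x : Fin (n + 1) → ℤ) (i : Fin n) :
    |(x i.succ : ℝ)| ≤ tailHeight x := by
  have h : (x i.succ).natAbs ≤ tailHeight x :=
    Finset.le_sup (f := fun i : Fin n ↦ (x i.succ).natAbs) (Finset.mem_univ i)
  rw [← Int.cast_abs, Int.abs_eq_natAbs]
  exact_mod_cast h

lemma tailHeight_le {x : Fin (n + 1) → ℤ} {t : ℝ} (ht : 0 ≤ t)
    (hx : ∀ i : Fin n, |(x i.succ : ℝ)| ≤ t) : (tailHeight x : ℝ) ≤ t := by
  rw [← Nat.le_floor_iff ht]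
  refine Finset.sup_le fun i _ ↦ Nat.le_floor ?_
  have := hx i
  rwa [← Int.cast_abs, Int.abs_eq_natAbs] at this

lemma one_le_tailHeight {x : Fin (n + 1) → ℤ} (hx : ∃ i : Fin n, x i.succ ≠ 0) :
    1 ≤ tailHeight x := by
  obtain ⟨i, hi⟩ := hx
  have h : (x i.succ).natAbs ≤ tailHeight x :=
    Finset.le_sup (f := fun i : Fin n ↦ (x i.succ).natAbs) (Finset.mem_univ i)
  omega

lemma linForm_ne_zero (hindep : LinearIndependent ℚ (Fin.cons 1 θ : Fin (n + 1) → ℝ))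
    {x : Fin (n + 1) → ℤ} (hx : ∃ i : Fin n, x i.succ ≠ 0) : linForm θ x ≠ 0 := by
  intro h
  obtain ⟨i, hi⟩ := hx
  refine hi ?_
  have := Fintype.linearIndependent_iff.1 hindep (fun j ↦ (x j : ℚ)) (by
    rw [Fin.sum_univ_succ, ← h, linForm]
    simp [Rat.smul_def, mul_comm]) i.succ
  exact_mod_cast this

variable (θ) in
lemma finite_setOf_tailHeight_le (B : ℕ) (c : ℝ) :
    {x : Fin (n + 1) → ℤ | tailHeight x ≤ B ∧ |linForm θ x| ≤ c}.Finite := by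
  set M : ℤ := max B ⌈c + ∑ i : Fin n, |θ i| * B⌉
  refine (Set.finite_Icc (fun _ ↦ -M : Fin (n + 1) → ℤ) fun _ ↦ M).subset ?_
  rintro x ⟨hB, hc⟩
  suffices h : ∀ j, |x j| ≤ M from ⟨fun j ↦ (abs_le.1 (h j)).1, fun j ↦ (abs_le.1 (h j)).2⟩
  have hx : ∀ i : Fin n, |(x i.succ : ℝ)| ≤ B := fun i ↦
    (abs_le_tailHeight x i).trans (by exact_mod_cast hB)
  refine Fin.cases ?_ fun i ↦ ?_
  · refine le_max_of_le_right ?_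
    have h1 : |(x 0 : ℝ)| ≤ c + ∑ i : Fin n, |θ i| * B := by
      have h2 : (x 0 : ℝ) = linForm θ x - ∑ i : Fin n, θ i * (x i.succ : ℝ) := by
        rw [linForm]; ring
      rw [h2]
      refine (abs_sub _ _).trans (add_le_add hc ((Finset.abs_sum_le_sum_abs _ _).trans ?_))
      gcongr with i
      rw [abs_mul]
      gcongr
      exact hx i
    have h3 := h1.trans (Int.le_ceil _)
    rw [← Int.cast_abs] at h3
    exact_mod_cast h3
  · refine le_max_of_le_left ?_
    have := hx i
    rw [← Int.cast_abs] at this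
    exact_mod_cast this

lemma exists_minimal_tailHeight
    (hsmall : ∀ ε : ℝ, 0 < ε → ∃ p : Fin (n + 1) → ℤ, (∃ i : Fin n, p i.succ ≠ 0) ∧
      |linForm θ p| < ε) {ε : ℝ} (hε : 0 < ε) :
    ∃ p : Fin (n + 1) → ℤ, (∃ i : Fin n, p i.succ ≠ 0) ∧ |linForm θ p| < ε ∧
      ∀ q : Fin (n + 1) → ℤ, (∃ i : Fin n, q i.succ ≠ 0) → |linForm θ q| < ε →
        tailHeight p ≤ tailHeight q := by
  obtain ⟨p, hp, hmin⟩ := exists_minimalFor_of_wellFoundedLT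
    (fun p : Fin (n + 1) → ℤ ↦ (∃ i : Fin n, p i.succ ≠ 0) ∧ |linForm θ p| < ε)
    tailHeight (hsmall ε hε)
  exact ⟨p, hp.1, hp.2, fun q h1 h2 ↦ (le_total _ _).elim id (hmin ⟨h1, h2⟩)⟩

/-- A sequence of points with nonzero tail, each minimizing the height among the points at which
the linear form is smaller in absolute value than at its predecessor. -/
lemma exists_minimal_points
    (hindep : LinearIndependent ℚ (Fin.cons 1 θ : Fin (n + 1) → ℝ))
    (hsmall : ∀ ε : ℝ, 0 < ε → ∃ p : Fin (n + 1) → ℤ, (∃ i : Fin n, p i.succ ≠ 0) ∧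
      |linForm θ p| < ε) :
    ∃ z : ℕ → Fin (n + 1) → ℤ, (∀ k, ∃ i : Fin n, z k i.succ ≠ 0) ∧
      (∀ k, |linForm θ (z (k + 1))| < |linForm θ (z k)|) ∧
      (∀ k q, (∃ i : Fin n, q i.succ ≠ 0) → |linForm θ q| < |linForm θ (z k)| →
        tailHeight (z (k + 1)) ≤ tailHeight q) ∧
      Monotone fun k ↦ tailHeight (z k) := by
  have hstep : ∀ y : {y : Fin (n + 1) → ℤ // ∃ i : Fin n, y i.succ ≠ 0},
      ∃ p : {y : Fin (n + 1) → ℤ // ∃ i : Fin n, y i.succ ≠ 0},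
        |linForm θ p| < |linForm θ y| ∧
        ∀ q : Fin (n + 1) → ℤ, (∃ i : Fin n, q i.succ ≠ 0) → |linForm θ q| < |linForm θ y| →
          tailHeight p.1 ≤ tailHeight q := fun y ↦ by
    obtain ⟨p, h1, h2⟩ := exists_minimal_tailHeight hsmall
      (abs_pos.2 (linForm_ne_zero hindep y.2))
    exact ⟨⟨p, h1⟩, h2⟩
  choose next hnext hmin using hstep
  obtain ⟨p₀, hp₀, -⟩ := hsmall 1 one_pos
  set y : ℕ → {y : Fin (n + 1) → ℤ // ∃ i : Fin n, y i.succ ≠ 0} := fun k ↦ next^[k] ⟨p₀, hp₀⟩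
  have hy : ∀ k, y (k + 1) = next (y k) := fun k ↦ Function.iterate_succ_apply' _ _ _
  have hlt : ∀ k, |linForm θ (y (k + 1))| < |linForm θ (y k)| := fun k ↦ hy k ▸ hnext _
  refine ⟨fun k ↦ y (k + 1), fun k ↦ (y (k + 1)).2, fun k ↦ hlt _, fun k q h1 h2 ↦ ?_,
    monotone_nat_of_le_succ fun k ↦ ?_⟩
  · simp only [hy (k + 1)]
    exact hmin _ q h1 h2
  · simp only [hy k]
    exact hmin _ _ (y (k + 1 + 1)).2 ((hlt _).trans (hlt _))

lemma exists_tailHeight_gt {z : ℕ → Fin (n + 1) → ℤ}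
    (hanti : StrictAnti fun k ↦ |linForm θ (z k)|) (B : ℕ) : ∃ k, B < tailHeight (z k) := by
  by_contra! h
  refine Set.infinite_range_of_injective (f := z) (fun i j hij ↦ hanti.injective (by simp [hij]))
    ((finite_setOf_tailHeight_le θ B |linForm θ (z 0)|).subset ?_)
  rintro _ ⟨k, rfl⟩
  exact ⟨h k, hanti.antitone k.zero_le⟩

theorem false_of_solvable {T₁ T₂ T₃ a b g γ : ℝ} (hn : 1 ≤ n)
    (hindep : LinearIndependent ℚ (Fin.cons 1 θ : Fin (n + 1) → ℝ))
    (hg : 1 < g) (ha : 0 < a) (hab : a ≤ b) (hbg : b / a < g) (hγ : g ^ n < γ * a * g)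
    (hunif : ∀ t, T₁ < t → LinSolvable n θ a t) (hreg : ∀ t, T₂ < t → ¬ LinSolvable n θ b t)
    (hsim : ∀ t, T₃ < t → SimSolvable n θ γ t) : False := by
  have hpow : ∀ u, (Real.exp u) ^ (-a) = Real.exp (-(a * u)) := fun u ↦ by
    rw [← Real.exp_mul]
    congr 1
    ring
  have hsmall : ∀ ε : ℝ, 0 < ε → ∃ p : Fin (n + 1) → ℤ, (∃ i : Fin n, p i.succ ≠ 0) ∧
      |linForm θ p| < ε := fun ε hε ↦ by
    obtain ⟨u, hu1, hu2⟩ := ((Real.tendsto_exp_atTop.eventually_gt_atTop T₁).and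
      (Filter.eventually_gt_atTop (-Real.log ε / a))).exists
    obtain ⟨p, hp, -, hL⟩ := hunif _ hu1
    refine ⟨p, hp, hL.trans_lt ?_⟩
    rw [hpow, ← Real.lt_log_iff_exp_lt hε]
    rw [div_lt_iff₀ ha] at hu2
    linarith
  obtain ⟨z, hz, hlt, hmin, hmono⟩ := exists_minimal_points hindep hsmall
  have hanti : StrictAnti fun k ↦ |linForm θ (z k)| := strictAnti_nat_of_succ_lt hlt
  have hne : ∀ k, linForm θ (z k) ≠ 0 := fun k ↦ linForm_ne_zero hindep (hz k)
  have hX1 : ∀ k, (1 : ℝ) ≤ tailHeight (z k) := fun k ↦ by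
    exact_mod_cast one_le_tailHeight (hz k)
  have hXtend : Filter.Tendsto (fun k ↦ (tailHeight (z k) : ℝ)) Filter.atTop Filter.atTop :=
    tendsto_natCast_atTop_atTop.comp (Filter.tendsto_atTop_atTop_of_monotone hmono fun B ↦
      (exists_tailHeight_gt hanti B).imp fun _ ↦ le_of_lt)
  have htend : Filter.Tendsto (fun k ↦ -Real.log |linForm θ (z k)|) Filter.atTop Filter.atTop := by
    refine Filter.tendsto_atTop_atTop_of_monotone (fun i j hij ↦ neg_le_neg
      (Real.log_le_log (abs_pos.2 (hne j)) (hanti.antitone hij))) fun B ↦ ?_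
    obtain ⟨p, hp, hpB⟩ := hsmall (Real.exp (-B)) (Real.exp_pos _)
    obtain ⟨k, hk⟩ := exists_tailHeight_gt hanti (tailHeight p)
    have h1 : |linForm θ (z k)| ≤ |linForm θ p| := by
      by_contra! h
      exact absurd ((hmono k.le_succ).trans (hmin k p hp h)) hk.not_ge
    refine ⟨k, ?_⟩
    rw [le_neg, Real.log_le_iff_le_exp (abs_pos.2 (hne k))]
    exact h1.trans hpB.le
  obtain ⟨N, hN⟩ := Filter.eventually_atTop.1 ((hXtend.eventually_gt_atTop T₂).and
    ((Real.tendsto_exp_atTop.comp (htend.atTop_div_const ha)).eventually_gt_atTop T₁))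
  refine false_of_minimal_sequence θ (x := fun k ↦ z (k + N))
    (X := fun k ↦ tailHeight (z (k + N))) hn hg ha hab hbg hγ (fun k ↦ abs_le_tailHeight _)
    (fun k ↦ hX1 _) (fun k ↦ ?_) (fun k ↦ hne _) (fun k ↦ ?_) (fun k ↦ ?_) (fun k ↦ ?_)
    (htend.comp (Filter.tendsto_add_atTop_nat N)) hsim
  · exact_mod_cast hmono (by omega)
  · exact hanti (by omega)
  · rw [← le_div_iff₀' ha]
    refine le_of_forall_gt_imp_ge_of_dense fun u hu ↦ ?_
    have hT := (hN (k + N) (by omega)).2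
    obtain ⟨p, hp, hpX, hpL⟩ := hunif _ (hT.trans (Real.exp_lt_exp.2 hu))
    rw [Real.log_le_iff_le_exp (by linarith [hX1 (k + 1 + N)])]
    refine le_trans ?_ (tailHeight_le (Real.exp_pos _).le hpX)
    rw [show k + 1 + N = k + N + 1 by ring]
    refine Nat.cast_le.2 (hmin _ p hp (hpL.trans_lt ?_))
    rw [hpow, ← Real.lt_log_iff_exp_lt (abs_pos.2 (hne _))]
    rw [div_lt_iff₀ ha] at hu
    linarith
  · have hT := (hN (k + N) (by omega)).1
    have h1 : (tailHeight (z (k + N)) : ℝ) ^ (-b) < |linForm θ (z (k + N))| := by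
      by_contra! h
      exact hreg _ hT ⟨z (k + N), hz _, abs_le_tailHeight _, h⟩
    have h2 : (0 : ℝ) < tailHeight (z (k + N)) := by linarith [hX1 (k + N)]
    have h3 := Real.log_lt_log (Real.rpow_pos_of_pos h2 _) h1
    rw [Real.log_rpow h2] at h3
    linarith

lemma linSolvable_one (hn : 1 ≤ n) {t : ℝ} (ht : 1 < t) : LinSolvable n θ 1 t := by
  have hN : 0 < ⌊t⌋₊ := Nat.floor_pos.2 ht.le
  obtain ⟨j, k, hk, hkN, h⟩ := Real.exists_int_int_abs_mul_sub_le (θ ⟨0, hn⟩) hN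
  have hkt : (k : ℝ) ≤ t :=
    le_trans (by exact_mod_cast hkN) (Nat.floor_le (zero_le_one.trans ht.le))
  refine ⟨Fin.cons (-j) (Pi.single ⟨0, hn⟩ k), ⟨⟨0, hn⟩, by
    rw [Fin.cons_succ, Pi.single_eq_same]; exact hk.ne'⟩, fun i ↦ ?_, ?_⟩
  · rw [Fin.cons_succ]
    rcases eq_or_ne i ⟨0, hn⟩ with rfl | hi
    · rw [Pi.single_eq_same, abs_of_pos (by exact_mod_cast hk)]
      exact hkt
    · rw [Pi.single_eq_of_ne hi]
      simpa using (zero_le_one.trans ht.le)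
  · rw [Finset.sum_eq_single ⟨0, hn⟩ (fun i _ hi ↦ by simp [Pi.single_eq_of_ne hi]) (by simp),
      Fin.cons_zero, Fin.cons_succ, Pi.single_eq_same, Real.rpow_neg_one]
    have : (-j : ℤ) + θ ⟨0, hn⟩ * k = k * θ ⟨0, hn⟩ - j := by push_cast; ring
    rw [this]
    refine h.trans ?_
    rw [one_div]
    exact inv_anti₀ (by linarith) (Nat.lt_floor_add_one t).le

lemma one_le_omegaHatExp (hn : 1 ≤ n) : 1 ≤ omegaHatExp n θ :=
  le_sSup ⟨1, one_pos, ENNReal.ofReal_one.symm, 1, fun _ ↦ linSolvable_one hn⟩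

variable (n θ) in
lemma omegaHatExp_le_omegaExp : omegaHatExp n θ ≤ omegaExp n θ := by
  refine sSup_le_sSup ?_
  rintro _ ⟨γ, h0, rfl, T, hT⟩
  refine ⟨γ, h0, rfl, fun T' ↦ ⟨max T T' + 1, ?_, hT _ ?_⟩⟩
  · linarith [le_max_right T T']
  · linarith [le_max_left T T']

lemma linSolvable_anti {a a' t : ℝ} (ht : 1 ≤ t) (ha : a ≤ a') (h : LinSolvable n θ a' t) :
    LinSolvable n θ a t := by
  obtain ⟨x, h1, h2, h3⟩ := h
  exact ⟨x, h1, h2, h3.trans (Real.rpow_le_rpow_of_exponent_le ht (neg_le_neg ha))⟩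

lemma exists_linSolvable_of_lt_omegaHatExp {a : ℝ} (ha : ENNReal.ofReal a < omegaHatExp n θ) :
    ∃ T, ∀ t, T < t → LinSolvable n θ a t := by
  obtain ⟨_, ⟨a', h0, rfl, T, hT⟩, h⟩ := lt_sSup_iff.1 ha
  have h' := (ENNReal.ofReal_lt_ofReal_iff h0).1 h
  exact ⟨max T 1, fun t ht ↦ linSolvable_anti ((le_max_right _ _).trans ht.le) h'.le
    (hT t ((le_max_left _ _).trans_lt ht))⟩

lemma exists_not_linSolvable_of_omegaExp_lt {b : ℝ} (hb0 : 0 < b)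
    (hb : omegaExp n θ < ENNReal.ofReal b) : ∃ T, ∀ t, T < t → ¬ LinSolvable n θ b t := by
  by_contra! h
  exact (le_sSup ⟨b, hb0, rfl, h⟩ : ENNReal.ofReal b ≤ omegaExp n θ).not_gt hb

end MinimalPoints

lemma exists_perturbation {n : ℕ} (hn : 2 ≤ n) {w w' γ : ℝ} (hw' : 0 < w')
    (h : w ^ (n - 1) / w' ^ n < γ) :
    ∃ ε, 0 < ε ∧ ε < w' ∧ ((w + ε) / (w' - ε) + ε) ^ (n - 1) < γ * (w' - ε) := by
  have h0 : ((w + 0) / (w' - 0) + 0) ^ (n - 1) < γ * (w' - 0) := by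
    obtain ⟨m, rfl⟩ : ∃ m, n = m + 1 := ⟨n - 1, by omega⟩
    simp only [add_zero, sub_zero, add_tsub_cancel_right] at h ⊢
    rw [div_lt_iff₀ (by positivity)] at h
    rw [div_pow, div_lt_iff₀ (by positivity)]
    calc _ < _ := h
      _ = _ := by ring
  have hc : ContinuousAt (fun ε : ℝ ↦ ((w + ε) / (w' - ε) + ε) ^ (n - 1)) 0 := by
    have : w' - 0 ≠ 0 := by simpa using hw'.ne'
    fun_prop (disch := assumption)
  have hc' : ContinuousAt (fun ε : ℝ ↦ γ * (w' - ε)) 0 := by fun_prop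
  have hev := (hc.eventually_lt hc' h0).and (gt_mem_nhds hw')
  obtain ⟨ε, ⟨h1, h2⟩, h3⟩ := ((hev.filter_mono nhdsWithin_le_nhds).and
    (self_mem_nhdsWithin : Set.Ioi (0 : ℝ) ∈ nhdsWithin 0 (Set.Ioi 0))).exists
  exact ⟨ε, h3, h2, h1⟩

end TransferenceProof

/-- if `1, θ₁, …, θₙ` are linearly independent over `ℚ` and `ω < ∞`, then
`λ̂ ≤ ω^{n-1}/ω̂ⁿ`. -/
theorem stmt13 (n : ℕ) (hn : 2 ≤ n) (θ : Fin n → ℝ)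
    (hindep : LinearIndependent ℚ (Fin.cons 1 θ : Fin (n+1) → ℝ))
    (hω : omegaExp n θ < ⊤) :
    lambdaHatExp n θ ≤ (omegaExp n θ) ^ (n - 1) / (omegaHatExp n θ) ^ n := by
  by_contra! hlt
  obtain ⟨_, ⟨γ, hγ0, rfl, T₃, hsim⟩, hγ⟩ := lt_sSup_iff.1 hlt
  have h1 := TransferenceProof.one_le_omegaHatExp (θ := θ) (by omega : 1 ≤ n)
  have h2 := TransferenceProof.omegaHatExp_le_omegaExp n θ
  obtain ⟨w, hw⟩ := ENNReal.canLift.prf _ hω.ne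
  obtain ⟨w', hw'⟩ := ENNReal.canLift.prf _ (h2.trans_lt hω).ne
  rw [← hw'] at h1
  rw [← hw, ← hw'] at h2 hγ
  have h1R : (1 : ℝ) ≤ w' := by exact_mod_cast h1
  have h2R : (w' : ℝ) ≤ w := by exact_mod_cast h2
  have hw'0 : w' ≠ 0 := fun h ↦ by simp [h] at h1R; linarith
  have hγR : (w : ℝ) ^ (n - 1) / (w' : ℝ) ^ n < γ := by
    rw [← ENNReal.coe_pow, ← ENNReal.coe_pow, ← ENNReal.coe_div (pow_ne_zero _ hw'0),
      ENNReal.ofReal, ENNReal.coe_lt_coe, Real.lt_toNNReal_iff_coe_lt] at hγ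
    exact_mod_cast hγ
  obtain ⟨ε, hε, hεw, hpert⟩ := TransferenceProof.exists_perturbation hn (by linarith) hγR
  have ha : 0 < (w' : ℝ) - ε := by linarith
  obtain ⟨T₁, hT₁⟩ := TransferenceProof.exists_linSolvable_of_lt_omegaHatExp (n := n) (θ := θ)
    (a := w' - ε) (by
      rw [← hw', ENNReal.ofReal, ENNReal.coe_lt_coe, Real.toNNReal_lt_iff_lt_coe ha.le]
      linarith)
  obtain ⟨T₂, hT₂⟩ := TransferenceProof.exists_not_linSolvable_of_omegaExp_lt (n := n) (θ := θ)
    (b := w + ε) (by linarith) (by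
      rw [← hw, ENNReal.ofReal, ENNReal.coe_lt_coe, Real.lt_toNNReal_iff_coe_lt]
      linarith)
  have hq : 1 ≤ (w + ε) / (w' - ε) := (one_le_div ha).2 (by linarith)
  refine TransferenceProof.false_of_solvable (g := (w + ε) / (w' - ε) + ε) (by omega) hindep
    (by linarith) ha (by linarith) (by linarith) ?_ hT₁ hT₂ hsim
  calc _ = ((w + ε) / (w' - ε) + ε) ^ (n - 1) * ((w + ε) / (w' - ε) + ε) := by
        rw [← pow_succ, Nat.sub_add_cancel (by omega)]
    _ < _ := mul_lt_mul_of_pos_right hpert (by linarith)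
end

section
/- Suppose 1, θ₁, …, θₙ are linearly independent over ℚ and ω < ∞. Then λ ≤ ωⁿ/ω̂^{n+1}. -/
open scoped ENNReal


section Segments

open Module Submodule

variable {V : Type*} [AddCommGroup V] [Module ℝ V]

/-- The span of the consecutive vectors `y a, …, y p`. -/
def segSpan (y : ℕ → V) (a p : ℕ) : Submodule ℝ V := span ℝ (y '' Set.Icc a p)

lemma mem_segSpan (y : ℕ → V) {a p i : ℕ} (h1 : a ≤ i) (h2 : i ≤ p) : y i ∈ segSpan y a p :=
  subset_span ⟨i, ⟨h1, h2⟩, rfl⟩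

lemma segSpan_mono (y : ℕ → V) {a a' p p' : ℕ} (h1 : a' ≤ a) (h2 : p ≤ p') :
    segSpan y a p ≤ segSpan y a' p' :=
  span_mono (Set.image_mono (Set.Icc_subset_Icc h1 h2))

lemma segSpan_self (y : ℕ → V) (a : ℕ) : segSpan y a a = span ℝ {y a} := by
  simp [segSpan]

lemma segSpan_succ_right (y : ℕ → V) {a p : ℕ} (h : a ≤ p + 1) :
    segSpan y a (p + 1) = span ℝ {y (p + 1)} ⊔ segSpan y a p := by
  rw [segSpan, ← Set.insert_Icc_right_eq_Icc_add_one h, Set.image_insert_eq, span_insert, segSpan]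

lemma segSpan_left (y : ℕ → V) {a p : ℕ} (h : a ≤ p) :
    segSpan y a p = span ℝ {y a} ⊔ segSpan y (a + 1) p := by
  rw [segSpan, ← Set.insert_Icc_add_one_left_eq_Icc h, Set.image_insert_eq, span_insert, segSpan]

lemma segSpan_left_of_mem (y : ℕ → V) {a p : ℕ} (h : a ≤ p) (hy : y a ∈ segSpan y (a + 1) p) :
    segSpan y (a + 1) p = segSpan y a p := by
  rw [segSpan_left y h, eq_comm, sup_eq_right, span_singleton_le_iff_mem]
  exact hy

lemma exists_segSpan_left_notMem (y : ℕ → V) {a p : ℕ} (h : a ≤ p) (hy : y p ≠ 0) :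
    ∃ a', a ≤ a' ∧ a' ≤ p ∧ segSpan y a' p = segSpan y a p ∧ y a' ∉ segSpan y (a' + 1) p := by
  induction h using Nat.decreasingInduction with
  | self => exact ⟨p, le_rfl, le_rfl, rfl, by simpa [segSpan] using hy⟩
  | of_succ k hk ih =>
    by_cases hm : y k ∈ segSpan y (k + 1) p
    · obtain ⟨a', h1, h2, h3, h4⟩ := ih
      exact ⟨a', by lia, h2, h3.trans (segSpan_left_of_mem y hk.le hm), h4⟩
    · exact ⟨k, le_rfl, hk.le, rfl, hm⟩

lemma exists_segSpan_right_notMem (y : ℕ → V) {a p : ℕ} (h : a ≤ p) :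
    ∃ p', a ≤ p' ∧ p' ≤ p ∧ segSpan y a p' = segSpan y a p ∧
      (p' = a ∨ ∃ q, p' = q + 1 ∧ a ≤ q ∧ y p' ∉ segSpan y a q) := by
  induction p, h using Nat.le_induction with
  | base => exact ⟨a, le_rfl, le_rfl, rfl, Or.inl rfl⟩
  | succ q hq ih =>
    by_cases hm : y (q + 1) ∈ segSpan y a q
    · obtain ⟨p', h1, h2, h3, h4⟩ := ih
      refine ⟨p', h1, by lia, ?_, h4⟩
      rw [h3, segSpan_succ_right y (by lia), eq_comm, sup_eq_right, span_singleton_le_iff_mem]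
      exact hm
    · exact ⟨q + 1, by lia, le_rfl, rfl, Or.inr ⟨q, rfl, hq, hm⟩⟩

variable [FiniteDimensional ℝ V]

lemma finrank_segSpan_succ_right (y : ℕ → V) {a p : ℕ} (h : a ≤ p + 1)
    (hy : y (p + 1) ∉ segSpan y a p) :
    finrank ℝ (segSpan y a (p + 1)) = finrank ℝ (segSpan y a p) + 1 := by
  rw [segSpan_succ_right y h, sup_comm, finrank_sup_span_singleton hy]

lemma finrank_segSpan_left (y : ℕ → V) {a p : ℕ} (h : a ≤ p) (hy : y a ∉ segSpan y (a + 1) p) :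
    finrank ℝ (segSpan y a p) = finrank ℝ (segSpan y (a + 1) p) + 1 := by
  rw [segSpan_left y h, sup_comm, finrank_sup_span_singleton hy]

lemma exists_segSpan_stable (y : ℕ → V) :
    ∃ (T : Submodule ℝ V) (a₀ : ℕ), ∀ a, a₀ ≤ a → ∃ p, a ≤ p ∧ segSpan y a p = T := by
  have tail (a : ℕ) : ∃ p, a ≤ p ∧ segSpan y a p = span ℝ (y '' Set.Ici a) := by
    obtain ⟨p, hp⟩ := monotone_stabilizes_iff_noetherian.2 inferInstance
      (⟨fun p => segSpan y a p, fun p q h => segSpan_mono y le_rfl h⟩ : ℕ →o Submodule ℝ V)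
    refine ⟨max a p, le_max_left _ _, le_antisymm
      (span_mono (Set.image_mono Set.Icc_subset_Ici_self)) (span_le.2 ?_)⟩
    rintro _ ⟨i, hi, rfl⟩
    have h1 : segSpan y a p = segSpan y a (max a p) := hp (max a p) (le_max_right _ _)
    have h2 : segSpan y a p = segSpan y a (max i p) := hp (max i p) (le_max_right _ _)
    rw [SetLike.mem_coe, ← h1, h2]
    exact mem_segSpan y hi (le_max_left _ _)
  obtain ⟨a₀, h₀⟩ := IsArtinian.monotone_stabilizes
    (⟨fun a => OrderDual.toDual (span ℝ (y '' Set.Ici a)), fun a b h =>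
      OrderDual.toDual_le_toDual.2 (span_mono (Set.image_mono (Set.Ici_subset_Ici.2 h)))⟩ :
      ℕ →o (Submodule ℝ V)ᵒᵈ)
  refine ⟨span ℝ (y '' Set.Ici a₀), a₀, fun a ha => ?_⟩
  obtain ⟨p, hp, h⟩ := tail a
  exact ⟨p, hp, h.trans (OrderDual.toDual.injective (h₀ a ha).symm)⟩

end Segments

section Growth

open Module Submodule

variable {V : Type*} [AddCommGroup V] [Module ℝ V]

/-- A sequence of vectors with logarithmic sizes `u` such that the function `d` on subspaces
decreases in a controlled way when a neighbouring vector is added to a segment. -/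
structure SegmentSystem (y : ℕ → V) (u : ℕ → ℝ) (d : Submodule ℝ V → ℝ) (b K : ℝ) : Prop where
  notMem_span : ∀ a p, a < p → y p ∉ span ℝ {y a}
  line : ∀ a, b * u (a + 1) ≤ d (span ℝ {y a})
  left : ∀ a p, a + 1 ≤ p → y a ∉ segSpan y (a + 1) p →
    d (segSpan y (a + 1) p) ≤ d (segSpan y a p) + K * u (a + 1)
  right : ∀ a p, a ≤ p → y (p + 1) ∉ segSpan y a p →
    d (segSpan y a p) ≤ d (segSpan y a (p + 1)) + u (p + 1)
  ne_zero : ∀ a, y a ≠ 0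

namespace SegmentSystem

variable [FiniteDimensional ℝ V] {y : ℕ → V} {u : ℕ → ℝ} {d : Submodule ℝ V → ℝ} {b K G : ℝ}

lemma eq_of_finrank_eq_one (h : SegmentSystem y u d b K) {a p : ℕ} (hap : a ≤ p)
    (hr : finrank ℝ (segSpan y a p) = 1) : a = p := by
  by_contra hne
  have hlt : a < p := lt_of_le_of_ne hap hne
  have hle : span ℝ {y a} ≤ segSpan y a p :=
    (span_singleton_le_iff_mem _ _).2 (mem_segSpan y le_rfl hap)
  have heq : span ℝ {y a} = segSpan y a p :=
    eq_of_le_of_finrank_eq hle (by rw [hr, finrank_span_singleton (h.ne_zero a)])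
  exact h.notMem_span a p hlt (heq ▸ mem_segSpan y hap le_rfl)

variable {c : ℕ → ℝ}

lemma size_le_of_bound (h : SegmentSystem y u d b K) (hK : 0 ≤ K) {k : ℕ}
    (hG : ∀ i, c (i + 1) + K = G * c i) (hpos : ∀ i ≤ k, 0 < c i)
    (hc : ∀ i ≤ k, ∀ a p, a ≤ p → y a ∉ segSpan y (a + 1) p →
      finrank ℝ (segSpan y a p) = i + 1 → c i * u (a + 1) ≤ d (segSpan y a p)) :
    ∀ i ≤ k, ∀ a p R, a + 1 ≤ p → y a ∉ segSpan y (a + 1) p →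
      finrank ℝ (segSpan y a p) = i + 2 → u (a + 1) ≤ R → d (segSpan y a p) ≤ c (i + 1) * R →
      u p ≤ G ^ i * R := by
  intro i
  induction i with
  | zero =>
    intro _ a p R hap hm hr hR _
    rw [finrank_segSpan_left y (by lia) hm] at hr
    rw [← h.eq_of_finrank_eq_one hap (by lia)]
    simpa using hR
  | succ i ih =>
    intro hi a p R hap hm hr hR hd
    rw [finrank_segSpan_left y (by lia) hm] at hr
    obtain ⟨a', h1, h2, h3, h4⟩ := exists_segSpan_left_notMem y hap (h.ne_zero p)
    have hne : a' ≠ p := by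
      rintro rfl
      rw [← h3, segSpan_self, finrank_span_singleton (h.ne_zero a')] at hr
      lia
    have hb : d (segSpan y a' p) ≤ c (i + 1) * (G * R) := by
      rw [h3]
      have e1 := h.left a p hap hm
      have e2 := mul_le_mul_of_nonneg_left hR hK
      have e3 : (c (i + 1 + 1) + K) * R = G * c (i + 1) * R := by rw [hG]
      linarith
    have hr' : finrank ℝ (segSpan y a' p) = i + 2 := by rw [h3]; lia
    have hu : u (a' + 1) ≤ G * R :=
      le_of_mul_le_mul_left ((hc (i + 1) hi a' p h2 h4 hr').trans hb) (hpos _ hi)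
    have := ih (by lia) a' p (G * R) (by lia) h4 hr' hu hb
    rwa [pow_succ, mul_assoc]

lemma lower_bound (h : SegmentSystem y u d b K) (hK : 0 ≤ K) (h0 : c 0 = b)
    (hG : ∀ i, c (i + 1) + K = G * c i) (hs : ∀ i, c (i + 1) + G ^ i = c i) (k : ℕ)
    (hpos : ∀ i ≤ k, 0 < c i) :
    ∀ a p, a ≤ p → y a ∉ segSpan y (a + 1) p →
      finrank ℝ (segSpan y a p) = k + 1 → c k * u (a + 1) ≤ d (segSpan y a p) := by
  induction k using Nat.strong_induction_on with
  | _ k ih =>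
  intro a p hap hm hr
  obtain _ | k := k
  · obtain rfl := h.eq_of_finrank_eq_one hap hr
    rw [h0, segSpan_self]
    exact h.line a
  obtain ⟨p', h1, h2, h3, rfl | ⟨q, rfl, hq, hyq⟩⟩ := exists_segSpan_right_notMem y hap
  · rw [← h3, segSpan_self, finrank_span_singleton (h.ne_zero p')] at hr
    lia
  rw [← h3] at hr ⊢
  have hm' : y a ∉ segSpan y (a + 1) (q + 1) := fun hh => hm (segSpan_mono y le_rfl h2 hh)
  have hm'' : y a ∉ segSpan y (a + 1) q := fun hh => hm' (segSpan_mono y le_rfl (by lia) hh)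
  have hr' := finrank_segSpan_succ_right y (by lia) hyq
  have hI := ih k (by lia) (fun i hi => hpos i (by lia)) a q hq hm'' (by lia)
  by_contra! hlt
  have hu := h.size_le_of_bound hK hG (fun i hi => hpos i (by lia))
    (fun i (hi : i ≤ k) => ih i (by lia) (fun j hj => hpos j (by lia))) k le_rfl a (q + 1)
    (u (a + 1)) (by lia) hm' (by lia) le_rfl hlt.le
  have hR := h.right a q hq hyq
  have := hs k
  have e : (c (k + 1) + G ^ k) * u (a + 1) = c k * u (a + 1) := by rw [hs]
  linarith

lemma false_of_tendsto (h : SegmentSystem y u d b K) (hK : 0 ≤ K) (h0 : c 0 = b)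
    (hG : ∀ i, c (i + 1) + K = G * c i) (hs : ∀ i, c (i + 1) + G ^ i = c i)
    (hpos : ∀ i < finrank ℝ V, 0 < c i) (hmono : Monotone u)
    (hu : Filter.Tendsto u Filter.atTop Filter.atTop) : False := by
  obtain ⟨T, a₀, hT⟩ := exists_segSpan_stable y
  have hle := finrank_le T
  have hr : finrank ℝ T ≠ 0 := by
    obtain ⟨p, hp, rfl⟩ := hT a₀ le_rfl
    rw [Ne, finrank_eq_zero]
    intro h0
    have := mem_segSpan y le_rfl hp
    rw [h0, mem_bot] at this
    exact h.ne_zero _ this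
  obtain ⟨k, hk⟩ := Nat.exists_eq_succ_of_ne_zero hr
  have hck : 0 < c k := hpos k (by lia)
  have key (a : ℕ) (ha : a₀ ≤ a) : u a ≤ d T / c k := by
    obtain ⟨p, hp, hTp⟩ := hT a ha
    obtain ⟨a', h1, h2, h3, h4⟩ := exists_segSpan_left_notMem y hp (h.ne_zero p)
    have := h.lower_bound hK h0 hG hs k (fun i hi => hpos i (by lia)) a' p h2 h4
      (by rw [h3, hTp, hk])
    rw [h3, hTp] at this
    rw [le_div_iff₀ hck, mul_comm]
    exact (mul_le_mul_of_nonneg_left (hmono (by lia)) hck.le).trans this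
  obtain ⟨a, ha1, ha2⟩ :=
    ((Filter.eventually_ge_atTop a₀).and (hu.eventually_gt_atTop (d T / c k))).exists
  exact absurd (key a ha1) (not_le.2 ha2)

end SegmentSystem

end Growth

section Heights

open Module Submodule

variable {n : ℕ} (θ : Fin n → ℝ)

/-- The linear form `v₀ + θ₁ v₁ + … + θₙ vₙ`. -/
def linForm : (Fin (n + 1) → ℝ) →ₗ[ℝ] ℝ :=
  LinearMap.proj 0 + ∑ i, θ i • LinearMap.proj (Fin.succ i)

lemma linForm_apply (v : Fin (n + 1) → ℝ) : linForm θ v = v 0 + ∑ i, θ i * v i.succ := by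
  simp [linForm]

/-- The map sending `v` to the value of the linear form followed by some coordinates of `v`. -/
def formCoords {j : ℕ} (f : Fin j → Fin n) : (Fin (n + 1) → ℝ) →ₗ[ℝ] (Fin (j + 1) → ℝ) :=
  LinearMap.pi (Fin.cons (linForm θ) fun t => LinearMap.proj (f t).succ)

@[simp] lemma formCoords_zero {j : ℕ} (f : Fin j → Fin n) (v : Fin (n + 1) → ℝ) :
    formCoords θ f v 0 = linForm θ v := rfl

@[simp] lemma formCoords_succ {j : ℕ} (f : Fin j → Fin n) (v : Fin (n + 1) → ℝ) (t : Fin j) :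
    formCoords θ f v t.succ = v (f t).succ := rfl

/-- The minor of a tuple of vectors on the linear form and the coordinates selected by `f`. -/
noncomputable def formMinor {j : ℕ} (f : Fin j → Fin n) :
    (Fin (n + 1) → ℝ) [⋀^Fin (j + 1)]→ₗ[ℝ] ℝ :=
  Matrix.detRowAlternating.compLinearMap (formCoords θ f)

lemma formMinor_apply {j : ℕ} (f : Fin j → Fin n) (w : Fin (j + 1) → Fin (n + 1) → ℝ) :
    formMinor θ f w = Matrix.det (Matrix.of fun i => formCoords θ f (w i)) := rfl

/-- The largest absolute value of a minor of a tuple of vectors. -/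
noncomputable def tupleHeight {j : ℕ} (w : Fin (j + 1) → Fin (n + 1) → ℝ) : ℝ :=
  ‖fun f : Fin j → Fin n => formMinor θ f w‖

lemma abs_formMinor_le {j : ℕ} (f : Fin j → Fin n) (w : Fin (j + 1) → Fin (n + 1) → ℝ) :
    |formMinor θ f w| ≤ tupleHeight θ w :=
  norm_le_pi_norm (fun f : Fin j → Fin n => formMinor θ f w) f

lemma tupleHeight_nonneg {j : ℕ} (w : Fin (j + 1) → Fin (n + 1) → ℝ) : 0 ≤ tupleHeight θ w :=
  norm_nonneg _

lemma formMinor_cons_of_linForm_eq_zero {j : ℕ} (f : Fin (j + 1) → Fin n)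
    (z : Fin (n + 1) → ℝ) (hz : linForm θ z = 0) (w : Fin (j + 1) → Fin (n + 1) → ℝ) :
    |formMinor θ f (Fin.cons z w : Fin (j + 2) → Fin (n + 1) → ℝ)| ≤
      (j + 1) * (‖Fin.tail z‖ * tupleHeight θ w) := by
  rw [formMinor_apply, Matrix.det_succ_row_zero, Fin.sum_univ_succ]
  simp only [Matrix.of_apply, Fin.cons_zero, formCoords_zero, formCoords_succ, hz, mul_zero, zero_mul, zero_add]
  refine (Finset.abs_sum_le_sum_abs _ _).trans ?_
  have hle : ∀ t ∈ (Finset.univ : Finset (Fin (j + 1))),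
      |(-1) ^ ((Fin.succ t : Fin (j + 2)) : ℕ) * z (f t).succ *
        ((Matrix.of fun i => formCoords θ f ((Fin.cons z w : Fin (j + 2) → _) i)).submatrix
          Fin.succ t.succ.succAbove).det| ≤ ‖Fin.tail z‖ * tupleHeight θ w := by
    intro t _
    have hm : ((Matrix.of fun i => formCoords θ f ((Fin.cons z w : Fin (j + 2) → _) i)).submatrix
        Fin.succ t.succ.succAbove).det = formMinor θ (f ∘ t.succAbove) w := by
      rw [formMinor_apply]
      congr 1
      ext i s
      refine Fin.cases ?_ (fun s => ?_) s
      · simp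
      · simp
    rw [hm, abs_mul, abs_mul, abs_pow, abs_neg, abs_one, one_pow, one_mul]
    exact mul_le_mul (norm_le_pi_norm (Fin.tail z) (f t)) (abs_formMinor_le θ _ _)
      (abs_nonneg _) (norm_nonneg _)
  refine (Finset.sum_le_card_nsmul _ _ _ hle).trans ?_
  simp

lemma formMinor_cons_of_mem {j : ℕ} (f : Fin (j + 1) → Fin n)
    {y : Fin (n + 1) → ℝ} {w : Fin (j + 1) → Fin (n + 1) → ℝ}
    (hy : y ∈ span ℝ (Set.range w)) :
    formMinor θ f (Fin.cons y w : Fin (j + 2) → Fin (n + 1) → ℝ) = 0 := by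
  refine AlternatingMap.map_linearDependent _ _ fun h => ?_
  exact (linearIndependent_finCons.1 h).2 hy

lemma tupleHeight_cons_le {j : ℕ} {y : Fin (n + 1) → ℝ} {w : Fin (j + 1) → Fin (n + 1) → ℝ}
    (hy : y ∈ span ℝ (Set.range w)) (hL : linForm θ y ≠ 0) (z : Fin (n + 1) → ℝ) :
    tupleHeight θ (Fin.cons z w : Fin (j + 2) → Fin (n + 1) → ℝ) ≤
      (j + 1) * ((‖Fin.tail z‖ + |linForm θ z / linForm θ y| * ‖Fin.tail y‖) *
        tupleHeight θ w) := by
  set c := linForm θ z / linForm θ y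
  have h0 := tupleHeight_nonneg θ w
  refine (pi_norm_le_iff_of_nonneg (by positivity)).2 fun f => ?_
  have hz : linForm θ (z - c • y) = 0 := by
    simp [c, hL]
  have hsplit : formMinor θ f (Fin.cons z w : Fin (j + 2) → Fin (n + 1) → ℝ) =
      formMinor θ f (Fin.cons (z - c • y) w : Fin (j + 2) → Fin (n + 1) → ℝ) := by
    have e1 := MultilinearMap.cons_add (formMinor θ f).toMultilinearMap w (z - c • y) (c • y)
    have e2 := MultilinearMap.cons_smul (formMinor θ f).toMultilinearMap w c y
    simp only [sub_add_cancel, AlternatingMap.coe_multilinearMap] at e1 e2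
    rw [e1, e2, formMinor_cons_of_mem θ f hy, smul_zero, add_zero]
  have ht : ‖Fin.tail (z - c • y)‖ ≤ ‖Fin.tail z‖ + |c| * ‖Fin.tail y‖ := by
    have : Fin.tail (z - c • y) = Fin.tail z - c • Fin.tail y := rfl
    rw [this]
    refine (norm_sub_le _ _).trans ?_
    rw [norm_smul, Real.norm_eq_abs]
  rw [hsplit, Real.norm_eq_abs]
  refine (formMinor_cons_of_linForm_eq_zero θ f _ hz w).trans ?_
  gcongr

/-- The real vector with the coordinates of an integer vector. -/
def intVec {m : ℕ} (z : Fin m → ℤ) : Fin m → ℝ := fun i => z i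

lemma one_le_abs_det_of_intVec {m : ℕ} (w : Fin m → Fin m → ℝ)
    (hw : ∀ i, w i ∈ Set.range (intVec (m := m))) (hli : LinearIndependent ℝ w) :
    1 ≤ |(Matrix.of w).det| := by
  choose z hz using hw
  have hdet : (Matrix.of w).det = ((Matrix.of z).det : ℤ) := by
    have h1 : Matrix.of w = (Int.castRingHom ℝ).mapMatrix (Matrix.of z) := by
      ext i k
      simp [← hz, intVec]
    rw [h1, ← RingHom.map_det]
    rfl
  have hne : (Matrix.of w).det ≠ 0 := by
    have h1 : LinearIndependent ℝ (Matrix.of w).row := hli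
    exact ((Matrix.isUnit_iff_isUnit_det _).1 (Matrix.linearIndependent_rows_iff_isUnit.1 h1)).ne_zero
  rw [hdet] at hne ⊢
  have h2 : (Matrix.of z).det ≠ 0 := by exact_mod_cast hne
  exact_mod_cast Int.one_le_abs h2

lemma one_le_tupleHeight_of_intVec (w : Fin (n + 1) → Fin (n + 1) → ℝ)
    (hw : ∀ i, w i ∈ Set.range (intVec (m := n + 1))) (hli : LinearIndependent ℝ w) :
    1 ≤ tupleHeight θ w := by
  refine (one_le_abs_det_of_intVec w hw hli).trans (le_trans (le_of_eq ?_) (abs_formMinor_le θ id w))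
  have h := Matrix.det_updateCol_sum (Matrix.of w) 0 (Fin.cons 1 θ : Fin (n + 1) → ℝ)
  rw [Fin.cons_zero, one_smul] at h
  rw [← h, formMinor_apply]
  congr 2
  ext i k
  refine Fin.cases ?_ (fun k => ?_) k
  · simp [Fin.sum_univ_succ, linForm_apply]
  · simp

lemma exists_forall_le_tupleHeight (hn : n ≠ 0) {y : Fin (n + 1) → ℝ} (hL : linForm θ y ≠ 0) :
    ∃ ε : ℝ, 0 < ε ∧ ∀ (j : ℕ) (w : Fin (j + 1) → Fin (n + 1) → ℝ),
      (∀ i, w i ∈ Set.range (intVec (m := n + 1))) → LinearIndependent ℝ w →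
      y ∈ span ℝ (Set.range w) → ε ≤ tupleHeight θ w := by
  set e : Fin (n + 1) → Fin (n + 1) → ℝ := fun k => Pi.single k 1 with he
  set C : ℝ := 1 + (∑ k, |linForm θ (e k) / linForm θ y|) * ‖Fin.tail y‖ with hC
  have hC1 : 1 ≤ C := by
    have : 0 ≤ (∑ k, |linForm θ (e k) / linForm θ y|) * ‖Fin.tail y‖ := by positivity
    linarith
  have hn1 : (1 : ℝ) ≤ n := by exact_mod_cast Nat.one_le_iff_ne_zero.2 hn
  have hB : 1 ≤ n * C := one_le_mul_of_one_le_of_one_le hn1 hC1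
  have key (m : ℕ) : ∀ (j : ℕ) (w : Fin (j + 1) → Fin (n + 1) → ℝ), j + m = n →
      (∀ i, w i ∈ Set.range (intVec (m := n + 1))) → LinearIndependent ℝ w →
      y ∈ span ℝ (Set.range w) → 1 ≤ (n * C) ^ m * tupleHeight θ w := by
    induction m with
    | zero =>
      rintro j w hj hw hli -
      obtain rfl : j = n := hj
      simpa using one_le_tupleHeight_of_intVec θ w hw hli
    | succ m ih =>
      intro j w hj hw hli hy
      obtain ⟨k, hk⟩ : ∃ k, e k ∉ span ℝ (Set.range w) := by
        by_contra! hall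
        have htop : span ℝ (Set.range w) = ⊤ := by
          rw [eq_top_iff, ← (Pi.basisFun ℝ (Fin (n + 1))).span_eq, span_le]
          rintro _ ⟨k, rfl⟩
          simpa using hall k
        have := finrank_span_eq_card hli
        rw [htop, finrank_top] at this
        simp at this
        lia
      have hek : intVec (Pi.single k 1) = e k := by
        ext i
        by_cases hik : i = k <;> simp [intVec, he, hik]
      have h1 := ih (j + 1) (Fin.cons (e k) w) (by lia)
        (fun i => Fin.cases ⟨Pi.single k 1, hek⟩ (fun i => by simpa using hw i) i)
        (linearIndependent_finCons.2 ⟨hli, hk⟩)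
        (span_mono (by rw [Fin.range_cons]; exact Set.subset_insert _ _) hy)
      refine h1.trans ?_
      rw [pow_succ, mul_assoc]
      refine mul_le_mul_of_nonneg_left ?_ (by positivity)
      refine (tupleHeight_cons_le θ hy hL (e k)).trans ?_
      have h0 := tupleHeight_nonneg θ w
      have hj' : (j : ℝ) + 1 ≤ n := by exact_mod_cast (by lia : j + 1 ≤ n)
      rw [mul_assoc]
      have ht : ‖Fin.tail (e k)‖ ≤ 1 := by
        refine (pi_norm_le_iff_of_nonneg zero_le_one).2 fun i => ?_
        simp only [Fin.tail, he, Pi.single_apply]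
        split_ifs <;> simp
      have hs : |linForm θ (e k) / linForm θ y| ≤ ∑ k, |linForm θ (e k) / linForm θ y| :=
        Finset.single_le_sum (f := fun k => |linForm θ (e k) / linForm θ y|)
          (fun _ _ => abs_nonneg _) (Finset.mem_univ k)
      gcongr
      exact add_le_add ht (mul_le_mul_of_nonneg_right hs (norm_nonneg _))
  refine ⟨((n * C) ^ n)⁻¹, by positivity, fun j w hw hli hy => ?_⟩
  have hjn : j ≤ n := by
    have := hli.fintype_card_le_finrank
    simp at this
    lia
  rw [inv_le_iff_one_le_mul₀' (by positivity)]
  refine (key (n - j) j w (by lia) hw hli hy).trans ?_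
  have h0 := tupleHeight_nonneg θ w
  exact mul_le_mul_of_nonneg_right (pow_le_pow_right₀ hB (Nat.sub_le n j)) h0

/-- The heights of the independent integer tuples spanning a given subspace. -/
def heightSet (W : Submodule ℝ (Fin (n + 1) → ℝ)) : Set ℝ :=
  {h | ∃ (j : ℕ) (w : Fin (j + 1) → Fin (n + 1) → ℝ),
    (∀ i, w i ∈ Set.range (intVec (m := n + 1))) ∧ LinearIndependent ℝ w ∧
    span ℝ (Set.range w) = W ∧ tupleHeight θ w = h}

/-- The infimum of the heights of the independent integer tuples spanning a given subspace. -/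
noncomputable def subspaceHeight (W : Submodule ℝ (Fin (n + 1) → ℝ)) : ℝ :=
  sInf (heightSet θ W)

lemma heightSet_bddBelow (W : Submodule ℝ (Fin (n + 1) → ℝ)) : BddBelow (heightSet θ W) :=
  ⟨0, by rintro _ ⟨j, w, -, -, -, rfl⟩; exact tupleHeight_nonneg θ w⟩

lemma heightSet_span_nonempty {s : Set (Fin (n + 1) → ℝ)}
    (hs : s ⊆ Set.range (intVec (m := n + 1))) (h0 : span ℝ s ≠ ⊥) :
    (heightSet θ (span ℝ s)).Nonempty := by
  obtain ⟨t, hts, hspan, hli⟩ := exists_linearIndependent ℝ s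
  have hfin : t.Finite := hli.setFinite
  have := hfin.fintype
  have hcard : Fintype.card t ≠ 0 := by
    intro hc
    have := Fintype.card_eq_zero_iff.1 hc
    rw [← hspan, Set.isEmpty_coe_sort.1 this, span_empty] at h0
    exact h0 rfl
  obtain ⟨j, hj⟩ := Nat.exists_eq_succ_of_ne_zero hcard
  set f := (Fintype.equivFinOfCardEq hj).symm
  refine ⟨_, j, fun i => (f i : Fin (n + 1) → ℝ), fun i => hs (hts (f i).2),
    hli.comp _ f.injective, ?_, rfl⟩
  rw [← hspan]
  congr 1
  have : (fun i => (f i : Fin (n + 1) → ℝ)) = Subtype.val ∘ f := rfl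
  rw [this, f.surjective.range_comp, Subtype.range_coe]

lemma subspaceHeight_pos (hn : n ≠ 0) {W : Submodule ℝ (Fin (n + 1) → ℝ)}
    {y : Fin (n + 1) → ℝ} (hy : y ∈ W) (hL : linForm θ y ≠ 0) (hW : (heightSet θ W).Nonempty) :
    0 < subspaceHeight θ W := by
  obtain ⟨ε, hε, h⟩ := exists_forall_le_tupleHeight θ hn hL
  refine hε.trans_le (le_csInf hW ?_)
  rintro _ ⟨j, w, hw, hli, rfl, rfl⟩
  exact h j w hw hli hy

lemma subspaceHeight_span_singleton_le {y : Fin (n + 1) → ℝ}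
    (hy : y ∈ Set.range (intVec (m := n + 1))) (h0 : y ≠ 0) :
    subspaceHeight θ (span ℝ {y}) ≤ |linForm θ y| := by
  refine (csInf_le (heightSet_bddBelow θ _) ⟨0, fun _ => y, fun _ => hy,
    LinearIndependent.of_subsingleton (ι := Fin 1) 0 h0, by simp, rfl⟩).trans ?_
  refine (pi_norm_le_iff_of_nonneg (abs_nonneg _)).2 fun f => ?_
  exact (congrArg abs (Matrix.det_fin_one _)).le

lemma subspaceHeight_sup_le {W : Submodule ℝ (Fin (n + 1) → ℝ)}
    {y z : Fin (n + 1) → ℝ} (hy : y ∈ W) (hL : linForm θ y ≠ 0)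
    (hz : z ∈ Set.range (intVec (m := n + 1))) (hzW : z ∉ W) (hW : (heightSet θ W).Nonempty)
    {C : ℝ} (hC : 0 < C)
    (hle : n * (‖Fin.tail z‖ + |linForm θ z / linForm θ y| * ‖Fin.tail y‖) ≤ C) :
    subspaceHeight θ (span ℝ {z} ⊔ W) ≤ C * subspaceHeight θ W := by
  rw [← div_le_iff₀' hC]
  refine le_csInf hW ?_
  rintro _ ⟨j, w, hw, hli, rfl, rfl⟩
  rw [div_le_iff₀' hC]
  have hli' := linearIndependent_finCons.2 ⟨hli, hzW⟩
  have hjn : j + 1 ≤ n := by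
    have := hli'.fintype_card_le_finrank
    simp at this
    lia
  have hjn' : (j : ℝ) + 1 ≤ n := by exact_mod_cast hjn
  refine (csInf_le (heightSet_bddBelow θ _) ⟨j + 1, Fin.cons z w,
    fun i => Fin.cases (by simpa using hz) (fun i => by simpa using hw i) i, hli', ?_, rfl⟩).trans ?_
  · rw [Fin.range_cons, span_insert]
  refine (tupleHeight_cons_le θ hy hL z).trans ?_
  have h0 := tupleHeight_nonneg θ w
  rw [← mul_assoc]
  refine mul_le_mul_of_nonneg_right (le_trans ?_ hle) h0
  gcongr

end Heights

section MinimalVectors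

open Module Submodule

variable {n : ℕ} {θ : Fin n → ℝ}

lemma heightSet_segSpan_nonempty (z : ℕ → Fin (n + 1) → ℤ) {a p : ℕ} (h : a ≤ p)
    (h0 : intVec (z a) ≠ 0) :
    (heightSet θ (segSpan (fun i => intVec (z i)) a p)).Nonempty := by
  refine heightSet_span_nonempty θ ?_ fun hbot => h0 ?_
  · rintro _ ⟨i, -, rfl⟩
    exact ⟨z i, rfl⟩
  · have := mem_segSpan (fun i => intVec (z i)) le_rfl h
    rw [segSpan, hbot] at this
    simpa using this

lemma segmentSystem_of_intVec (hn : n ≠ 0) {a b : ℝ} (z : ℕ → Fin (n + 1) → ℤ)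
    (N L : ℕ → ℝ) (hN : ∀ i, N i = ‖Fin.tail (intVec (z i))‖)
    (hL : ∀ i, L i = linForm θ (intVec (z i))) (hN0 : ∀ i, 0 < N i) (hNm : Monotone N)
    (hL0 : ∀ i, L i ≠ 0) (hLm : StrictAnti fun i => |L i|)
    (hlow : ∀ i, -Real.log |L i| ≤ a * Real.log (2 * n * N i))
    (hup : ∀ i, b * Real.log (2 * n * N (i + 1)) ≤ -Real.log |L i|) :
    SegmentSystem (fun i => intVec (z i)) (fun i => Real.log (2 * n * N i))
      (fun W => -Real.log (subspaceHeight θ W)) b (a - b + 1) := by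
  have hn0 : (0 : ℝ) < n := by exact_mod_cast Nat.pos_of_ne_zero hn
  have hne (i : ℕ) : intVec (z i) ≠ 0 := by
    intro h
    apply hL0 i
    rw [hL, h, map_zero]
  have hpos (i : ℕ) : 0 < |L i| := abs_pos.2 (hL0 i)
  have hLi (i : ℕ) : linForm θ (intVec (z i)) ≠ 0 := hL i ▸ hL0 i
  have hset {p q : ℕ} (h : p ≤ q) := heightSet_segSpan_nonempty (θ := θ) z h (hne p)
  have hD {p q i : ℕ} (h1 : p ≤ i) (h2 : i ≤ q) :
      0 < subspaceHeight θ (segSpan (fun i => intVec (z i)) p q) :=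
    subspaceHeight_pos θ hn (mem_segSpan _ h1 h2) (hLi i) (hset (h1.trans h2))
  refine ⟨fun i p hip hmem => ?_, fun i => ?_, fun i p hip hm => ?_, fun i p hip hm => ?_, hne⟩
  · obtain ⟨c, hc⟩ := mem_span_singleton.1 hmem
    have h1 : |L p| = |c| * |L i| := by
      rw [hL, hL, ← hc, map_smul, smul_eq_mul, abs_mul]
    have h2 : N p = |c| * N i := by
      rw [hN, hN, ← hc, ← Real.norm_eq_abs, ← norm_smul]
      rfl
    have h3 := hLm hip
    have h4 := hNm hip.le
    simp only [h1, h2] at h3 h4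
    have h5 := hpos i
    have h6 := hN0 i
    have h7 : |c| < 1 := by
      by_contra! hc1
      nlinarith
    nlinarith
  · refine (hup i).trans (neg_le_neg (Real.log_le_log ?_ ?_))
    · rw [← segSpan_self (fun i => intVec (z i))]
      exact hD le_rfl le_rfl
    · rw [hL]
      exact subspaceHeight_span_singleton_le θ ⟨_, rfl⟩ (hne i)
  · have hC : 0 < 2 * n * N (i + 1) * (|L i| / |L (i + 1)|) := by
      have := hpos i
      have := hpos (i + 1)
      have := hN0 (i + 1)
      positivity
    have h1 := subspaceHeight_sup_le θ (mem_segSpan (fun i => intVec (z i)) le_rfl hip)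
      (hLi (i + 1)) ⟨z i, rfl⟩ hm (hset hip) hC (by
        rw [← hN, ← hN, ← hL, ← hL, abs_div]
        have h2 : 1 ≤ |L i| / |L (i + 1)| := (one_le_div (hpos _)).2 (hLm (Nat.lt_succ_self i)).le
        have h3 := hNm (Nat.le_succ i)
        have h4 : N (i + 1) ≤ N (i + 1) * (|L i| / |L (i + 1)|) :=
          le_mul_of_one_le_right (hN0 _).le h2
        calc n * (N i + |L i| / |L (i + 1)| * N (i + 1))
            ≤ n * (N (i + 1) * (|L i| / |L (i + 1)|) + |L i| / |L (i + 1)| * N (i + 1)) := by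
              gcongr
              exact h3.trans h4
          _ = _ := by ring)
    rw [← segSpan_left (fun i => intVec (z i)) (by lia)] at h1
    have h5 := Real.log_le_log (hD le_rfl (by lia)) h1
    rw [Real.log_mul hC.ne' (hD le_rfl hip).ne', Real.log_mul (by have := hN0 (i + 1); positivity)
      (div_pos (hpos _) (hpos _)).ne', Real.log_div (hpos _).ne' (hpos _).ne'] at h5
    have h6 := hlow (i + 1)
    have h7 := hup i
    linarith
  · have hC : 0 < 2 * n * N (p + 1) := by
      have := hN0 (p + 1)
      positivity
    have h1 := subspaceHeight_sup_le θ (mem_segSpan (fun i => intVec (z i)) hip le_rfl)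
      (hLi p) ⟨z (p + 1), rfl⟩ hm (hset hip) hC (by
        rw [← hN, ← hN, ← hL, ← hL, abs_div]
        have h2 : |L (p + 1)| / |L p| ≤ 1 := (div_le_one (hpos _)).2 (hLm (Nat.lt_succ_self p)).le
        have h3 := hNm (Nat.le_succ p)
        have h4 : |L (p + 1)| / |L p| * N p ≤ N (p + 1) :=
          (mul_le_of_le_one_left (hN0 _).le h2).trans h3
        calc n * (N (p + 1) + |L (p + 1)| / |L p| * N p)
            ≤ n * (N (p + 1) + N (p + 1)) := by gcongr
          _ = _ := by ring)
    rw [← segSpan_succ_right (fun i => intVec (z i)) (by lia)] at h1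
    have h5 := Real.log_le_log (hD le_rfl (by lia)) h1
    rw [Real.log_mul hC.ne' (hD le_rfl hip).ne'] at h5
    linarith

lemma le_geom_sum_of_minimal (hn : n ≠ 0) {a b : ℝ} (hb : 0 < b) (hab : b ≤ a)
    (z : ℕ → Fin (n + 1) → ℤ)
    (N L : ℕ → ℝ) (hN : ∀ i, N i = ‖Fin.tail (intVec (z i))‖)
    (hL : ∀ i, L i = linForm θ (intVec (z i))) (hN0 : ∀ i, 0 < N i) (hNm : Monotone N)
    (hNt : Filter.Tendsto N Filter.atTop Filter.atTop)
    (hL0 : ∀ i, L i ≠ 0) (hLm : StrictAnti fun i => |L i|)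
    (hlow : ∀ i, -Real.log |L i| ≤ a * Real.log (2 * n * N i))
    (hup : ∀ i, b * Real.log (2 * n * N (i + 1)) ≤ -Real.log |L i|) :
    b ≤ ∑ i ∈ Finset.range n, (a / b) ^ i := by
  by_contra! hlt
  have hn0 : (0 : ℝ) < n := by exact_mod_cast Nat.pos_of_ne_zero hn
  have hG1 : 1 ≤ a / b := (one_le_div hb).2 hab
  have hKb : a / b * b = a := div_mul_cancel₀ a hb.ne'
  refine (segmentSystem_of_intVec hn z N L hN hL hN0 hNm hL0 hLm hlow hup).false_of_tendsto
    (G := a / b) (c := fun i => b - ∑ j ∈ Finset.range i, (a / b) ^ j) (by linarith) (by simp)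
    (fun i => ?_) (fun i => ?_) (fun i hi => ?_) (fun i j hij => ?_) ?_
  · have := geom_sum_succ (x := a / b) (n := i)
    rw [this, mul_sub, hKb]
    ring
  · rw [Finset.sum_range_succ]
    ring
  · rw [finrank_fin_fun] at hi
    refine sub_pos.2 (lt_of_le_of_lt ?_ hlt)
    refine Finset.sum_le_sum_of_subset_of_nonneg ?_ fun j _ _ => by positivity
    intro j
    simp only [Finset.mem_range]
    lia
  · have := hN0 i
    exact Real.log_le_log (by positivity) (by have := hNm hij; gcongr)
  · exact Real.tendsto_log_atTop.comp (hNt.const_mul_atTop (by positivity))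

end MinimalVectors

section Sequence

lemma exists_seq_minimal {α : Type*} [Nonempty α] (f : α → ℝ) (N : α → ℕ) (hf : ∀ x, 0 < f x)
    (h : ∀ ε > 0, ∃ x, f x < ε) :
    ∃ s : ℕ → α, (∀ k, f (s (k + 1)) < f (s k) / 2) ∧
      (∀ k x, f x < f (s k) / 2 → N (s (k + 1)) ≤ N x) ∧ Monotone (N ∘ s) := by
  have hnext (x : α) : ∃ x', f x' < f x / 2 ∧ ∀ x'', f x'' < f x / 2 → N x' ≤ N x'' := by
    have hne : {x' | f x' < f x / 2}.Nonempty := h _ (half_pos (hf x))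
    exact ⟨Function.argminOn N _ hne, Function.argminOn_mem N _ hne,
      fun x'' hx => Function.argminOn_le N _ hx⟩
  choose g hg1 hg2 using hnext
  set s : ℕ → α := fun k => g^[k] (Classical.arbitrary α)
  have hs (k : ℕ) : s (k + 1) = g (s k) := Function.iterate_succ_apply' g k _
  refine ⟨fun k => s (k + 1), fun k => ?_, fun k x hx => ?_, monotone_nat_of_le_succ fun k => ?_⟩
  · exact (congrArg f (hs (k + 1))).trans_lt (hg1 _)
  · exact (congrArg N (hs (k + 1))).trans_le (hg2 _ _ hx)
  · have h1 := hg1 (s k)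
    have h2 := hg1 (s (k + 1))
    rw [← hs] at h1 h2
    have h3 := hf (s (k + 1))
    simp only [Function.comp_apply]
    rw [hs k]
    exact hg2 _ _ (by linarith)

variable {n : ℕ} {θ : Fin n → ℝ}

/-- The largest absolute value of the coordinates of `z` other than the first one. -/
def tailSup (z : Fin (n + 1) → ℤ) : ℕ := Finset.univ.sup fun i : Fin n => (z i.succ).natAbs

lemma natAbs_le_tailSup (z : Fin (n + 1) → ℤ) (i : Fin n) : (z i.succ).natAbs ≤ tailSup z :=
  Finset.le_sup (f := fun i : Fin n => (z i.succ).natAbs) (Finset.mem_univ i)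

lemma abs_le_tailSup (z : Fin (n + 1) → ℤ) (i : Fin n) : |(z i.succ : ℝ)| ≤ tailSup z := by
  rw [← Int.cast_abs, Int.abs_eq_natAbs]
  exact_mod_cast natAbs_le_tailSup z i

lemma tailSup_le {z : Fin (n + 1) → ℤ} {t : ℝ} (ht : 0 ≤ t) (h : ∀ i : Fin n, |(z i.succ : ℝ)| ≤ t) :
    (tailSup z : ℝ) ≤ t := by
  rw [← Nat.le_floor_iff ht]
  refine Finset.sup_le fun i _ => ?_
  rw [Nat.le_floor_iff ht, Nat.cast_natAbs, Int.cast_abs]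
  exact h i

lemma norm_tail_intVec (z : Fin (n + 1) → ℤ) : ‖Fin.tail (intVec z)‖ = tailSup z :=
  le_antisymm ((pi_norm_le_iff_of_nonneg (Nat.cast_nonneg _)).2 (abs_le_tailSup z))
    (tailSup_le (norm_nonneg _) (norm_le_pi_norm (Fin.tail (intVec z))))

lemma tailSup_pos {z : Fin (n + 1) → ℤ} : 0 < tailSup z ↔ ∃ i : Fin n, z i.succ ≠ 0 := by
  simp [tailSup, Finset.lt_sup_iff]

lemma linSolvable_iff {γ t : ℝ} (ht : 0 ≤ t) : LinSolvable n θ γ t ↔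
    ∃ z : Fin (n + 1) → ℤ, 0 < tailSup z ∧ (tailSup z : ℝ) ≤ t ∧
      |linForm θ (intVec z)| ≤ t ^ (-γ) := by
  refine exists_congr fun z => and_congr tailSup_pos.symm (and_congr ⟨tailSup_le ht, fun h i =>
    (abs_le_tailSup z i).trans h⟩ ?_)
  rw [linForm_apply]
  rfl

lemma linForm_intVec_ne_zero (hindep : LinearIndependent ℚ (Fin.cons 1 θ : Fin (n + 1) → ℝ))
    {z : Fin (n + 1) → ℤ} (hz : z ≠ 0) : linForm θ (intVec z) ≠ 0 := by
  intro h
  refine hz (funext fun i => ?_)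
  have := Fintype.linearIndependent_iff.1 hindep (fun i => (z i : ℚ)) (by
    rw [Fin.sum_univ_succ]
    rw [linForm_apply] at h
    simpa [Rat.smul_def, intVec, mul_comm] using h) i
  exact_mod_cast this

lemma le_geom_sum_of_linSolvable
    (hindep : LinearIndependent ℚ (Fin.cons 1 θ : Fin (n + 1) → ℝ)) (hn : n ≠ 0) {a b b' : ℝ}
    (hb : 0 < b) (hbb' : b < b') (hab : b ≤ a)
    (hhat : ∃ T : ℝ, ∀ t, T < t → LinSolvable n θ b' t)
    (hord : ∃ T : ℝ, ∀ t, T < t → ¬ LinSolvable n θ a t) :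
    b ≤ ∑ i ∈ Finset.range n, (a / b) ^ i := by
  obtain ⟨T₁, hT₁⟩ := hhat
  obtain ⟨T₂, hT₂⟩ := hord
  have hn0 : (1 : ℝ) ≤ n := by exact_mod_cast Nat.one_le_iff_ne_zero.2 hn
  let S := {z : Fin (n + 1) → ℤ // 0 < tailSup z}
  let f : S → ℝ := fun z => |linForm θ (intVec z.1)|
  have hne (z : S) : linForm θ (intVec z.1) ≠ 0 := by
    refine linForm_intVec_ne_zero hindep ?_
    rintro h
    have := z.2
    simp [h, tailSup] at this
  have hf (z : S) : 0 < f z := abs_pos.2 (hne z)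
  have hsmall (ε : ℝ) (hε : 0 < ε) : ∃ z, f z < ε := by
    have h1 : ∀ᶠ t : ℝ in Filter.atTop, t ^ (-b') < ε :=
      (tendsto_rpow_neg_atTop (hb.trans hbb')).eventually_lt_const hε
    obtain ⟨t, h1, h2, h3⟩ := (h1.and ((Filter.eventually_gt_atTop T₁).and
      (Filter.eventually_ge_atTop 0))).exists
    obtain ⟨z, hz, -, hz'⟩ := (linSolvable_iff h3).1 (hT₁ t h2)
    exact ⟨⟨z, hz⟩, hz'.trans_lt h1⟩
  have : Nonempty S := ⟨(hsmall 1 one_pos).choose⟩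
  obtain ⟨s, hs1, hs2, hs3⟩ := exists_seq_minimal f (fun z => tailSup z.1) hf hsmall
  have hnot (k : ℕ) (t : ℝ) (h1 : T₂ < t) (h2 : (tailSup (s k).1 : ℝ) ≤ t) :
      t ^ (-a) < f (s k) := by
    by_contra! hle
    exact hT₂ t h1 ((linSolvable_iff ((Nat.cast_nonneg _).trans h2)).2 ⟨_, (s k).2, h2, hle⟩)
  have hf0 : Filter.Tendsto (fun k => f (s k)) Filter.atTop (nhds 0) := by
    have hle (k : ℕ) : f (s k) ≤ f (s 0) * (1 / 2) ^ k := by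
      induction k with
      | zero => simp
      | succ k ih =>
        rw [pow_succ]
        linarith [hs1 k]
    refine squeeze_zero (fun k => (hf _).le) hle ?_
    simpa using (tendsto_pow_atTop_nhds_zero_of_lt_one (r := (1 / 2 : ℝ)) (by norm_num)
      (by norm_num)).const_mul (f (s 0))
  have htend : Filter.Tendsto (fun k => (tailSup (s k).1 : ℝ)) Filter.atTop Filter.atTop := by
    refine Filter.tendsto_atTop_atTop_of_monotone (fun i j hij => by exact_mod_cast hs3 hij)
      fun B => ?_
    by_contra! hB
    set t := max (max B (T₂ + 1)) 1
    have ht : 0 < t := one_pos.trans_le (le_max_right _ _)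
    obtain ⟨k, hk⟩ := (hf0.eventually_lt_const (Real.rpow_pos_of_pos ht (-a))).exists
    exact absurd hk (not_lt.2 (hnot k t ((lt_add_one T₂).trans_le
      ((le_max_right _ _).trans (le_max_left _ _)))
      ((hB k).le.trans ((le_max_left _ _).trans (le_max_left _ _)))).le)
  have hup : ∀ᶠ t : ℝ in Filter.atTop,
      b * Real.log (2 * n * t) ≤ b' * Real.log (t / 2) - Real.log 2 := by
    have h1 := (Real.tendsto_log_atTop.const_mul_atTop (sub_pos.2 hbb')).eventually_ge_atTop
      (b * Real.log (2 * n) + b' * Real.log 2 + Real.log 2)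
    filter_upwards [h1, Filter.eventually_gt_atTop 0] with t h1 h2
    rw [Real.log_mul (by positivity) h2.ne', Real.log_div h2.ne' two_ne_zero]
    linarith
  obtain ⟨k₀, hk₀⟩ := Filter.eventually_atTop.1 ((htend.eventually hup).and
    ((htend.eventually_gt_atTop T₂).and (htend.eventually_gt_atTop (2 * T₁))))
  have hpos (k : ℕ) : (0 : ℝ) < tailSup (s k).1 := by exact_mod_cast (s k).2
  refine le_geom_sum_of_minimal hn hb hab (θ := θ) (fun k => (s (k + k₀)).1)
    (fun k => tailSup (s (k + k₀)).1) (fun k => linForm θ (intVec (s (k + k₀)).1))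
    (fun k => (norm_tail_intVec _).symm) (fun k => rfl) (fun k => hpos _)
    (fun i j hij => Nat.cast_le.2 (hs3 (Nat.add_le_add_right hij k₀)))
    (htend.comp (Filter.tendsto_add_atTop_nat k₀)) (fun k => hne _)
    (strictAnti_nat_of_succ_lt fun k => ?_) (fun k => ?_) (fun k => ?_)
  · have h1 := hs1 (k + k₀)
    have h2 := hf (s (k + k₀))
    rw [show k + 1 + k₀ = k + k₀ + 1 by ring]
    exact h1.trans (half_lt_self h2)
  · have h1 := Real.log_le_log (Real.rpow_pos_of_pos (hpos _) _)
      (hnot (k + k₀) _ (hk₀ _ (Nat.le_add_left _ _)).2.1 le_rfl).le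
    rw [Real.log_rpow (hpos _)] at h1
    have h2 : Real.log (tailSup (s (k + k₀)).1) ≤ Real.log (2 * n * tailSup (s (k + k₀)).1) := by
      refine Real.log_le_log (hpos _) (le_mul_of_one_le_left (hpos _).le (by linarith))
    have h3 := mul_le_mul_of_nonneg_left h2 (hb.le.trans hab)
    simp only [f] at h1
    linarith
  · rw [show k + 1 + k₀ = k + k₀ + 1 by ring]
    obtain ⟨h1, -, h2⟩ := hk₀ (k + k₀ + 1) (by lia)
    refine h1.trans ?_
    have ht := hpos (k + k₀ + 1)
    set t : ℝ := (tailSup (s (k + k₀ + 1)).1 : ℝ) with htdef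
    obtain ⟨z, hz1, hz2, hz3⟩ := (linSolvable_iff (by positivity)).1 (hT₁ (t / 2) (by linarith))
    have h3 : f (s (k + k₀)) / 2 ≤ f ⟨z, hz1⟩ := by
      by_contra! hlt
      have h4 : tailSup (s (k + k₀ + 1)).1 ≤ tailSup z := hs2 (k + k₀) ⟨z, hz1⟩ hlt
      have h5 : t ≤ tailSup z := Nat.cast_le.2 h4
      linarith
    have h6 := Real.log_le_log (half_pos (hf _)) (h3.trans hz3)
    rw [Real.log_div (hf _).ne' two_ne_zero, Real.log_rpow (half_pos ht)] at h6
    simp only [f] at h6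
    linarith

end Sequence

section Exponents

variable {n : ℕ} {θ : Fin n → ℝ}

lemma eventually_mul_rpow_lt {r s : ℝ} (h : s < r) (C : ℝ) :
    ∀ᶠ q : ℝ in Filter.atTop, C * (2 * q) ^ s < q ^ r := by
  filter_upwards [(tendsto_rpow_atTop (sub_pos.2 h)).eventually_gt_atTop (C * 2 ^ s),
    Filter.eventually_gt_atTop 0] with q h1 h2
  have h3 : q ^ r = q ^ (r - s) * q ^ s := by rw [← Real.rpow_add h2, sub_add_cancel]
  rw [Real.mul_rpow zero_le_two h2.le, h3, ← mul_assoc]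
  exact mul_lt_mul_of_pos_right h1 (Real.rpow_pos_of_pos h2 _)

lemma exists_sim_large (hn : n ≠ 0) {a γ : ℝ} (hγ : 0 < γ)
    (hord : ∃ T : ℝ, ∀ t, T < t → ¬ LinSolvable n θ a t)
    (hsim : ∀ T : ℝ, ∃ t, T < t ∧ SimSolvable n θ γ t) (Q : ℝ) :
    ∃ x : Fin (n + 1) → ℤ, Q < |(x 0 : ℝ)| ∧
      ∀ i : Fin n, |(x 0 : ℝ) * θ i - x i.succ| ≤ |(x 0 : ℝ)| ^ (-γ) := by
  obtain ⟨T, hT⟩ := hord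
  set R := max (max Q (T + 1)) 1
  have hR : 0 < R := one_pos.trans_le (le_max_right _ _)
  obtain ⟨t₀, ht₀⟩ := Filter.eventually_atTop.1
    ((tendsto_rpow_neg_atTop hγ).eventually_lt_const (Real.rpow_pos_of_pos hR (-a)))
  obtain ⟨t, ht, x, hx0, hxt, hx⟩ := hsim t₀
  have hq : 0 < |(x 0 : ℝ)| := abs_pos.2 (by exact_mod_cast hx0)
  refine ⟨x, ?_, fun i => (hx i).trans
    (Real.rpow_le_rpow_of_nonpos hq hxt (neg_nonpos.2 hγ.le))⟩
  by_contra! hle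
  have hleR : |(x 0 : ℝ)| ≤ R := hle.trans ((le_max_left _ _).trans (le_max_left _ _))
  let i₀ : Fin n := ⟨0, Nat.pos_of_ne_zero hn⟩
  refine hT R ((lt_add_one T).trans_le ((le_max_right _ _).trans (le_max_left _ _)))
    ⟨Fin.cons (-x i₀.succ) (Pi.single i₀ (x 0)), ⟨i₀, by simpa using hx0⟩, fun i => ?_, ?_⟩
  · rw [Fin.cons_succ]
    by_cases hi : i = i₀
    · subst hi
      simpa using hleR
    · simpa [hi] using hR.le
  · refine le_trans (le_of_eq ?_) ((hx i₀).trans (ht₀ t ht.le).le)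
    rw [Finset.sum_eq_single i₀ (fun i _ hi => by simp [hi]) (by simp)]
    simp only [Fin.cons_zero, Fin.cons_succ, Pi.single_eq_same, Int.cast_neg]
    ring_nf

lemma mul_one_add_le_of_simSolvable (hn : n ≠ 0) {a b γ : ℝ} (hb : 0 < b) (hab : b ≤ a)
    (hγ : 0 < γ) (hhat : ∃ T : ℝ, ∀ t, T < t → LinSolvable n θ b t)
    (hord : ∃ T : ℝ, ∀ t, T < t → ¬ LinSolvable n θ a t)
    (hsim : ∀ T : ℝ, ∃ t, T < t ∧ SimSolvable n θ γ t) :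
    b * (1 + γ) ≤ 1 + a := by
  by_contra! hlt
  have hγb : b⁻¹ < γ := by
    rw [inv_lt_iff_one_lt_mul₀ hb]
    linarith
  have hab' : b⁻¹ * (1 + a) < 1 + γ := by
    rwa [inv_mul_lt_iff₀ hb]
  obtain ⟨T₁, hT₁⟩ := hhat
  obtain ⟨T₂, hT₂⟩ := hord
  have htend : Filter.Tendsto (fun q : ℝ => (2 * q) ^ b⁻¹) Filter.atTop Filter.atTop :=
    (tendsto_rpow_atTop (inv_pos.2 hb)).comp (Filter.tendsto_id.const_mul_atTop two_pos)
  obtain ⟨Q, hQ⟩ := Filter.eventually_atTop.1 ((htend.eventually_gt_atTop T₁).and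
    ((htend.eventually_gt_atTop T₂).and ((eventually_mul_rpow_lt hγb (2 * n)).and
      (eventually_mul_rpow_lt hab' n))))
  obtain ⟨x, hxQ, hx⟩ := exists_sim_large hn hγ ⟨T₂, hT₂⟩ hsim (max Q 0)
  set q := |(x 0 : ℝ)| with hqdef
  have hq : 0 < q := (le_max_right _ _).trans_lt hxQ
  obtain ⟨h1, h2, h3, h4⟩ := hQ q ((le_max_left _ _).trans hxQ.le)
  set Y := (2 * q) ^ b⁻¹ with hY
  have hY0 : 0 < Y := Real.rpow_pos_of_pos (by positivity) _
  obtain ⟨z, hz0, hzY, hzL⟩ := (linSolvable_iff hY0.le).1 (hT₁ Y h1)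
  have hzL' : Y ^ (-a) < |linForm θ (intVec z)| := by
    by_contra! hle
    exact hT₂ Y h2 ((linSolvable_iff hY0.le).2 ⟨z, hz0, hzY, hle⟩)
  have hYb : Y ^ (-b) = (2 * q)⁻¹ := by
    rw [hY, ← Real.rpow_mul (by positivity), mul_neg, inv_mul_cancel₀ hb.ne', Real.rpow_neg_one]
  have hYa : Y ^ (1 + a) = (2 * q) ^ (b⁻¹ * (1 + a)) := by
    rw [hY, ← Real.rpow_mul (by positivity)]
  have herr : |∑ i : Fin n, (z i.succ : ℝ) * ((x 0 : ℝ) * θ i - x i.succ)| ≤ n * Y * q ^ (-γ) := by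
    refine (Finset.abs_sum_le_sum_abs _ _).trans
      ((Finset.sum_le_card_nsmul _ _ (Y * q ^ (-γ)) fun i _ => ?_).trans_eq ?_)
    · rw [abs_mul]
      exact mul_le_mul ((abs_le_tailSup z i).trans hzY) (hx i) (abs_nonneg _) hY0.le
    · simp [mul_assoc]
  have hid : ((∑ i, x i * z i : ℤ) : ℝ) = (x 0 : ℝ) * linForm θ (intVec z) -
      ∑ i : Fin n, (z i.succ : ℝ) * ((x 0 : ℝ) * θ i - x i.succ) := by
    rw [Fin.sum_univ_succ, linForm_apply]
    push_cast
    simp only [intVec, mul_sub, Finset.sum_sub_distrib, mul_add, Finset.mul_sum]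
    have e1 : ∑ i : Fin n, (z i.succ : ℝ) * ((x 0 : ℝ) * θ i) =
        ∑ i : Fin n, (x 0 : ℝ) * (θ i * z i.succ) := Finset.sum_congr rfl fun i _ => by ring
    have e2 : ∑ i : Fin n, (z i.succ : ℝ) * (x i.succ : ℝ) =
        ∑ i : Fin n, (x i.succ : ℝ) * (z i.succ : ℝ) := Finset.sum_congr rfl fun i _ => by ring
    rw [e1, e2]
    ring
  have hqγ : 0 < q ^ γ := Real.rpow_pos_of_pos hq _
  have hsmall : n * Y * q ^ (-γ) < 1 / 2 := by
    rw [Real.rpow_neg hq.le, ← div_eq_mul_inv, div_lt_iff₀ hqγ]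
    linarith
  have hL : |(x 0 : ℝ) * linForm θ (intVec z)| ≤ 1 / 2 := by
    rw [abs_mul]
    refine (mul_le_mul_of_nonneg_left (hzL.trans_eq hYb) hq.le).trans_eq ?_
    rw [mul_inv]
    field_simp
  have hzero : (∑ i, x i * z i : ℤ) = 0 := by
    rw [← Int.abs_lt_one_iff]
    have : |((∑ i, x i * z i : ℤ) : ℝ)| < 1 := by
      rw [hid]
      exact (abs_sub _ _).trans_lt (by linarith)
    exact_mod_cast this
  rw [hzero, Int.cast_zero, eq_comm, sub_eq_zero] at hid
  rw [← hid, abs_mul] at herr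
  have h5 : q * Y ^ (-a) < n * Y * q ^ (-γ) := (mul_lt_mul_of_pos_left hzL' hq).trans_le herr
  rw [Real.rpow_neg hq.le, Real.rpow_neg hY0.le, ← div_eq_mul_inv, ← div_eq_mul_inv,
    div_lt_div_iff₀ (Real.rpow_pos_of_pos hY0 _) hqγ] at h5
  rw [← hYa, Real.rpow_add hY0, Real.rpow_add hq, Real.rpow_one, Real.rpow_one] at h4
  linarith

lemma exists_forall_not_linSolvable {a : ℝ} (ha : 0 < a) (h : omegaExp n θ < ENNReal.ofReal a) :
    ∃ T : ℝ, ∀ t, T < t → ¬ LinSolvable n θ a t := by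
  by_contra! hall
  exact absurd (le_sSup ⟨a, ha, rfl, hall⟩ : ENNReal.ofReal a ≤ omegaExp n θ) (not_le.2 h)

lemma exists_forall_linSolvable {b : ℝ} (h : ENNReal.ofReal b < omegaHatExp n θ) :
    ∃ T : ℝ, ∀ t, T < t → LinSolvable n θ b t := by
  obtain ⟨_, ⟨γ, hγ, rfl, T, hT⟩, hlt⟩ := lt_sSup_iff.1 h
  have hbγ := ((ENNReal.ofReal_lt_ofReal_iff hγ).1 hlt).le
  refine ⟨max T 1, fun t ht => ?_⟩
  obtain ⟨x, h1, h2, h3⟩ := hT t ((le_max_left _ _).trans_lt ht)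
  exact ⟨x, h1, h2, h3.trans (Real.rpow_le_rpow_of_exponent_le
    ((le_max_right _ _).trans ht.le) (neg_le_neg hbγ))⟩

lemma omegaHatExp_le_omegaExp : omegaHatExp n θ ≤ omegaExp n θ := by
  refine sSup_le_sSup ?_
  rintro _ ⟨γ, hγ, rfl, T, hT⟩
  refine ⟨γ, hγ, rfl, fun T' => ⟨max T T' + 1, ?_, hT _ ?_⟩⟩
  · exact (le_max_right _ _).trans_lt (lt_add_one _)
  · exact (le_max_left _ _).trans_lt (lt_add_one _)

lemma one_le_omegaHatExp (hn : n ≠ 0) : 1 ≤ omegaHatExp n θ := by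
  refine le_sSup ⟨1, one_pos, by simp, 1, fun t ht => ?_⟩
  let i₀ : Fin n := ⟨0, Nat.pos_of_ne_zero hn⟩
  have ht0 : 0 < t := one_pos.trans ht
  obtain ⟨j, k, hk, hkt, hjk⟩ := Real.exists_int_int_abs_mul_sub_le (θ i₀)
    (Nat.floor_pos.2 ht.le)
  have hkt' : |(k : ℝ)| ≤ t := by
    rw [abs_of_pos (by exact_mod_cast hk)]
    exact le_trans (by exact_mod_cast hkt) (Nat.floor_le ht0.le)
  refine ⟨Fin.cons (-j) (Pi.single i₀ k), ⟨i₀, by simpa using hk.ne'⟩, fun i => ?_, ?_⟩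
  · rw [Fin.cons_succ]
    by_cases hi : i = i₀
    · subst hi
      simpa using hkt'
    · simpa [hi] using ht0.le
  · rw [Finset.sum_eq_single i₀ (fun i _ hi => by simp [hi]) (by simp), Real.rpow_neg_one]
    simp only [Fin.cons_zero, Fin.cons_succ, Pi.single_eq_same, Int.cast_neg]
    calc |-(j : ℝ) + θ i₀ * k| = |k * θ i₀ - j| := by ring_nf
      _ ≤ 1 / (⌊t⌋₊ + 1) := hjk
      _ ≤ t⁻¹ := by
        rw [one_div]
        exact inv_anti₀ ht0 (Nat.lt_floor_add_one t).le

lemma mul_pow_le_of_simSolvable (hn : n ≠ 0)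
    (hindep : LinearIndependent ℚ (Fin.cons 1 θ : Fin (n + 1) → ℝ)) {a b b' γ : ℝ}
    (hb : 0 < b) (hbb' : b < b') (hab : b' ≤ a) (hγ : 0 < γ)
    (hhat : ∃ T : ℝ, ∀ t, T < t → LinSolvable n θ b' t)
    (hord : ∃ T : ℝ, ∀ t, T < t → ¬ LinSolvable n θ a t)
    (hsim : ∀ T : ℝ, ∃ t, T < t ∧ SimSolvable n θ γ t) :
    γ * b ^ (n + 1) ≤ a ^ n := by
  have h1 := mul_one_add_le_of_simSolvable hn (hb.trans hbb') hab hγ hhat hord hsim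
  have h2 := le_geom_sum_of_linSolvable hindep hn hb hbb' (hbb'.le.trans hab) hhat hord
  have h3 : 0 ≤ a / b - 1 := sub_nonneg.2 ((one_le_div hb).2 (hbb'.le.trans hab))
  have h4 := mul_le_mul_of_nonneg_right h2 h3
  rw [geom_sum_mul, mul_sub, mul_div_cancel₀ a hb.ne', div_pow] at h4
  have h5 : γ * b ≤ a ^ n / b ^ n := by nlinarith
  rw [le_div_iff₀ (by positivity)] at h5
  rw [pow_succ']
  linarith

end Exponents

/-- if `1, θ₁, …, θₙ` are linearly independent over `ℚ` and `ω < ∞`, then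
`λ ≤ ωⁿ/ω̂^{n+1}`. -/
theorem stmt14 (n : ℕ) (hn : 2 ≤ n) (θ : Fin n → ℝ)
    (hindep : LinearIndependent ℚ (Fin.cons 1 θ : Fin (n+1) → ℝ))
    (hω : omegaExp n θ < ⊤) :
    lambdaExp n θ ≤ (omegaExp n θ) ^ n / (omegaHatExp n θ) ^ (n + 1) := by
  have hn0 : n ≠ 0 := by lia
  have hle := omegaHatExp_le_omegaExp (θ := θ)
  have hone := one_le_omegaHatExp (θ := θ) hn0
  have hhat_top := (hle.trans_lt hω).ne
  have hone' : 1 ≤ (omegaHatExp n θ).toReal := by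
    simpa using ENNReal.toReal_mono hhat_top hone
  have hle' := ENNReal.toReal_mono hω.ne hle
  have hw := ENNReal.ofReal_toReal hω.ne
  have hw' := ENNReal.ofReal_toReal hhat_top
  generalize (omegaExp n θ).toReal = w at *
  generalize (omegaHatExp n θ).toReal = w' at *
  refine sSup_le ?_
  rintro _ ⟨γ, hγ, rfl, hsim⟩
  have key : ∀ᶠ ε : ℝ in nhdsWithin 0 (Set.Ioi 0), γ * (w' - 2 * ε) ^ (n + 1) ≤ (w + ε) ^ n := by
    filter_upwards [Ioo_mem_nhdsGT (show (0 : ℝ) < 1 / 2 by norm_num)] with ε hε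
    obtain ⟨h0, h1⟩ := hε
    refine mul_pow_le_of_simSolvable hn0 hindep (b' := w' - ε) (by linarith) (by linarith)
      (by linarith) hγ (exists_forall_linSolvable ?_)
      (exists_forall_not_linSolvable (by linarith) ?_) hsim
    · rw [← hw']
      exact (ENNReal.ofReal_lt_ofReal_iff (by linarith)).2 (by linarith)
    · rw [← hw]
      exact (ENNReal.ofReal_lt_ofReal_iff (by linarith)).2 (by linarith)
  have hlim : γ * w' ^ (n + 1) ≤ w ^ n := by
    have c1 : Continuous fun ε : ℝ => γ * (w' - 2 * ε) ^ (n + 1) := by fun_prop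
    have c2 : Continuous fun ε : ℝ => (w + ε) ^ n := by fun_prop
    have := le_of_tendsto_of_tendsto ((c1.tendsto 0).mono_left nhdsWithin_le_nhds)
      ((c2.tendsto 0).mono_left nhdsWithin_le_nhds) key
    simpa using this
  rw [← hw, ← hw', ENNReal.le_div_iff_mul_le
    (Or.inl (pow_ne_zero _ (ENNReal.ofReal_pos.2 (by linarith)).ne'))
    (Or.inl (ENNReal.pow_ne_top ENNReal.ofReal_ne_top)),
    ← ENNReal.ofReal_pow (by linarith), ← ENNReal.ofReal_pow (by linarith),
    ← ENNReal.ofReal_mul hγ.le]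
  exact ENNReal.ofReal_le_ofReal hlim
end

section
/- (Linear independence criterion.) Let α, β, c₁, c₂ be positive real numbers with β ≥ α. Let (t_k)_{k∈ℕ} be an increasing sequence of positive reals with lim_{k→∞} t_k = ∞ and limsup_{k→∞} log(t_{k+1})/log(t_k) = 1, and suppose that for every sufficiently large integer k there exists x ∈ ℤ^{n+1} with r(x) ≤ t_k and c₁ t_k^{−β} ≤ h(x) ≤ c₂ t_k^{−α}. Then the dimension of the ℚ-vector space spanned by 1, θ₁, …, θₙ is at least (1+β)/(1+β−α). -/
open scoped RealInnerProductSpace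

/-- The vector `(1, θ₁, …, θₙ) ∈ ℝ^{n+1}`. -/
noncomputable def thetaVec (n : ℕ) (θ : Fin n → ℝ) : EuclideanSpace ℝ (Fin (n+1)) :=
  (EuclideanSpace.equiv (Fin (n+1)) ℝ).symm (Fin.cons 1 θ)

/-- The line `ℓ` spanned by `(1, θ₁, …, θₙ)`. -/
noncomputable def lineTheta (n : ℕ) (θ : Fin n → ℝ) :
    Submodule ℝ (EuclideanSpace ℝ (Fin (n+1))) :=
  Submodule.span ℝ {thetaVec n θ}

/-- `r(x)`: the Euclidean distance from `x` to the line `ℓ`. -/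
noncomputable def rdist (n : ℕ) (θ : Fin n → ℝ) (x : EuclideanSpace ℝ (Fin (n+1))) : ℝ :=
  Metric.infDist x (lineTheta n θ : Set (EuclideanSpace ℝ (Fin (n+1))))

/-- `h(x)`: the Euclidean distance from `x` to `ℓ^⊥`. -/
noncomputable def hdist (n : ℕ) (θ : Fin n → ℝ) (x : EuclideanSpace ℝ (Fin (n+1))) : ℝ :=
  Metric.infDist x ((lineTheta n θ)ᗮ : Set (EuclideanSpace ℝ (Fin (n+1))))

/-- `x ∈ ℤ^{n+1}`: all coordinates of `x` are integers. -/
def IsIntegerPoint (n : ℕ) (x : EuclideanSpace ℝ (Fin (n+1))) : Prop :=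
  ∀ i, ∃ m : ℤ, x i = (m : ℝ)

/-- The point of `ℝ^{n+1}` with integer coordinates `m`. -/
noncomputable def intPt (n : ℕ) (m : Fin (n+1) → ℤ) : EuclideanSpace ℝ (Fin (n+1)) :=
  (EuclideanSpace.equiv (Fin (n+1)) ℝ).symm (fun i => (m i : ℝ))

/-- Dirichlet's theorem on simultaneous approximation. -/
lemma exists_simultaneous_approx {ι : Type*} [Fintype ι] (ξ : ι → ℝ) (N : ℕ) (hN : 0 < N) :
    ∃ q : ℕ, 0 < q ∧ q ≤ N ^ Fintype.card ι ∧ ∀ i, ∃ p : ℤ, |q * ξ i - p| ≤ 1 / N := by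
  classical
  have hN' : (0 : ℝ) < N := by exact_mod_cast hN
  let box : ℕ → ι → ℕ := fun q i => ⌊N * Int.fract (q * ξ i)⌋₊
  have hbox : ∀ q ∈ Finset.range (N ^ Fintype.card ι + 1),
      box q ∈ Fintype.piFinset fun _ : ι => Finset.range N := by
    intro q _
    rw [Fintype.mem_piFinset]
    intro i
    rw [Finset.mem_range, Nat.floor_lt (by have := Int.fract_nonneg (q * ξ i); positivity)]
    nlinarith [Int.fract_lt_one (q * ξ i)]
  obtain ⟨a, ha, b, hb, hne, hab⟩ :=
    Finset.exists_ne_map_eq_of_card_lt_of_maps_to (by simp) hbox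
  wlog hlt : a < b generalizing a b
  · exact this b hb a ha hne.symm hab.symm (by omega)
  rw [Finset.mem_range] at hb
  refine ⟨b - a, by omega, by omega, fun i => ⟨⌊b * ξ i⌋ - ⌊a * ξ i⌋, ?_⟩⟩
  have hi : ⌊N * Int.fract (a * ξ i)⌋₊ = ⌊N * Int.fract (b * ξ i)⌋₊ := congrFun hab i
  have hanonneg : 0 ≤ N * Int.fract (a * ξ i) := by
    have := Int.fract_nonneg (a * ξ i); positivity
  have hbnonneg : 0 ≤ N * Int.fract (b * ξ i) := by
    have := Int.fract_nonneg (b * ξ i); positivity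
  have h1 := Nat.floor_le hanonneg
  have h2 := Nat.lt_floor_add_one (N * Int.fract (a * ξ i))
  have h3 := Nat.floor_le hbnonneg
  have h4 := Nat.lt_floor_add_one (N * Int.fract (b * ξ i))
  rw [hi] at h1 h2
  have e : ((b - a : ℕ) : ℝ) * ξ i - ((⌊b * ξ i⌋ - ⌊a * ξ i⌋ : ℤ) : ℝ)
      = Int.fract (b * ξ i) - Int.fract (a * ξ i) := by
    rw [Int.fract, Int.fract]
    push_cast [Nat.cast_sub hlt.le]
    ring
  rw [e, abs_le, ← neg_div, div_le_iff₀ hN', le_div_iff₀ hN']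
  constructor <;> linarith

/-- If the elements of `b` are well approximated by rationals with denominator `q`, then an element
of the `ℚ`-span of `b` is well approximated with denominator a fixed multiple of `q`. -/
lemma exists_approx_of_mem_span {b : Set ℝ} {x : ℝ} (hx : x ∈ Submodule.span ℚ b) :
    ∃ D : ℕ, 0 < D ∧ ∃ C : ℝ, 0 ≤ C ∧ ∀ (q : ℕ) (δ : ℝ), 0 ≤ δ →
      (∀ ξ ∈ b, ∃ p : ℤ, |q * ξ - p| ≤ δ) → ∃ a : ℤ, |D * q * x - a| ≤ C * δ := by
  induction hx using Submodule.span_induction with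
  | mem ξ hξ =>
    refine ⟨1, one_pos, 1, zero_le_one, fun q δ _ h => ?_⟩
    simpa using h ξ hξ
  | zero => exact ⟨1, one_pos, 0, le_rfl, fun q δ _ _ => ⟨0, by simp⟩⟩
  | add x y _ _ hx hy =>
    obtain ⟨D₁, hD₁, C₁, hC₁, h₁⟩ := hx
    obtain ⟨D₂, hD₂, C₂, hC₂, h₂⟩ := hy
    refine ⟨D₁ * D₂, by positivity, D₂ * C₁ + D₁ * C₂, by positivity, fun q δ hδ h => ?_⟩
    obtain ⟨a₁, ha₁⟩ := h₁ q δ hδ h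
    obtain ⟨a₂, ha₂⟩ := h₂ q δ hδ h
    refine ⟨D₂ * a₁ + D₁ * a₂, ?_⟩
    push_cast
    calc |(D₁ * D₂ * q * (x + y) - (D₂ * a₁ + D₁ * a₂) : ℝ)|
        = |D₂ * (D₁ * q * x - a₁) + D₁ * (D₂ * q * y - a₂)| := by congr 1; ring
      _ ≤ D₂ * |D₁ * q * x - a₁| + D₁ * |D₂ * q * y - a₂| := by
        refine (abs_add_le _ _).trans_eq ?_
        rw [abs_mul, abs_mul, Nat.abs_cast, Nat.abs_cast]
      _ ≤ D₂ * (C₁ * δ) + D₁ * (C₂ * δ) := by gcongr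
      _ = (D₂ * C₁ + D₁ * C₂) * δ := by ring
  | smul r x _ hx =>
    obtain ⟨D, hD, C, hC, h⟩ := hx
    refine ⟨D * r.den, by have := r.den_pos; positivity, |(r.num : ℝ)| * C, by positivity,
      fun q δ hδ hq => ?_⟩
    obtain ⟨a, ha⟩ := h q δ hδ hq
    refine ⟨r.num * a, ?_⟩
    have hr : (r.den : ℝ) * (r : ℝ) = r.num := by
      exact_mod_cast Rat.den_mul_eq_num r
    have e : ((D * r.den : ℕ) : ℝ) * q * (r • x) - ((r.num * a : ℤ) : ℝ)
        = r.num * (D * q * x - a) := by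
      rw [Rat.smul_def]
      push_cast
      linear_combination D * q * x * hr
    rw [e, abs_mul, mul_assoc |_| C]
    gcongr

/-- Simultaneous approximation of the elements of a finite family in terms of the rank of the
`ℚ`-space it spans together with `1`. -/
lemma exists_simultaneous_approx_of_finrank {ι : Type*} [Fintype ι] (θ : ι → ℝ) :
    ∃ m : ℕ, Module.finrank ℚ (Submodule.span ℚ (insert (1 : ℝ) (Set.range θ))) = m + 1 ∧
      ∃ D : ℕ, 0 < D ∧ ∃ C : ℝ, 0 < C ∧ ∀ N : ℕ, 0 < N → ∃ q : ℕ, 0 < q ∧ q ≤ D * N ^ m ∧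
        ∀ i, ∃ a : ℤ, |q * θ i - a| ≤ C / N := by
  classical
  obtain ⟨b, hbt, h1b, htb, hli⟩ := exists_linearIndepOn_id_extension
    (LinearIndepOn.singleton (R := ℚ) (v := id) (i := (1 : ℝ)) one_ne_zero)
    (Set.singleton_subset_iff.2 (Set.mem_insert (1 : ℝ) (Set.range θ)))
  have hspan : Submodule.span ℚ (insert (1 : ℝ) (Set.range θ)) = Submodule.span ℚ b :=
    le_antisymm (Submodule.span_le.2 htb) (Submodule.span_mono hbt)
  have hbfin : b.Finite := ((Set.finite_range θ).insert 1).subset hbt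
  have h1b' : (1 : ℝ) ∈ b := h1b rfl
  let s : Finset ℝ := hbfin.toFinset.erase 1
  have hs : s.card + 1 = hbfin.toFinset.card :=
    Finset.card_erase_add_one (by simpa using h1b')
  have : Fintype b := hbfin.fintype
  refine ⟨s.card, ?_, ?_⟩
  · rw [hs, hspan, finrank_span_set_eq_card hli]
    congr 1
    ext; simp
  have hmem : ∀ i, θ i ∈ Submodule.span ℚ b := fun i =>
    htb (Set.mem_insert_of_mem _ (Set.mem_range_self i))
  choose D hD C hC happ using fun i => exists_approx_of_mem_span (hmem i)
  refine ⟨∏ i, D i, Finset.prod_pos fun i _ => hD i,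
    (∏ i, (D i : ℝ)) * ∑ i, C i + 1, ?_, fun N hN => ?_⟩
  · have : 0 ≤ ∑ i, C i := Finset.sum_nonneg fun i _ => hC i
    positivity
  obtain ⟨q, hq, hqN, hqs⟩ := exists_simultaneous_approx (fun x : s => (x : ℝ)) N hN
  rw [Fintype.card_coe] at hqN
  have hN' : (0 : ℝ) < N := by exact_mod_cast hN
  have hqb : ∀ ξ ∈ b, ∃ p : ℤ, |q * ξ - p| ≤ 1 / N := by
    intro ξ hξ
    by_cases h : ξ = 1
    · exact ⟨q, by simp [h]⟩
    · exact hqs ⟨ξ, by simp [s, h, hξ]⟩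
  refine ⟨(∏ i, D i) * q, Nat.mul_pos (Finset.prod_pos fun i _ => hD i) hq,
    Nat.mul_le_mul_left _ hqN, fun i => ?_⟩
  obtain ⟨a, ha⟩ := happ i q (1 / N) (by positivity) hqb
  let P : ℕ := ∏ j ∈ Finset.univ.erase i, D j
  have hP : (∏ j, D j) = P * D i := (Finset.prod_erase_mul _ _ (Finset.mem_univ i)).symm
  have hPle : (P : ℝ) ≤ ∏ j, (D j : ℝ) := by
    have : P ≤ ∏ j, D j := by rw [hP]; exact Nat.le_mul_of_pos_right _ (hD i)
    exact_mod_cast this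
  refine ⟨P * a, ?_⟩
  have e : (((∏ j, D j) * q : ℕ) : ℝ) * θ i - ((P * a : ℤ) : ℝ)
      = P * (D i * q * θ i - a) := by
    rw [hP]; push_cast; ring
  rw [e, abs_mul, Nat.abs_cast]
  calc (P : ℝ) * |D i * q * θ i - a| ≤ (∏ j, (D j : ℝ)) * (C i * (1 / N)) := by gcongr
    _ ≤ (∏ j, (D j : ℝ)) * ((∑ j, C j) * (1 / N)) := by
      gcongr
      exact Finset.single_le_sum (fun j _ => hC j) (Finset.mem_univ i)
    _ = ((∏ j, (D j : ℝ)) * ∑ j, C j) / N := by ring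
    _ ≤ _ := by gcongr; linarith

lemma eventually_succ_le_rpow_of_limsup {t : ℕ → ℝ}
    (htlim : Filter.Tendsto t Filter.atTop Filter.atTop)
    (htlog : Filter.limsup (fun k => Real.log (t (k + 1)) / Real.log (t k)) Filter.atTop = 1)
    {s : ℝ} (hs : 1 < s) : ∀ᶠ k in Filter.atTop, t (k + 1) ≤ t k ^ s := by
  have hbdd : Filter.IsBoundedUnder (· ≤ ·) Filter.atTop
      fun k => Real.log (t (k + 1)) / Real.log (t k) := by
    by_contra h
    rw [Real.limsup_of_not_isBoundedUnder h] at htlog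
    exact zero_ne_one htlog
  have hlt := Filter.eventually_lt_of_limsup_lt (htlog.trans_lt hs) hbdd
  filter_upwards [hlt, htlim.eventually_gt_atTop 1,
    (htlim.comp (Filter.tendsto_add_atTop_nat 1)).eventually_gt_atTop 0] with k hk h1 h0
  have h0' : 0 < t (k + 1) := h0
  have hlog : 0 < Real.log (t k) := Real.log_pos h1
  rw [div_lt_iff₀ hlog] at hk
  rw [← Real.log_le_log_iff h0' (by positivity), Real.log_rpow (by linarith)]
  exact hk.le

lemma exists_le_and_le_rpow {t : ℕ → ℝ} (htlim : Filter.Tendsto t Filter.atTop Filter.atTop)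
    {s : ℝ} (hs : 0 ≤ s) {K : ℕ} (hpos : ∀ k ≥ K, 0 ≤ t k)
    (hstep : ∀ k ≥ K, t (k + 1) ≤ t k ^ s) {y : ℝ} (hy : t K < y) :
    ∃ k ≥ K, y ≤ t k ∧ t k ≤ y ^ s := by
  classical
  have hex : ∃ j, y ≤ t (K + j) := by
    obtain ⟨k, hkK, hk⟩ :=
      ((Filter.eventually_ge_atTop K).and (htlim.eventually_ge_atTop y)).exists
    exact ⟨k - K, by rwa [Nat.add_sub_cancel' hkK]⟩
  obtain ⟨j, hj⟩ : ∃ j, Nat.find hex = j + 1 := by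
    refine Nat.exists_eq_succ_of_ne_zero fun h => ?_
    have := Nat.find_spec hex
    rw [h, Nat.add_zero] at this
    linarith
  have hge := Nat.find_spec hex
  have hlt : ¬ y ≤ t (K + j) := Nat.find_min hex (by omega)
  rw [hj] at hge
  refine ⟨K + (j + 1), by omega, hge, (hstep (K + j) (by omega)).trans ?_⟩
  exact Real.rpow_le_rpow (hpos _ (by omega)) (not_le.1 hlt).le hs

lemma exists_nat_rpow_lt {m : ℕ} {ρ F G c : ℝ} (hG : 0 < G) (hc : 0 < c)
    (hρ : m * ρ < 1) :
    ∃ N : ℕ, 0 < N ∧ F * (G * (N : ℝ) ^ m) ^ ρ < c * N := by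
  have hlim : Filter.Tendsto (fun N : ℕ => (N : ℝ) ^ (1 - m * ρ)) Filter.atTop Filter.atTop :=
    (tendsto_rpow_atTop (by linarith)).comp tendsto_natCast_atTop_atTop
  obtain ⟨N, hN, hlt⟩ := ((Filter.eventually_gt_atTop 0).and
    (hlim.eventually_gt_atTop (F * G ^ ρ / c))).exists
  have hN' : (0 : ℝ) < N := by exact_mod_cast hN
  refine ⟨N, hN, ?_⟩
  rw [div_lt_iff₀ hc] at hlt
  rw [Real.mul_rpow hG.le (by positivity), ← Real.rpow_natCast, ← Real.rpow_mul hN'.le]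
  calc F * (G ^ ρ * (N : ℝ) ^ (m * ρ)) = F * G ^ ρ * (N : ℝ) ^ (m * ρ) := by ring
    _ < (N : ℝ) ^ (1 - m * ρ) * c * (N : ℝ) ^ (m * ρ) := by gcongr
    _ = c * ((N : ℝ) ^ (1 - m * ρ) * (N : ℝ) ^ (m * ρ)) := by ring
    _ = c * N := by rw [← Real.rpow_add hN']; simp

section Distances

variable {n : ℕ} {θ : Fin n → ℝ}

lemma one_le_norm_thetaVec : 1 ≤ ‖thetaVec n θ‖ := by
  have := PiLp.norm_apply_le (thetaVec n θ) 0
  simpa [thetaVec] using this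

lemma hdist_mul_norm_thetaVec (x : EuclideanSpace ℝ (Fin (n + 1))) :
    hdist n θ x * ‖thetaVec n θ‖ = |⟪x, thetaVec n θ⟫| := by
  have hpos : 0 < ‖thetaVec n θ‖ := one_pos.trans_le one_le_norm_thetaVec
  apply le_antisymm
  · set a := ⟪x, thetaVec n θ⟫ / ‖thetaVec n θ‖ ^ 2 with ha
    have hmem : x - a • thetaVec n θ ∈ (lineTheta n θ)ᗮ := by
      rw [lineTheta, Submodule.mem_orthogonal_singleton_iff_inner_left, inner_sub_left,
        real_inner_smul_left, real_inner_self_eq_norm_sq, ha]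
      field_simp
      simp
    have hle : hdist n θ x ≤ ‖a • thetaVec n θ‖ := by
      refine (Metric.infDist_le_dist_of_mem hmem).trans_eq ?_
      rw [dist_eq_norm, sub_sub_cancel]
    calc hdist n θ x * ‖thetaVec n θ‖ ≤ ‖a • thetaVec n θ‖ * ‖thetaVec n θ‖ := by gcongr
      _ = |⟪x, thetaVec n θ⟫| := by
        rw [norm_smul, Real.norm_eq_abs, ha, abs_div, abs_of_pos (pow_pos hpos 2)]
        field_simp
  · rw [← div_le_iff₀ hpos, hdist, Metric.le_infDist ⟨0, Submodule.zero_mem _⟩]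
    intro w hw
    have hw' : ⟪w, thetaVec n θ⟫ = 0 :=
      (Submodule.mem_orthogonal_singleton_iff_inner_left).1 hw
    rw [div_le_iff₀ hpos, dist_eq_norm]
    calc |⟪x, thetaVec n θ⟫| = |⟪x - w, thetaVec n θ⟫| := by rw [inner_sub_left, hw', sub_zero]
      _ ≤ _ := abs_real_inner_le_norm _ _

lemma norm_le_rdist_add_inner (x : EuclideanSpace ℝ (Fin (n + 1))) :
    ‖x‖ ≤ 2 * rdist n θ x + |⟪x, thetaVec n θ⟫| := by
  suffices h : (‖x‖ - |⟪x, thetaVec n θ⟫|) / 2 ≤ rdist n θ x by linarith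
  rw [rdist, Metric.le_infDist ⟨0, Submodule.zero_mem _⟩]
  intro w hw
  obtain ⟨a, rfl⟩ := Submodule.mem_span_singleton.1 hw
  rw [dist_eq_norm]
  set v := thetaVec n θ with hv
  have h1 : 1 ≤ ‖v‖ := one_le_norm_thetaVec
  have htri : ‖x‖ ≤ ‖x - a • v‖ + ‖a • v‖ := by
    simpa using norm_add_le (x - a • v) (a • v)
  have hmul : ‖a • v‖ * ‖v‖ ≤ (|⟪x, v⟫| + ‖x - a • v‖) * ‖v‖ := by
    calc ‖a • v‖ * ‖v‖ = |⟪a • v, v⟫| := by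
          rw [real_inner_smul_left, real_inner_self_eq_norm_sq, abs_mul, norm_smul,
            Real.norm_eq_abs, abs_of_nonneg (sq_nonneg ‖v‖)]
          ring
      _ = |⟪x, v⟫ - ⟪x - a • v, v⟫| := by rw [← inner_sub_left, sub_sub_cancel]
      _ ≤ |⟪x, v⟫| + |⟪x - a • v, v⟫| := abs_sub _ _
      _ ≤ |⟪x, v⟫| * ‖v‖ + ‖x - a • v‖ * ‖v‖ :=
        add_le_add (le_mul_of_one_le_right (abs_nonneg _) h1) (abs_real_inner_le_norm _ _)
      _ = _ := by ring
  have := le_of_mul_le_mul_right hmul (by linarith)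
  linarith

lemma norm_intPt_sub_smul_thetaVec_le {q : ℕ} {a : Fin n → ℤ} {δ : ℝ}
    (h : ∀ i, |q * θ i - a i| ≤ δ) :
    ‖intPt n (Fin.cons (q : ℤ) a) - (q : ℝ) • thetaVec n θ‖ ≤ n * δ := by
  have hδ : 0 < n → 0 ≤ δ := fun hn => (abs_nonneg _).trans (h ⟨0, hn⟩)
  have hnδ : 0 ≤ n * δ := by
    rcases n.eq_zero_or_pos with rfl | hn
    · simp
    · have := hδ hn; positivity
  rw [EuclideanSpace.norm_eq]
  refine Real.sqrt_le_iff.2 ⟨hnδ, ?_⟩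
  have hterm : ∀ i, (a i - q * θ i) ^ 2 ≤ δ ^ 2 := fun i => by
    rw [← sq_abs, abs_sub_comm]
    exact pow_le_pow_left₀ (abs_nonneg _) (h i) 2
  have hsum : ∑ i, (a i - q * θ i) ^ 2 ≤ n * δ ^ 2 := by
    simpa using Finset.sum_le_sum fun i (_ : i ∈ Finset.univ) => hterm i
  have hn2 : (n : ℝ) ≤ (n : ℝ) ^ 2 := by exact_mod_cast Nat.le_self_pow two_ne_zero n
  rw [Fin.sum_univ_succ]
  simp only [intPt, thetaVec, Real.norm_eq_abs, sq_abs]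
  simp
  nlinarith [sq_nonneg δ]

lemma exists_int_inner_intPt (a b : Fin (n + 1) → ℤ) :
    ∃ z : ℤ, ⟪intPt n a, intPt n b⟫ = z := by
  refine ⟨∑ i, b i * a i, ?_⟩
  simp [intPt, PiLp.inner_apply]

end Distances

/-- linear independence criterion: under Nesterenko'\''s Diophantine hypotheses,
the dimension of the `ℚ`-vector space spanned by `1, θ₁, …, θₙ` inside `ℝ` is at least
`(1+β)/(1+β-α)`. -/
theorem stmt18 (n : ℕ) (hn : 2 ≤ n) (θ : Fin n → ℝ)
    (α β c₁ c₂ : ℝ) (hα : 0 < α) (hβ : 0 < β) (hc₁ : 0 < c₁) (hc₂ : 0 < c₂)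
    (hαβ : α ≤ β)
    (t : ℕ → ℝ) (htpos : ∀ k, 0 < t k) (htmono : StrictMono t)
    (htlim : Filter.Tendsto t Filter.atTop Filter.atTop)
    (htlog : Filter.limsup (fun k => Real.log (t (k+1)) / Real.log (t k)) Filter.atTop = 1)
    (happrox : ∀ᶠ k in Filter.atTop, ∃ m : Fin (n+1) → ℤ,
      rdist n θ (intPt n m) ≤ t k ∧
      c₁ * t k ^ (-β) ≤ hdist n θ (intPt n m) ∧ hdist n θ (intPt n m) ≤ c₂ * t k ^ (-α)) :
    (1 + β) / (1 + β - α) ≤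
      (Module.finrank ℚ (Submodule.span ℚ (insert (1 : ℝ) (Set.range θ))) : ℝ) := by
  by_contra! hlt
  obtain ⟨m, hm, D, hD, C, hC, hsim⟩ := exists_simultaneous_approx_of_finrank θ
  have hm0 : (0 : ℝ) ≤ m := m.cast_nonneg
  have hgap : m * (1 + β - α) < α := by
    rw [hm, lt_div_iff₀ (by linarith)] at hlt
    push_cast at hlt
    linarith
  obtain ⟨s, hs, hms⟩ : ∃ s : ℝ, 1 < s ∧ m * ((1 + β) * s - α) < α := by
    have hden : 0 < m * (1 + β) + 1 := by positivity
    set ε := (α - m * (1 + β - α)) / (m * (1 + β) + 1) with hε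
    have hε0 : 0 < ε := div_pos (by linarith) hden
    have hεmul : ε * (m * (1 + β) + 1) = α - m * (1 + β - α) := div_mul_cancel₀ _ hden.ne'
    exact ⟨1 + ε, by linarith, by linarith⟩
  set ρ := (1 + β) * s / α - 1 with hρ
  have hρ0 : 0 ≤ ρ := by
    rw [hρ, sub_nonneg, le_div_iff₀ hα]
    nlinarith
  have hmρ : m * ρ < 1 := by
    have e : m * ρ = m * ((1 + β) * s - α) / α := by rw [hρ]; field_simp
    rwa [e, div_lt_one hα]
  obtain ⟨K, hK⟩ := Filter.eventually_atTop.1 ((htlim.eventually_ge_atTop 1).and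
    ((eventually_succ_le_rpow_of_limsup htlim htlog hs).and happrox))
  set v := thetaVec n θ with hv
  have hv1 : 1 ≤ ‖v‖ := one_le_norm_thetaVec
  set d₁ := c₁ * ‖v‖ with hd₁
  set d₂ := c₂ * ‖v‖ with hd₂
  have hd₁0 : 0 < d₁ := by positivity
  have hd₂0 : 0 < d₂ := by positivity
  obtain ⟨M, hM⟩ := exists_nat_gt (t K ^ α / (2 * d₂))
  have hM0 : (0 : ℝ) < M := lt_of_le_of_lt (by have := htpos K; positivity) hM
  have hD0 : (0 : ℝ) < D := by exact_mod_cast hD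
  obtain ⟨N, hN, hNlt⟩ := exists_nat_rpow_lt (m := m) (ρ := ρ)
    (F := n * (M * C) * (2 + d₂) * (2 * d₂)) (G := 2 * d₂ * (M * D)) (c := d₁)
    (by positivity) hd₁0 hmρ
  have hN0 : (0 : ℝ) < N := by exact_mod_cast hN
  obtain ⟨q', hq', hq'N, hq'θ⟩ := hsim N hN
  choose a' ha' using hq'θ
  have hq'1 : (1 : ℝ) ≤ q' := by exact_mod_cast hq'
  have hq'N' : (q' : ℝ) ≤ D * N ^ m := by exact_mod_cast hq'N
  let q : ℕ := M * q'
  have hq : (q : ℝ) = M * q' := by simp [q]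
  have hq0 : (0 : ℝ) < q := by rw [hq]; positivity
  have happq : ∀ i, |q * θ i - (M * a' i : ℤ)| ≤ M * C / N := fun i => by
    have e : q * θ i - ((M * a' i : ℤ) : ℝ) = M * (q' * θ i - a' i) := by
      rw [hq]; push_cast; ring
    rw [e, abs_mul, Nat.abs_cast, mul_div_assoc]
    exact mul_le_mul_of_nonneg_left (ha' i) hM0.le
  set u := intPt n (Fin.cons (q : ℤ) fun i => M * a' i) with hu
  have hue : ‖u - (q : ℝ) • v‖ ≤ n * (M * C / N) := norm_intPt_sub_smul_thetaVec_le happq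
  set Y := 2 * d₂ * q with hY
  have hY0 : 0 < Y := by positivity
  have hKY : t K < Y ^ α⁻¹ := by
    rw [Real.lt_rpow_inv_iff_of_pos (htpos K).le hY0.le hα]
    rw [div_lt_iff₀ (by positivity)] at hM
    calc t K ^ α < M * (2 * d₂) := hM
      _ ≤ M * (2 * d₂) * q' := le_mul_of_one_le_right (by positivity) hq'1
      _ = Y := by rw [hY, hq]; ring
  obtain ⟨k, hk, hYk, hkY⟩ := exists_le_and_le_rpow htlim (by linarith) (fun k _ => (htpos k).le)
    (fun k hk => (hK k hk).2.1) hKY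
  obtain ⟨htk1, -, x, hrx, hhx₁, hhx₂⟩ := hK k hk
  have htk0 := htpos k
  set L := |⟪intPt n x, v⟫| with hL
  have hLh : hdist n θ (intPt n x) * ‖v‖ = L := hdist_mul_norm_thetaVec _
  have hL₁ : d₁ * t k ^ (-β) ≤ L := by
    rw [← hLh, hd₁, mul_right_comm]
    gcongr
  have hL₂ : L ≤ d₂ * t k ^ (-α) := by
    rw [← hLh, hd₂, mul_right_comm]
    gcongr
  have hqL : q * L ≤ 1 / 2 := by
    rw [Real.rpow_inv_le_iff_of_pos hY0.le htk0.le hα] at hYk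
    calc q * L ≤ q * (d₂ * t k ^ (-α)) := by gcongr
      _ = Y * t k ^ (-α) / 2 := by rw [hY]; ring
      _ ≤ t k ^ α * t k ^ (-α) / 2 := by gcongr
      _ = 1 / 2 := by rw [← Real.rpow_add htk0]; simp
  have hxnorm : ‖intPt n x‖ ≤ (2 + d₂) * t k := by
    have h1 : t k ^ (-α) ≤ 1 := Real.rpow_le_one_of_one_le_of_nonpos htk1 (by linarith)
    have h2 : d₂ * t k ^ (-α) ≤ d₂ * t k := by gcongr; linarith
    have := norm_le_rdist_add_inner (θ := θ) (intPt n x)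
    linarith
  have hpow : t k ^ (1 + β) ≤ Y ^ ρ * Y := by
    calc t k ^ (1 + β) ≤ ((Y ^ α⁻¹) ^ s) ^ (1 + β) := by gcongr
      _ = Y ^ (ρ + 1) := by
        rw [← Real.rpow_mul hY0.le, ← Real.rpow_mul hY0.le, hρ]
        congr 1
        field_simp
        ring
      _ = Y ^ ρ * Y := by rw [Real.rpow_add hY0, Real.rpow_one]
  have hYN : Y ≤ 2 * d₂ * (M * D) * N ^ m := by
    calc Y = 2 * d₂ * M * q' := by rw [hY, hq]; ring
      _ ≤ 2 * d₂ * M * (D * N ^ m) := by gcongr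
      _ = _ := by ring
  have hmain : n * (M * C) * (2 + d₂) * t k ^ (1 + β) < d₁ * N * q := by
    calc n * (M * C) * (2 + d₂) * t k ^ (1 + β)
        ≤ n * (M * C) * (2 + d₂) * (Y ^ ρ * Y) := by gcongr
      _ = n * (M * C) * (2 + d₂) * (2 * d₂) * Y ^ ρ * q := by
        conv_lhs => rw [← mul_assoc]
        nth_rewrite 2 [hY]
        ring
      _ ≤ n * (M * C) * (2 + d₂) * (2 * d₂) * (2 * d₂ * (M * D) * N ^ m) ^ ρ * q := by gcongr
      _ < d₁ * N * q := by gcongr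
  have herr : ‖intPt n x‖ * ‖u - (q : ℝ) • v‖ < q * L := by
    calc ‖intPt n x‖ * ‖u - (q : ℝ) • v‖ ≤ ((2 + d₂) * t k) * (n * (M * C / N)) := by gcongr
      _ = n * (M * C) * (2 + d₂) * t k ^ (1 + β) * t k ^ (-β) / N := by
        rw [mul_assoc _ (t k ^ (1 + β)), ← Real.rpow_add htk0, add_neg_cancel_right,
          Real.rpow_one]
        ring
      _ < d₁ * N * q * t k ^ (-β) / N := by gcongr
      _ = q * (d₁ * t k ^ (-β)) := by field_simp
      _ ≤ q * L := by gcongr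
  obtain ⟨z, hz⟩ := exists_int_inner_intPt x (Fin.cons (q : ℤ) fun i => M * a' i)
  have hzsum : (z : ℝ) = ⟪intPt n x, u - (q : ℝ) • v⟫ + q * ⟪intPt n x, v⟫ := by
    rw [← hz, inner_sub_right, real_inner_smul_right, sub_add_cancel]
  have hin := (abs_real_inner_le_norm (intPt n x) (u - (q : ℝ) • v)).trans_lt herr
  have hqabs : |q * ⟪intPt n x, v⟫| = q * L := by rw [abs_mul, Nat.abs_cast]
  have hz1 : |(z : ℝ)| < 1 := by
    rw [hzsum]
    linarith [abs_add_le ⟪intPt n x, u - (q : ℝ) • v⟫ (q * ⟪intPt n x, v⟫)]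
  have hz0 : z = 0 := by
    rw [← Int.abs_lt_one_iff]
    exact_mod_cast hz1
  rw [hz0, Int.cast_zero] at hzsum
  rw [eq_neg_of_add_eq_zero_left hzsum.symm, abs_neg, hqabs] at hin
  exact lt_irrefl _ hin
end
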